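/- (Scattering / existence of the asymptotic state) Let 4/5 < s < 1, let φ₀ ∈ C_c^∞(ℝ³), and let φ be a smooth decaying global solution of the cubic defocusing NLS on [0,∞) × ℝ³ with φ(0,·) = φ₀. Then there exists a measurable function g : ℝ³ → ℂ with ∫_{ℝ³} (1+|ξ|²)^s |g(ξ)|² dξ < ∞ such that lim_{t → ∞} ∫_{ℝ³} (1+|ξ|²)^s | 𝓕(φ(t,·))(ξ) − e^{−4π² i t |ξ|²} g(ξ) |² dξ = 0; that is, φ(t) converges in H^s(ℝ³) to the free Schrödinger evolution e^{itΔ}φ⁺ of the state φ⁺ with 𝓕φ⁺ = g. -/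

import Mathlib

open MeasureTheory Real Complex Filter
open scoped FourierTransform ContDiff ENNReal

noncomputable section

abbrev E3 := EuclideanSpace ℝ (Fin 3)

/-- the `i`-th standard basis vector of `ℝ³`. -/
def e3 (i : Fin 3) : E3 := EuclideanSpace.single i (1 : ℝ)

/-- the `i`-th spatial partial derivative. -/
def pd (g : E3 → ℂ) (i : Fin 3) (x : E3) : ℂ := fderiv ℝ g x (e3 i)

/-- the (spatial) Laplacian. -/
def lap (g : E3 → ℂ) (x : E3) : ℂ := ∑ i : Fin 3, fderiv ℝ (fun y => pd g i y) x (e3 i)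

/-- the antiderivative `F(z) = ∫₀^z f(s) ds` of `f`. -/
def Fa (f : ℝ → ℝ) (z : ℝ) : ℝ := ∫ s in (0:ℝ)..z, f s

/-- `u` is a smooth decaying solution of the gNLS `i ∂ₜ u + α Δ u = μ f(|u|²) u`
on `[0,T] × ℝ³`: it is jointly smooth, every time derivative slice is a Schwartz
function of `x`, and the equation holds pointwise on `[0,T] × ℝ³`. -/
structure IsSolution (α μ : ℝ) (f : ℝ → ℝ) (T : ℝ) (u : ℝ → E3 → ℂ) : Prop where
  smooth : ContDiff ℝ ∞ (fun p : ℝ × E3 => u p.1 p.2)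
  schwartz : ∀ (k : ℕ) (t : ℝ), ∃ g : SchwartzMap E3 ℂ,
      ∀ x, iteratedDeriv k (fun s => u s x) t = g x
  eqn : ∀ t ∈ Set.Icc (0:ℝ) T, ∀ x : E3,
      Complex.I * deriv (fun s => u s x) t + (α : ℂ) * lap (u t) x
        = ((μ * f (Complex.normSq (u t x)) : ℝ) : ℂ) * u t x

/-- the `i`-th component of the mass current `Im (conj u ∇u)`. -/
def massCur (g : E3 → ℂ) (i : Fin 3) (x : E3) : ℝ := ((starRingEnd ℂ) (g x) * pd g i x).im

/-- the Morawetz action centered at `y`. -/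
def morAction (g : E3 → ℂ) (y : E3) : ℝ :=
  ∫ x : E3, ∑ i : Fin 3, massCur g i x * ((x i - y i) / ‖x - y‖)

/-- `|∇̸_y g(x)|²`, the squared norm of the angular part of the gradient. -/
def angGradSq (g : E3 → ℂ) (y x : E3) : ℝ :=
  ∑ i : Fin 3, Complex.normSq (pd g i x -
    (((x i - y i) / ‖x - y‖ : ℝ) : ℂ) *
      ∑ j : Fin 3, (((x j - y j) / ‖x - y‖ : ℝ) : ℂ) * pd g j x)

/-- squared homogeneous Sobolev norm `‖g‖²_{Ḣ^σ}`. -/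
def sobSq (σ : ℝ) (g : E3 → ℂ) : ℝ := ∫ ξ : E3, ‖ξ‖ ^ (2 * σ) * ‖𝓕 g ξ‖ ^ 2


/-- `u` is a smooth decaying global solution of the gNLS `i ∂ₜ u + α Δ u = μ f(|u|²) u`
on `[0,∞) × ℝ³`. -/
structure IsGlobalSolution (α μ : ℝ) (f : ℝ → ℝ) (u : ℝ → E3 → ℂ) : Prop where
  smooth : ContDiff ℝ ∞ (fun p : ℝ × E3 => u p.1 p.2)
  schwartz : ∀ (k : ℕ) (t : ℝ), ∃ g : SchwartzMap E3 ℂ,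
      ∀ x, iteratedDeriv k (fun s => u s x) t = g x
  eqn : ∀ t ≥ (0:ℝ), ∀ x : E3,
      Complex.I * deriv (fun s => u s x) t + (α : ℂ) * lap (u t) x
        = ((μ * f (Complex.normSq (u t x)) : ℝ) : ℂ) * u t x

/-- squared inhomogeneous Sobolev norm `‖g‖²_{H^s}`. -/
def inhomSobSq (s : ℝ) (g : E3 → ℂ) : ℝ :=
  ∫ ξ : E3, (1 + ‖ξ‖ ^ 2) ^ s * ‖𝓕 g ξ‖ ^ 2

/-- the inhomogeneous Sobolev norm `‖g‖_{H^s}`. -/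
def hsNorm (s : ℝ) (g : E3 → ℂ) : ℝ := Real.sqrt (inhomSobSq s g)

section Helpers

open scoped SchwartzMap Convolution Topology

section Part1


open scoped SchwartzMap Convolution

abbrev SW := SchwartzMap E3 ℂ

lemma young_pt (G : E3 → ℝ≥0∞) (hG : Measurable G) (x : E3) :
    (∫⁻ y, G y * G (x - y)) ^ (2:ℝ) ≤
      (∫⁻ y, G y ^ (4/3:ℝ) * G (x - y) ^ (4/3:ℝ)) * ∫⁻ y, G y ^ (4/3:ℝ) := by
  have hm : Measurable fun y => G (x - y) := hG.comp (measurable_const.sub measurable_id)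
  set a : E3 → ℝ≥0∞ := fun y => (G y * G (x - y)) ^ (2/3:ℝ)
  set b : E3 → ℝ≥0∞ := fun y => (G y * G (x - y)) ^ (1/3:ℝ)
  have hab : ∀ y, G y * G (x - y) = (a * b) y := by
    intro y
    simp only [a, b, Pi.mul_apply]
    rw [← ENNReal.rpow_add_of_nonneg _ _ (by norm_num) (by norm_num)]
    norm_num
  have h1 : (∫⁻ y, G y * G (x - y)) ≤
      (∫⁻ y, a y ^ (2:ℝ)) ^ (1/2:ℝ) * (∫⁻ y, b y ^ (2:ℝ)) ^ (1/2:ℝ) := by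
    simp_rw [hab]
    exact ENNReal.lintegral_mul_le_Lp_mul_Lq volume Real.HolderConjugate.two_two
      ((hG.mul hm).pow_const _).aemeasurable ((hG.mul hm).pow_const _).aemeasurable
  have hs : ∀ z : ℝ≥0∞, (z ^ (1/2:ℝ)) ^ (2:ℝ) = z := by
    intro z; rw [← ENNReal.rpow_mul]; norm_num
  have h2 : (∫⁻ y, G y * G (x - y)) ^ (2:ℝ) ≤ (∫⁻ y, a y ^ (2:ℝ)) * (∫⁻ y, b y ^ (2:ℝ)) := by
    calc _ ≤ _ := ENNReal.rpow_le_rpow h1 (by norm_num)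
      _ = _ := by rw [ENNReal.mul_rpow_of_nonneg _ _ (by norm_num), hs, hs]
  refine h2.trans ?_
  have ha : ∀ y, a y ^ (2:ℝ) = G y ^ (4/3:ℝ) * G (x - y) ^ (4/3:ℝ) := by
    intro y
    simp only [a]
    rw [← ENNReal.rpow_mul, ENNReal.mul_rpow_of_nonneg _ _ (by norm_num)]; norm_num
  simp_rw [ha]
  refine mul_le_mul' le_rfl ?_
  have h3 : ∫⁻ y, b y ^ (2:ℝ) ≤ (∫⁻ y, (G y ^ (2/3:ℝ)) ^ (2:ℝ)) ^ (1/2:ℝ) *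
      (∫⁻ y, (G (x - y) ^ (2/3:ℝ)) ^ (2:ℝ)) ^ (1/2:ℝ) := by
    have : ∀ y, b y ^ (2:ℝ) = ((fun y => G y ^ (2/3:ℝ)) * fun y => G (x - y) ^ (2/3:ℝ)) y := by
      intro y
      simp only [b, Pi.mul_apply]
      rw [← ENNReal.rpow_mul, ENNReal.mul_rpow_of_nonneg _ _ (by norm_num)]; norm_num
    simp_rw [this]
    exact ENNReal.lintegral_mul_le_Lp_mul_Lq volume Real.HolderConjugate.two_two
      (hG.pow_const _).aemeasurable (hm.pow_const _).aemeasurable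
  refine h3.trans (le_of_eq ?_)
  have h4 : (∫⁻ y, (G (x - y) ^ (2/3:ℝ)) ^ (2:ℝ)) = ∫⁻ y, (G y ^ (2/3:ℝ)) ^ (2:ℝ) :=
    lintegral_sub_left_eq_self (fun y => (G y ^ (2/3:ℝ)) ^ (2:ℝ)) x
  rw [h4, ← ENNReal.rpow_add_of_nonneg _ _ (by norm_num) (by norm_num)]
  simp_rw [← ENNReal.rpow_mul]
  norm_num

lemma young_43 (G : E3 → ℝ≥0∞) (hG : Measurable G) :
    ∫⁻ x, (∫⁻ y, G y * G (x - y)) ^ (2:ℝ) ≤ (∫⁻ y, G y ^ (4/3:ℝ)) ^ 3 := by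
  calc ∫⁻ x, (∫⁻ y, G y * G (x - y)) ^ (2:ℝ)
      ≤ ∫⁻ x, (∫⁻ y, G y ^ (4/3:ℝ) * G (x - y) ^ (4/3:ℝ)) * ∫⁻ y, G y ^ (4/3:ℝ) :=
        lintegral_mono fun x => young_pt G hG x
    _ = (∫⁻ x, (∫⁻ y, G y ^ (4/3:ℝ) * G (x - y) ^ (4/3:ℝ))) * ∫⁻ y, G y ^ (4/3:ℝ) := by
        rw [lintegral_mul_const]
        have hm : Measurable fun p : E3 × E3 => G p.2 ^ (4/3:ℝ) * G (p.1 - p.2) ^ (4/3:ℝ) := by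
          fun_prop
        exact hm.lintegral_prod_right'
    _ = ((∫⁻ y, G y ^ (4/3:ℝ)) * (∫⁻ y, G y ^ (4/3:ℝ))) * ∫⁻ y, G y ^ (4/3:ℝ) := by
        congr 1
        rw [lintegral_lintegral_swap]
        · have : ∀ y, ∫⁻ x, G y ^ (4/3:ℝ) * G (x - y) ^ (4/3:ℝ) =
              G y ^ (4/3:ℝ) * ∫⁻ x, G x ^ (4/3:ℝ) := by
            intro y
            rw [lintegral_const_mul _ (by fun_prop)]
            congr 1
            exact lintegral_sub_right_eq_self (fun x => G x ^ (4/3:ℝ)) y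
          simp_rw [this]
          rw [lintegral_mul_const _ (by fun_prop)]
        · fun_prop
    _ = _ := by ring

lemma plancherel_lint (f : SW) : ∫⁻ ξ, ‖𝓕 f ξ‖ₑ ^ (2:ℝ) = ∫⁻ x, ‖f x‖ₑ ^ (2:ℝ) := by
  have key : ∀ g : SW, ∫⁻ x, ‖g x‖ₑ ^ (2:ℝ) = ENNReal.ofReal (∫ x, ‖g x‖ ^ 2) := by
    intro g
    rw [ofReal_integral_eq_lintegral_ofReal]
    · congr 1; ext x
      rw [← ofReal_norm, ENNReal.ofReal_rpow_of_nonneg (norm_nonneg _) (by norm_num)]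
      norm_num
    · exact (g.memLp 2 volume).integrable_norm_pow (by norm_num)
    · exact Eventually.of_forall fun x => by positivity
  rw [key, key, SchwartzMap.integral_norm_sq_fourier]

lemma hy_lint (g : SW) : ∫⁻ ξ, ‖𝓕 g ξ‖ₑ ^ (4:ℝ) ≤ (∫⁻ x, ‖g x‖ₑ ^ (4/3:ℝ)) ^ 3 := by
  set B := ContinuousLinearMap.mul ℂ ℂ
  have h1 : ∀ ξ, ‖𝓕 g ξ‖ₑ ^ (4:ℝ) = ‖𝓕 (SchwartzMap.convolution B g g) ξ‖ₑ ^ (2:ℝ) := by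
    intro ξ
    rw [SchwartzMap.fourier_convolution, SchwartzMap.pairing_apply_apply]
    simp only [B, ContinuousLinearMap.mul_apply', enorm_mul]
    rw [← sq, ← ENNReal.rpow_natCast, ← ENNReal.rpow_mul]; norm_num
  simp_rw [h1]
  rw [plancherel_lint]
  refine le_trans (lintegral_mono fun x => ?_) (young_43 (fun x => ‖g x‖ₑ) (by fun_prop))
  apply ENNReal.rpow_le_rpow _ (by norm_num)
  rw [SchwartzMap.convolution_apply, MeasureTheory.convolution_def]
  refine (enorm_integral_le_lintegral_enorm _).trans (le_of_eq ?_)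
  simp [B, enorm_mul]

lemma hy (g : SW) : eLpNorm (𝓕 g : SW) 4 volume ≤ eLpNorm g (4/3) volume := by
  rw [eLpNorm_eq_lintegral_rpow_enorm_toReal (by norm_num) (by norm_num),
    eLpNorm_eq_lintegral_rpow_enorm_toReal (by norm_num) (ENNReal.div_ne_top (by norm_num) (by norm_num))]
  have e1 : (4:ℝ≥0∞).toReal = 4 := by norm_num
  have e2 : (4/3:ℝ≥0∞).toReal = 4/3 := by simp [ENNReal.toReal_div]
  rw [e1, e2]
  calc _ ≤ ((∫⁻ x, ‖g x‖ₑ ^ (4/3:ℝ)) ^ 3) ^ (1/4:ℝ) :=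
        ENNReal.rpow_le_rpow (hy_lint g) (by norm_num)
    _ = _ := by
      rw [← ENNReal.rpow_natCast, ← ENNReal.rpow_mul]; norm_num

end Part1

section Part2


open scoped SchwartzMap Convolution

/-- the Schrödinger multiplier -/
def mS (σ : ℝ) (ξ : E3) : ℂ := Complex.exp (((-4) * π ^ 2 * σ * ‖ξ‖ ^ 2 : ℝ) * Complex.I)

lemma tg_expI : Function.HasTemperateGrowth (fun r : ℝ => Complex.exp ((r:ℂ) * Complex.I)) := by
  have hit : ∀ n : ℕ, iteratedDeriv n (fun r : ℝ => Complex.exp ((r:ℂ) * Complex.I)) =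
      fun r : ℝ => Complex.I ^ n * Complex.exp ((r:ℂ) * Complex.I) := by
    intro n
    induction n with
    | zero => simp
    | succ n ih =>
      rw [iteratedDeriv_succ, ih]
      ext r
      have h1 : HasDerivAt (fun r : ℝ => Complex.exp ((r:ℂ) * Complex.I))
          (Complex.exp ((r:ℂ) * Complex.I) * (1 * Complex.I)) r :=
        ((Complex.ofRealCLM.hasDerivAt (x := r)).mul_const Complex.I).cexp
      rw [(h1.const_mul _).deriv]
      ring
  constructor
  · have : ContDiff ℝ ∞ (fun r : ℝ => Complex.exp ((Complex.ofRealCLM r) * Complex.I)) := by fun_prop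
    exact this
  · intro n
    refine ⟨0, 1, fun x => ?_⟩
    rw [norm_iteratedFDeriv_eq_norm_iteratedDeriv, hit]
    simp [Complex.norm_exp_ofReal_mul_I]

lemma tg_mS (σ : ℝ) : Function.HasTemperateGrowth (mS σ) := by
  have h : Function.HasTemperateGrowth (fun ξ : E3 => (-4) * π ^ 2 * σ * ‖ξ‖ ^ 2) :=
    (Function.HasTemperateGrowth.const _).mul (Function.hasTemperateGrowth_norm_sq E3)
  exact tg_expI.comp h

lemma norm_mS (σ : ℝ) (ξ : E3) : ‖mS σ ξ‖ = 1 := Complex.norm_exp_ofReal_mul_I _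

lemma mS_add (σ τ : ℝ) (ξ : E3) : mS (σ + τ) ξ = mS σ ξ * mS τ ξ := by
  unfold mS; rw [← Complex.exp_add]; congr 1; push_cast; ring

lemma mS_zero (ξ : E3) : mS 0 ξ = 1 := by simp [mS]

lemma mS_conj (σ : ℝ) (ξ : E3) : (starRingEnd ℂ) (mS σ ξ) = mS (-σ) ξ := by
  unfold mS; rw [← Complex.exp_conj, map_mul, Complex.conj_ofReal, Complex.conj_I]
  congr 1; push_cast; ring

/-- the free propagator on Schwartz space -/
def S (σ : ℝ) (f : SW) : SW := SchwartzMap.fourierMultiplierCLM ℂ (mS σ) f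

lemma S_fourier (σ : ℝ) (f : SW) (ξ : E3) : 𝓕 (S σ f) ξ = mS σ ξ * 𝓕 f ξ := by
  unfold S
  rw [SchwartzMap.fourierMultiplierCLM_apply]
  simp [SchwartzMap.smulLeftCLM_apply_apply (tg_mS σ)]

lemma sw_ext_fourier {f g : SW} (h : ∀ ξ, 𝓕 f ξ = 𝓕 g ξ) : f = g := by
  have : 𝓕 f = 𝓕 g := by ext ξ; exact h ξ
  have h2 : 𝓕⁻ (𝓕 f) = 𝓕⁻ (𝓕 g) := by rw [this]
  simpa using h2

lemma S_add (σ τ : ℝ) (f : SW) : S (σ + τ) f = S σ (S τ f) := by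
  apply sw_ext_fourier; intro ξ
  rw [S_fourier, S_fourier, S_fourier, mS_add]; ring

lemma S_zero (f : SW) : S 0 f = f := by
  apply sw_ext_fourier; intro ξ; rw [S_fourier, mS_zero, one_mul]

lemma S_apply (σ : ℝ) (f : SW) (x : E3) :
    S σ f x = ∫ ξ, Complex.exp ((2 * π * inner ℝ ξ x : ℝ) * Complex.I) * (mS σ ξ * 𝓕 f ξ) := by
  have h : S σ f = 𝓕⁻ (𝓕 (S σ f)) := by simp
  rw [h, SchwartzMap.fourierInv_coe, Real.fourierInv_eq']
  refine integral_congr_ae (Eventually.of_forall fun ξ => ?_)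
  simp only [smul_eq_mul, S_fourier]

/-- derivative in direction e_i as a Schwartz function -/
def dS (i : Fin 3) (f : SW) : SW := LineDeriv.lineDerivOp (e3 i) f

lemma dS_apply (i : Fin 3) (f : SW) (x : E3) : dS i f x = fderiv ℝ f x (e3 i) :=
  SchwartzMap.lineDerivOp_apply_eq_fderiv _ _ _

lemma inner_e3 (i : Fin 3) (ξ : E3) : inner ℝ ξ (e3 i) = ξ i := by
  simp [e3, EuclideanSpace.inner_single_right]

lemma dS_fourier (i : Fin 3) (f : SW) (ξ : E3) :
    𝓕 (dS i f) ξ = (2 * π * Complex.I) * (ξ i : ℂ) * 𝓕 f ξ := by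
  unfold dS
  rw [SchwartzMap.fourier_lineDerivOp_eq]
  rw [smul_apply, SchwartzMap.smulLeftCLM_apply_apply]
  · simp [inner_e3]; ring
  · fun_prop

lemma S_dS (σ : ℝ) (i : Fin 3) (f : SW) : S σ (dS i f) = dS i (S σ f) := by
  apply sw_ext_fourier; intro ξ
  rw [S_fourier, dS_fourier, dS_fourier, S_fourier]; ring

/-- the Laplacian on Schwartz functions -/
def lS (f : SW) : SW := ∑ i : Fin 3, dS i (dS i f)

lemma sw_sum_apply (F : Fin 3 → SW) (x : E3) : (∑ i, F i) x = ∑ i, F i x := by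
  simp [Fin.sum_univ_three]

lemma lS_apply (f : SW) (x : E3) : lS f x = ∑ i, dS i (dS i f) x := by
  unfold lS; rw [sw_sum_apply]

lemma lS_fourier (f : SW) (ξ : E3) :
    𝓕 (lS f) ξ = (-4 * π ^ 2 * ‖ξ‖ ^ 2 : ℝ) * 𝓕 f ξ := by
  have h : 𝓕 (lS f) = ∑ i, 𝓕 (dS i (dS i f)) := by
    unfold lS
    simp [Fin.sum_univ_three, FourierTransform.fourier_add]
  rw [h, sw_sum_apply]
  simp_rw [dS_fourier]
  rw [EuclideanSpace.norm_sq_eq]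
  simp only [Fin.sum_univ_three, Real.norm_eq_abs, sq_abs]
  push_cast
  ring_nf
  rw [Complex.I_sq]; ring

lemma S_lS (σ : ℝ) (f : SW) : S σ (lS f) = lS (S σ f) := by
  apply sw_ext_fourier; intro ξ
  rw [S_fourier, lS_fourier, lS_fourier, S_fourier]; ring

lemma S_int_sq (σ : ℝ) (f : SW) : ∫ x, ‖S σ f x‖ ^ 2 = ∫ x, ‖f x‖ ^ 2 := by
  rw [← SchwartzMap.integral_norm_sq_fourier (S σ f), ← SchwartzMap.integral_norm_sq_fourier f]
  simp_rw [S_fourier, norm_mul, norm_mS, one_mul]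

lemma S_cont (f : SW) : Continuous fun p : ℝ × E3 => S p.1 f p.2 := by
  simp_rw [S_apply]
  apply continuous_of_dominated (bound := fun ξ => ‖𝓕 f ξ‖)
  · intro p
    apply Continuous.aestronglyMeasurable
    have := (𝓕 f).continuous
    unfold mS
    fun_prop
  · intro p
    refine Eventually.of_forall fun ξ => ?_
    rw [norm_mul, Complex.norm_exp_ofReal_mul_I, norm_mul, norm_mS]; simp
  · exact (𝓕 f).integrable.norm
  · refine Eventually.of_forall fun ξ => ?_
    unfold mS
    fun_prop

lemma S_deriv (f : SW) (t : ℝ) (x : E3) :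
    HasDerivAt (fun s => S s f x) (Complex.I * S t (lS f) x) t := by
  have e : Complex.I * S t (lS f) x = ∫ ξ, Complex.exp ((2 * π * inner ℝ ξ x : ℝ) * Complex.I) *
      (mS t ξ * (Complex.I * 𝓕 (lS f) ξ)) := by
    rw [S_apply, ← integral_const_mul]
    congr 1; ext ξ; ring
  rw [e]
  simp_rw [S_apply]
  refine (hasDerivAt_integral_of_dominated_loc_of_deriv_le (𝕜 := ℝ) (s := Set.univ)
    (F := fun s ξ => Complex.exp ((2 * π * inner ℝ ξ x : ℝ) * Complex.I) * (mS s ξ * 𝓕 f ξ))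
    (F' := fun s ξ => Complex.exp ((2 * π * inner ℝ ξ x : ℝ) * Complex.I) *
      (mS s ξ * (Complex.I * 𝓕 (lS f) ξ)))
    (bound := fun ξ => ‖𝓕 (lS f) ξ‖)
    univ_mem ?_ ?_ ?_ ?_ ?_ ?_).2
  · refine Eventually.of_forall fun s => ?_
    apply Continuous.aestronglyMeasurable
    have := (𝓕 f).continuous
    unfold mS
    fun_prop
  · have h := (𝓕 (S t f)).integrable (μ := volume)
    refine h.mono ?_ (Eventually.of_forall fun ξ => ?_)
    · apply Continuous.aestronglyMeasurable
      have := (𝓕 f).continuous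
      unfold mS
      fun_prop
    · rw [S_fourier, norm_mul, Complex.norm_exp_ofReal_mul_I, one_mul]
  · apply Continuous.aestronglyMeasurable
    have := (𝓕 (lS f)).continuous
    unfold mS
    fun_prop
  · refine Eventually.of_forall fun ξ s _ => ?_
    rw [norm_mul, Complex.norm_exp_ofReal_mul_I, norm_mul, norm_mS]; simp
  · exact (𝓕 (lS f)).integrable.norm
  · refine Eventually.of_forall fun ξ s _ => ?_
    have h1 : HasDerivAt (fun s : ℝ => mS s ξ) (mS s ξ * ((-4 * π ^ 2 * ‖ξ‖ ^ 2 : ℝ) * Complex.I)) s := by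
      unfold mS
      apply HasDerivAt.cexp
      apply HasDerivAt.mul_const
      have h0 : HasDerivAt (fun s : ℝ => (-4) * π ^ 2 * s * ‖ξ‖ ^ 2) ((-4) * π ^ 2 * 1 * ‖ξ‖ ^ 2) s :=
        ((hasDerivAt_id s).const_mul _).mul_const _
      exact h0.ofReal_comp.congr_deriv (by push_cast; ring)
    have h2 := (h1.mul_const (𝓕 f ξ)).const_mul (Complex.exp ((2 * π * inner ℝ ξ x : ℝ) * Complex.I))
    exact h2.congr_deriv (by rw [lS_fourier]; ring)

end Part2

section Part3



lemma integrable_gauss (b : ℂ) (hb : 0 < b.re) (x : E3) :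
    Integrable fun v : E3 => cexp (-b * ‖v‖ ^ 2 + 2 * π * Complex.I * (inner ℝ x v : ℝ)) := by
  exact GaussianFourier.integrable_cexp_neg_mul_sq_norm_add hb _ _

lemma gauss_fubini (b : ℂ) (hb : 0 < b.re) (f : SW) (x : E3) :
    ∫ ξ, cexp (-b * ‖ξ‖ ^ 2 + 2 * π * Complex.I * (inner ℝ x ξ : ℝ)) * 𝓕 f ξ =
      (π / b) ^ (3 / 2 : ℂ) * ∫ w, cexp (-π ^ 2 * ‖x - w‖ ^ 2 / b) * f w := by
  have h := VectorFourier.integral_bilin_fourierIntegral_eq_flip (ContinuousLinearMap.mul ℂ ℂ)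
    (L := innerₗ E3) continuous_fourierChar continuous_inner (integrable_gauss b hb x)
    (f.integrable (μ := volume))
  rw [← integral_const_mul]
  have h2 : ∀ w : E3, (π / b) ^ (3 / 2 : ℂ) * (cexp (-π ^ 2 * ‖x - w‖ ^ 2 / b) * f w) =
     𝓕 (fun v : E3 => cexp (-b * ‖v‖ ^ 2 + 2 * π * Complex.I * (inner ℝ x v : ℝ))) w * f w := by
    intro w
    rw [fourier_gaussian_innerProductSpace' hb x w]
    simp; ring
  simp_rw [h2]
  have h3 : (innerₗ E3).flip = innerₗ E3 := by
    ext a c; simp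
  rw [h3] at h
  exact h.symm

lemma S_kernel0 (σ : ℝ) (hσ : σ ≠ 0) (f : SW) (x : E3) :
    S σ f x = (π / ((4 * π ^ 2 * σ : ℝ) * Complex.I)) ^ (3 / 2 : ℂ) *
      ∫ w, cexp (-π ^ 2 * ‖x - w‖ ^ 2 / ((4 * π ^ 2 * σ : ℝ) * Complex.I)) * f w := by
  set c : ℝ := 4 * π ^ 2 * σ with hc
  have hc0 : c ≠ 0 := by positivity
  have hcI : ((c:ℂ) * Complex.I) ≠ 0 := by simp [hc0]
  have hbr : ∀ ε : ℝ, ((ε:ℂ) + c * Complex.I).re = ε := by intro ε; simp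
  have hlim : Tendsto (fun ε : ℝ => (ε:ℂ) + c * Complex.I) (𝓝[>] 0) (𝓝 (c * Complex.I)) := by
    have : Continuous fun ε : ℝ => (ε:ℂ) + c * Complex.I := by fun_prop
    have h := (this.tendsto 0).mono_left (nhdsWithin_le_nhds (s := Set.Ioi (0:ℝ)))
    simpa using h
  have L1 : Tendsto (fun ε : ℝ => ∫ ξ, cexp (-((ε:ℂ) + c * Complex.I) * ‖ξ‖ ^ 2 +
      2 * π * Complex.I * (inner ℝ x ξ : ℝ)) * 𝓕 f ξ) (𝓝[>] 0) (𝓝 (S σ f x)) := by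
    rw [S_apply]
    apply tendsto_integral_filter_of_dominated_convergence (fun ξ => ‖𝓕 f ξ‖)
    · refine Eventually.of_forall fun ε => ?_
      apply Continuous.aestronglyMeasurable
      have := (𝓕 f).continuous
      fun_prop
    · filter_upwards [self_mem_nhdsWithin] with ε hε
      refine Eventually.of_forall fun ξ => ?_
      rw [norm_mul]
      refine mul_le_of_le_one_left (norm_nonneg _) ?_
      rw [Complex.norm_exp]
      apply Real.exp_le_one_iff.mpr
      have : (-((ε:ℂ) + c * Complex.I) * ‖ξ‖ ^ 2 + 2 * π * Complex.I * (inner ℝ x ξ : ℝ)).re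
        = -ε * ‖ξ‖^2 := by
        have hq : ((‖ξ‖:ℂ) ^ 2) = ((‖ξ‖ ^ 2 : ℝ) : ℂ) := by push_cast; rfl
        rw [hq]; simp only [Complex.add_re, Complex.mul_re, Complex.neg_re, Complex.ofReal_re, Complex.ofReal_im,
          Complex.I_re, Complex.I_im, Complex.mul_im, Complex.neg_im, Complex.add_im, Complex.re_ofNat, Complex.im_ofNat]
        ring
      rw [this]
      have : 0 < ε := hε
      nlinarith [sq_nonneg ‖ξ‖]
    · exact (𝓕 f).integrable.norm
    · refine Eventually.of_forall fun ξ => ?_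
      have e : cexp ((2 * π * inner ℝ ξ x : ℝ) * Complex.I) * (mS σ ξ * 𝓕 f ξ) =
        cexp (-(c * Complex.I) * ‖ξ‖ ^ 2 + 2 * π * Complex.I * (inner ℝ x ξ : ℝ)) * 𝓕 f ξ := by
        unfold mS
        rw [← mul_assoc, ← Complex.exp_add]
        congr 2
        rw [real_inner_comm, hc]; push_cast; ring
      rw [e]
      apply Tendsto.mul_const
      apply (Complex.continuous_exp.tendsto _).comp
      apply Tendsto.add_const
      apply Tendsto.mul_const
      exact hlim.neg
  have L2 : Tendsto (fun ε : ℝ => (π / ((ε:ℂ) + c * Complex.I)) ^ (3 / 2 : ℂ) *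
      ∫ w, cexp (-π ^ 2 * ‖x - w‖ ^ 2 / ((ε:ℂ) + c * Complex.I)) * f w) (𝓝[>] 0)
      (𝓝 ((π / (c * Complex.I)) ^ (3 / 2 : ℂ) *
      ∫ w, cexp (-π ^ 2 * ‖x - w‖ ^ 2 / (c * Complex.I)) * f w)) := by
    apply Tendsto.mul
    · have h1 : Tendsto (fun ε : ℝ => (π:ℂ) / ((ε:ℂ) + c * Complex.I)) (𝓝[>] 0)
        (𝓝 (π / (c * Complex.I))) := Tendsto.div tendsto_const_nhds hlim hcI
      refine h1.cpow tendsto_const_nhds ?_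
      right
      simp [Complex.div_im, hc0, Real.pi_ne_zero]
    · apply tendsto_integral_filter_of_dominated_convergence (fun ξ => ‖f ξ‖)
      · refine Eventually.of_forall fun ε => ?_
        apply Continuous.aestronglyMeasurable
        have := f.continuous
        fun_prop
      · filter_upwards [self_mem_nhdsWithin] with ε hε
        refine Eventually.of_forall fun w => ?_
        rw [norm_mul]
        refine mul_le_of_le_one_left (norm_nonneg _) ?_
        rw [Complex.norm_exp]
        apply Real.exp_le_one_iff.mpr
        have : (-π ^ 2 * ‖x - w‖ ^ 2 / ((ε:ℂ) + c * Complex.I)) =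
          ((-π ^ 2 * ‖x - w‖ ^ 2 : ℝ) : ℂ) / ((ε:ℂ) + c * Complex.I) := by push_cast; ring
        rw [this, Complex.div_re]
        have hε' : 0 < ε := hε
        simp only [Complex.ofReal_re, Complex.ofReal_im, hbr, zero_mul, zero_div, add_zero]
        apply div_nonpos_of_nonpos_of_nonneg
        · have : 0 ≤ π ^ 2 * ‖x - w‖ ^ 2 * ε := by positivity
          nlinarith
        · exact Complex.normSq_nonneg _
      · exact f.integrable.norm
      · refine Eventually.of_forall fun w => ?_
        apply Tendsto.mul_const
        apply (Complex.continuous_exp.tendsto _).comp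
        exact Tendsto.div tendsto_const_nhds hlim hcI
  refine tendsto_nhds_unique L1 (L2.congr' ?_)
  filter_upwards [self_mem_nhdsWithin] with ε hε
  exact (gauss_fubini _ (by rw [hbr]; exact hε) f x).symm

/-- multiplication by a quadratic phase -/
def modS (τ : ℝ) (f : SW) : SW := SchwartzMap.smulLeftCLM ℂ (mS τ) f

lemma modS_apply (τ : ℝ) (f : SW) (x : E3) : modS τ f x = mS τ x * f x := by
  unfold modS; rw [SchwartzMap.smulLeftCLM_apply_apply (tg_mS τ)]; rfl

lemma S_kernel (σ : ℝ) (hσ : σ ≠ 0) (f : SW) (x : E3) :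
    ‖S σ f x‖ = (4 * π * |σ|) ^ (-(3/2) : ℝ) *
      ‖𝓕 (modS (-1 / (16 * π ^ 2 * σ)) f) ((4 * π * σ)⁻¹ • x)‖ := by
  have hpi := Real.pi_pos
  rw [S_kernel0 σ hσ, norm_mul]
  congr 1
  · have : (3 / 2 : ℂ) = ((3/2 : ℝ) : ℂ) := by push_cast; ring
    rw [this, Complex.norm_cpow_real, Real.rpow_neg (by positivity), ← Real.inv_rpow (by positivity)]
    congr 1
    rw [norm_div, norm_mul]
    simp only [Complex.norm_real, Complex.norm_I, Real.norm_eq_abs, abs_mul, mul_one]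
    rw [abs_of_pos hpi, abs_of_nonneg (by positivity : (0:ℝ) ≤ π^2)]
    have : |σ| ≠ 0 := by simpa using hσ
    simp
    field_simp
  · rw [SchwartzMap.fourier_coe, Real.fourier_eq']
    have : ∀ w, cexp (-π ^ 2 * ‖x - w‖ ^ 2 / ((4 * π ^ 2 * σ : ℝ) * Complex.I)) * f w =
      cexp ((‖x‖ ^ 2 / (4 * σ) : ℝ) * Complex.I) * (cexp ((-2 * π * inner ℝ w ((4 * π * σ)⁻¹ • x) : ℝ) * Complex.I) •
        modS (-1 / (16 * π ^ 2 * σ)) f w) := by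
      intro w
      rw [modS_apply, smul_eq_mul, mS, ← mul_assoc, ← mul_assoc, ← Complex.exp_add, ← Complex.exp_add]
      congr 2
      have hn : ‖x - w‖ ^ 2 = ‖x‖ ^ 2 - 2 * inner ℝ w x + ‖w‖ ^ 2 := by
        rw [norm_sub_sq_real, real_inner_comm]
      rw [← Complex.ofReal_pow ‖x - w‖ 2, hn, inner_smul_right]
      have h1 : (σ : ℂ) ≠ 0 := by exact_mod_cast hσ
      have h2 : (π : ℂ) ≠ 0 := by exact_mod_cast hpi.ne'
      push_cast
      field_simp
      rw [Complex.I_sq]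
      ring
    simp_rw [this]
    rw [integral_const_mul, norm_mul, Complex.norm_exp_ofReal_mul_I, one_mul]

end Part3

section Part4



/-- the `L⁴` norm -/
def N4 (f : E3 → ℂ) : ℝ := lpNorm f 4 volume
/-- the `L^{4/3}` norm -/
def N43 (f : E3 → ℂ) : ℝ := lpNorm f (4/3) volume

lemma N4_nonneg (f : E3 → ℂ) : 0 ≤ N4 f := lpNorm_nonneg
lemma N43_nonneg (f : E3 → ℂ) : 0 ≤ N43 f := lpNorm_nonneg

lemma ne43 : (4/3:ℝ≥0∞) ≠ ⊤ := ENNReal.div_ne_top (by norm_num) (by norm_num)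
lemma ne43' : (4/3:ℝ≥0∞) ≠ 0 := by simp
lemma toReal43 : (4/3:ℝ≥0∞).toReal = 4/3 := by simp [ENNReal.toReal_div]
lemma one_le_43 : (1:ℝ≥0∞) ≤ 4/3 := by
  rw [ENNReal.le_div_iff_mul_le (by simp) (by simp)]; norm_num

lemma N4_pow {f : E3 → ℂ} (hf : AEStronglyMeasurable f volume) : N4 f ^ 4 = ∫ x, ‖f x‖ ^ 4 := by
  unfold N4
  rw [lpNorm_eq_integral_norm_rpow_toReal (by norm_num) (by norm_num) hf]
  have e1 : (4:ℝ≥0∞).toReal = 4 := by norm_num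
  rw [e1, ← Real.rpow_natCast, ← Real.rpow_mul]
  · norm_num
  · exact integral_nonneg fun x => by positivity

lemma N43_eq {f : E3 → ℂ} (hf : AEStronglyMeasurable f volume) :
    N43 f = (∫ x, ‖f x‖ ^ (4/3:ℝ)) ^ (3/4:ℝ) := by
  unfold N43
  rw [lpNorm_eq_integral_norm_rpow_toReal (by simp) ne43 hf, toReal43]
  norm_num

instance ht1 : ENNReal.HolderTriple (4/3) 4 1 where
  inv_add_inv_eq_inv := by
    rw [ENNReal.inv_div (by simp) (by simp)]
    have h3 : (3/4:ℝ≥0∞) = ENNReal.ofReal (3/4) := by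
      rw [ENNReal.ofReal_div_of_pos (by norm_num)]; norm_num
    have h4 : (4:ℝ≥0∞)⁻¹ = ENNReal.ofReal (1/4) := by
      rw [ENNReal.ofReal_div_of_pos (by norm_num)]; norm_num
    rw [h3, h4, ← ENNReal.ofReal_add (by norm_num) (by norm_num)]; norm_num

instance ht2 : ENNReal.HolderTriple 4 2 (4/3) where
  inv_add_inv_eq_inv := by
    rw [ENNReal.inv_div (by simp) (by simp)]
    have h3 : (3/4:ℝ≥0∞) = ENNReal.ofReal (3/4) := by
      rw [ENNReal.ofReal_div_of_pos (by norm_num)]; norm_num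
    have h4 : (4:ℝ≥0∞)⁻¹ = ENNReal.ofReal (1/4) := by
      rw [ENNReal.ofReal_div_of_pos (by norm_num)]; norm_num
    have h2 : (2:ℝ≥0∞)⁻¹ = ENNReal.ofReal (1/2) := by
      rw [ENNReal.ofReal_div_of_pos (by norm_num)]; norm_num
    rw [h3, h4, h2, ← ENNReal.ofReal_add (by norm_num) (by norm_num)]; norm_num

instance ht3 : ENNReal.HolderTriple 4 4 2 where
  inv_add_inv_eq_inv := by
    have h4 : (4:ℝ≥0∞)⁻¹ = ENNReal.ofReal (1/4) := by
      rw [ENNReal.ofReal_div_of_pos (by norm_num)]; norm_num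
    have h2 : (2:ℝ≥0∞)⁻¹ = ENNReal.ofReal (1/2) := by
      rw [ENNReal.ofReal_div_of_pos (by norm_num)]; norm_num
    rw [h4, h2, ← ENNReal.ofReal_add (by norm_num) (by norm_num)]; norm_num

/-- Hölder for `lpNorm` of products -/
lemma lpNorm_mul_le {p q r : ℝ≥0∞} [ENNReal.HolderTriple p q r] {f g : E3 → ℂ}
    (hf : MemLp f p volume) (hg : MemLp g q volume) :
    lpNorm (fun x => f x * g x) r volume ≤ lpNorm f p volume * lpNorm g q volume := by
  have h := eLpNorm_smul_le_mul_eLpNorm (p := p) (q := q) (r := r) (μ := volume) hg.1 hf.1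
  have hm : AEStronglyMeasurable (fun x => f x * g x) volume := hf.1.mul hg.1
  rw [← toReal_eLpNorm hm, ← toReal_eLpNorm hf.1, ← toReal_eLpNorm hg.1, ← ENNReal.toReal_mul]
  exact ENNReal.toReal_mono (ENNReal.mul_ne_top hf.2.ne hg.2.ne) h

lemma holder43 {f g : E3 → ℂ} (hf : MemLp f (4/3) volume) (hg : MemLp g 4 volume) :
    Integrable (fun x => f x * g x) ∧ ∫ x, ‖f x * g x‖ ≤ N43 f * N4 g := by
  have h1 : MemLp (fun x => f x * g x) 1 volume := hg.mul' (r := 1) hf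
  refine ⟨memLp_one_iff_integrable.1 h1, ?_⟩
  rw [← lpNorm_one_eq_integral_norm h1.1]
  exact lpNorm_mul_le hf hg

lemma lpNorm_congr_norm {f g : E3 → ℂ} (p : ℝ≥0∞) (hf : AEStronglyMeasurable f volume)
    (hg : AEStronglyMeasurable g volume) (h : ∀ x, ‖f x‖ = ‖g x‖) :
    lpNorm f p volume = lpNorm g p volume := by
  rw [← toReal_eLpNorm hf, ← toReal_eLpNorm hg, eLpNorm_congr_norm_ae (Eventually.of_forall h)]

lemma sw_m (f : SW) : AEStronglyMeasurable f volume := f.continuous.aestronglyMeasurable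

lemma sw_memLp (f : SW) (p : ℝ≥0∞) : MemLp f p volume := f.memLp p volume

lemma hyN (g : SW) : N4 (𝓕 g : SW) ≤ N43 g := by
  unfold N4 N43
  rw [← toReal_eLpNorm (sw_m _), ← toReal_eLpNorm (sw_m _)]
  exact ENNReal.toReal_mono (sw_memLp g _).2.ne (hy g)

lemma dispersive (σ : ℝ) (hσ : σ ≠ 0) (f : SW) :
    N4 (S σ f) ≤ (4 * π * |σ|) ^ (-(3/4) : ℝ) * N43 f := by
  set h := modS (-1 / (16 * π ^ 2 * σ)) f with hh
  have hs : 0 < 4 * π * |σ| := by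
    have := abs_pos.2 hσ
    have := Real.pi_pos
    positivity
  have e1 : N43 h = N43 f := by
    apply lpNorm_congr_norm _ (sw_m _) (sw_m _)
    intro x; rw [hh, modS_apply, norm_mul, norm_mS, one_mul]
  have e2 : N4 (S σ f) ^ 4 = ((4 * π * |σ|) ^ (-(3/4) : ℝ) * N4 (𝓕 h : SW)) ^ 4 := by
    rw [N4_pow (sw_m _), mul_pow, N4_pow (sw_m _)]
    simp_rw [S_kernel σ hσ f, mul_pow]
    rw [integral_const_mul]
    rw [Measure.integral_comp_inv_smul volume (fun y => ‖𝓕 (modS (-1 / (16 * π ^ 2 * σ)) f) y‖ ^ 4)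
      (4 * π * σ)]
    rw [smul_eq_mul, ← mul_assoc, ← hh]
    congr 1
    have : |(4 * π * σ) ^ Module.finrank ℝ E3| = (4 * π * |σ|) ^ (3:ℝ) := by
      rw [abs_pow, abs_mul, abs_of_pos (by have := Real.pi_pos; positivity : (0:ℝ) < 4 * π)]
      simp
    rw [this, ← Real.rpow_natCast, ← Real.rpow_mul hs.le, ← Real.rpow_add hs, ← Real.rpow_natCast,
      ← Real.rpow_mul hs.le]
    norm_num
  have e3 : N4 (S σ f) = (4 * π * |σ|) ^ (-(3/4) : ℝ) * N4 (𝓕 h : SW) :=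
    (pow_left_inj₀ (N4_nonneg _) (mul_nonneg (Real.rpow_nonneg hs.le _) (N4_nonneg _))
      (by norm_num)).1 e2
  rw [e3, ← e1]
  exact mul_le_mul_of_nonneg_left (hyN h) (Real.rpow_nonneg hs.le _)

/-- squared `H¹` norm -/
def H1sq (f : SW) : ℝ := (∫ x, ‖f x‖ ^ 2) + ∑ i, ∫ x, ‖dS i f x‖ ^ 2

lemma H1sq_nonneg (f : SW) : 0 ≤ H1sq f := by
  unfold H1sq
  refine add_nonneg (integral_nonneg fun x => by positivity)
    (Finset.sum_nonneg fun i _ => integral_nonneg fun x => by positivity)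

lemma sw_sq_int (f : SW) : Integrable (fun x => ‖f x‖ ^ 2) volume :=
  (sw_memLp f 2).integrable_norm_pow (by norm_num)

lemma weight_le (f : SW) : Integrable (fun ξ => (1 + ‖ξ‖ ^ 2) * ‖𝓕 f ξ‖ ^ 2) volume ∧
    ∫ ξ, (1 + ‖ξ‖ ^ 2) * ‖𝓕 f ξ‖ ^ 2 ≤ H1sq f := by
  have e : ∀ ξ, (1 + ‖ξ‖ ^ 2) * ‖𝓕 f ξ‖ ^ 2 =
      ‖𝓕 f ξ‖ ^ 2 + ∑ i, (1 / (4 * π ^ 2)) * ‖𝓕 (dS i f) ξ‖ ^ 2 := by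
    intro ξ
    simp_rw [dS_fourier, norm_mul, mul_pow]
    rw [EuclideanSpace.norm_sq_eq ξ]
    have hpi := Real.pi_pos
    simp [Fin.sum_univ_three]
    field_simp
    ring
  simp_rw [e]
  have i1 := sw_sq_int (𝓕 f)
  have i2 : ∀ i ∈ Finset.univ, Integrable (fun ξ => (1 / (4 * π ^ 2)) * ‖𝓕 (dS i f) ξ‖ ^ 2) volume :=
    fun i _ => (sw_sq_int (𝓕 (dS i f))).const_mul _
  refine ⟨i1.add (integrable_finsetSum _ i2), ?_⟩
  rw [integral_add i1 (integrable_finsetSum _ i2), integral_finsetSum _ i2]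
  simp_rw [integral_const_mul, SchwartzMap.integral_norm_sq_fourier]
  unfold H1sq
  gcongr with i
  refine mul_le_of_le_one_left (integral_nonneg fun x => by positivity) ?_
  rw [div_le_one (by have := Real.pi_pos; positivity)]
  nlinarith [Real.pi_gt_three]

lemma H1sq_S (σ : ℝ) (f : SW) : H1sq (S σ f) = H1sq f := by
  unfold H1sq; simp_rw [← S_dS, S_int_sq]

/-- the Sobolev weight -/
def wS (ξ : E3) : ℂ := (((1 + ‖ξ‖ ^ 2) ^ (-(1/2) : ℝ) : ℝ) : ℂ)

lemma wS_cont : Continuous wS := by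
  unfold wS
  apply Complex.continuous_ofReal.comp
  apply Continuous.rpow_const (by fun_prop)
  intro x; left; positivity

lemma wS_memLp : MemLp wS 4 volume := by
  have h := integrable_rpow_neg_one_add_norm_sq (E := E3) (μ := volume) (r := 4) (by simp; norm_num)
  rw [← integrable_norm_rpow_iff wS_cont.aestronglyMeasurable (by norm_num) (by norm_num)]
  refine h.congr (Eventually.of_forall fun ξ => ?_)
  have : (0:ℝ) ≤ 1 + ‖ξ‖ ^ 2 := by positivity
  simp only [wS, Complex.norm_real, Real.norm_eq_abs]
  rw [abs_of_nonneg (Real.rpow_nonneg this _), ← Real.rpow_mul this]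
  norm_num

/-- the Sobolev constant -/
def CS : ℝ := N4 wS

lemma CS_nonneg : 0 ≤ CS := N4_nonneg _

lemma lpNorm_two_sq {f : E3 → ℂ} (hf : AEStronglyMeasurable f volume) :
    lpNorm f 2 volume ^ 2 = ∫ x, ‖f x‖ ^ 2 := by
  rw [lpNorm_eq_integral_norm_rpow_toReal (by norm_num) (by norm_num) hf]
  rw [← Real.rpow_natCast, ← Real.rpow_mul]
  · norm_num
  · exact integral_nonneg fun x => by positivity

lemma finv_neg (f : SW) (ξ : E3) : 𝓕⁻ f ξ = 𝓕 f (-ξ) := by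
  rw [SchwartzMap.fourierInv_coe, Real.fourierInv_eq_fourier_neg, SchwartzMap.fourier_coe]

lemma sobolev (f : SW) : N4 f ≤ CS * √(H1sq f) := by
  have e0 : N4 f = N4 (𝓕 (𝓕⁻ f) : SW) := by simp
  rw [e0]
  refine (hyN _).trans ?_
  -- change of variables by reflection
  have hm : MemLp (fun ξ => (√(1 + ‖ξ‖ ^ 2) : ℂ) * 𝓕⁻ f ξ) 2 volume := by
    rw [memLp_two_iff_integrable_sq_norm]
    · have := (weight_le f).1.comp_neg
      refine this.congr (Eventually.of_forall fun ξ => ?_)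
      have h0 : (0:ℝ) ≤ 1 + ‖ξ‖ ^ 2 := by positivity
      simp only [norm_neg, norm_mul, Complex.norm_real, Real.norm_eq_abs]
      rw [mul_pow, sq_abs, Real.sq_sqrt h0, finv_neg]
    · apply Continuous.aestronglyMeasurable
      have := (𝓕⁻ f).continuous
      fun_prop
  have e1 : N43 (𝓕⁻ f : SW) = lpNorm (fun ξ => wS ξ * ((√(1 + ‖ξ‖ ^ 2) : ℂ) * 𝓕⁻ f ξ)) (4/3) volume := by
    unfold N43; congr 1; ext ξ
    have h0 : (0:ℝ) < 1 + ‖ξ‖ ^ 2 := by positivity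
    rw [← mul_assoc, wS, ← Complex.ofReal_mul, Real.sqrt_eq_rpow, ← Real.rpow_add h0]
    norm_num
  rw [e1]
  refine (lpNorm_mul_le (p := 4) (q := 2) wS_memLp hm).trans ?_
  refine mul_le_mul_of_nonneg_left ?_ CS_nonneg
  apply Real.le_sqrt_of_sq_le
  rw [lpNorm_two_sq hm.1]
  refine le_trans (le_of_eq ?_) (weight_le f).2
  rw [← integral_neg_eq_self]
  refine integral_congr_ae (Eventually.of_forall fun ξ => ?_)
  have h0 : (0:ℝ) ≤ 1 + ‖ξ‖ ^ 2 := by positivity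
  simp only [norm_neg, norm_mul, Complex.norm_real, Real.norm_eq_abs]
  rw [mul_pow, sq_abs, Real.sq_sqrt h0, finv_neg]
  simp

lemma sobolev_S (σ : ℝ) (f : SW) : N4 (S σ f) ≤ CS * √(H1sq f) := by
  rw [← H1sq_S σ f]; exact sobolev _

end Part4

section Part5



/-- a fixed bump function -/
def bmp : ContDiffBump (0 : E3) := ⟨1, 2, by norm_num, by norm_num⟩

def cut (n : ℕ) (x : E3) : ℝ := bmp (((n:ℝ)+1)⁻¹ • x)

def dcut (n : ℕ) (i : Fin 3) (x : E3) : ℝ := ((n:ℝ)+1)⁻¹ * fderiv ℝ bmp (((n:ℝ)+1)⁻¹ • x) (e3 i)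

lemma cut_cont (n : ℕ) : Continuous (cut n) := by
  unfold cut
  exact bmp.continuous.comp (continuous_const_smul _)

lemma bmp_cd : ContDiff ℝ 1 (bmp : E3 → ℝ) := bmp.contDiff

lemma dcut_cont (n : ℕ) (i : Fin 3) : Continuous (dcut n i) := by
  unfold dcut
  have h : Continuous (fderiv ℝ (bmp : E3 → ℝ)) := bmp_cd.continuous_fderiv (by norm_num)
  have h2 : Continuous fun x : E3 => fderiv ℝ (bmp : E3 → ℝ) (((n:ℝ)+1)⁻¹ • x) :=
    h.comp (continuous_const_smul _)
  exact continuous_const.mul (h2.clm_apply continuous_const)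

lemma cut_hld (n : ℕ) (i : Fin 3) (x : E3) : HasLineDerivAt ℝ (cut n) (dcut n i x) x (e3 i) := by
  have h1 : HasFDerivAt (bmp : E3 → ℝ) (fderiv ℝ bmp (((n:ℝ)+1)⁻¹ • x)) (((n:ℝ)+1)⁻¹ • x) :=
    ((bmp_cd.differentiable (by norm_num)) _).hasFDerivAt
  have h2 : HasFDerivAt (fun y : E3 => ((n:ℝ)+1)⁻¹ • y) (((n:ℝ)+1)⁻¹ • ContinuousLinearMap.id ℝ E3) x :=
    (hasFDerivAt_id (𝕜 := ℝ) x).const_smul (((n:ℝ)+1)⁻¹)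
  have h3 := (h1.comp x h2).hasLineDerivAt (e3 i)
  have e : dcut n i x = ((fderiv ℝ bmp (((n:ℝ)+1)⁻¹ • x)).comp
      (((n:ℝ)+1)⁻¹ • ContinuousLinearMap.id ℝ E3)) (e3 i) := by
    simp [dcut]
  rw [e]; exact h3

lemma cut_bd (n : ℕ) (x : E3) : ‖cut n x‖ ≤ 1 := by
  unfold cut; rw [Real.norm_eq_abs, abs_of_nonneg bmp.nonneg]; exact bmp.le_one

lemma cut_zero (n : ℕ) (x : E3) (hx : 2 * ((n:ℝ)+1) < ‖x‖) : cut n x = 0 := by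
  unfold cut
  apply bmp.zero_of_le_dist
  have : (0:ℝ) < (n:ℝ)+1 := by positivity
  rw [dist_zero_right, norm_smul, norm_inv, Real.norm_eq_abs, abs_of_pos this]
  show (2:ℝ) ≤ _
  rw [le_inv_mul_iff₀ this]; linarith

lemma dcut_zero (n : ℕ) (i : Fin 3) (x : E3) (hx : 2 * ((n:ℝ)+1) < ‖x‖) : dcut n i x = 0 := by
  have h : HasLineDerivAt ℝ (cut n) 0 x (e3 i) := by
    have h0 : (fun _ : E3 => (0:ℝ)) =ᶠ[𝓝 x] cut n := by
      have : ∀ᶠ y in 𝓝 x, 2 * ((n:ℝ)+1) < ‖y‖ := continuous_norm.continuousAt.eventually (lt_mem_nhds hx)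
      filter_upwards [this] with y hy using (cut_zero n y hy).symm
    have := ((hasFDerivAt_const (0:ℝ) x).congr_of_eventuallyEq h0.symm).hasLineDerivAt (𝕜 := ℝ) (e3 i)
    simpa using this
  exact (cut_hld n i x).unique h

lemma cut_cs (n : ℕ) : HasCompactSupport (cut n) := by
  apply HasCompactSupport.of_support_subset_isCompact (isCompact_closedBall (0:E3) (2 * ((n:ℝ)+1)))
  intro x hx
  by_contra h
  rw [mem_closedBall_zero_iff, not_le] at h
  exact hx (cut_zero n x h)

lemma dcut_cs (n : ℕ) (i : Fin 3) : HasCompactSupport (dcut n i) := by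
  apply HasCompactSupport.of_support_subset_isCompact (isCompact_closedBall (0:E3) (2 * ((n:ℝ)+1)))
  intro x hx
  by_contra h
  rw [mem_closedBall_zero_iff, not_le] at h
  exact hx (dcut_zero n i x h)

lemma cut_lim (x : E3) : Tendsto (fun n => cut n x) atTop (𝓝 1) := by
  have h : Tendsto (fun n : ℕ => ((n:ℝ)+1)⁻¹ • x) atTop (𝓝 ((0:ℝ) • x)) :=
    (tendsto_one_div_add_atTop_nhds_zero_nat.congr (fun n => by simp)).smul_const x
  rw [zero_smul] at h
  have h2 := (bmp.continuous.tendsto (0:E3)).comp h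
  have : bmp (0:E3) = 1 := bmp.one_of_mem_closedBall (by simp [bmp])
  rw [this] at h2
  exact h2

lemma dcut_bd_ex : ∃ C : ℝ, 0 ≤ C ∧ ∀ n i x, ‖dcut n i x‖ ≤ C * ((n:ℝ)+1)⁻¹ ∧ ‖dcut n i x‖ * (1+‖x‖) ≤ C := by
  have h : Continuous (fderiv ℝ (bmp : E3 → ℝ)) := bmp_cd.continuous_fderiv (by norm_num)
  obtain ⟨C, hC⟩ := h.bounded_above_of_compact_support (bmp.hasCompactSupport.fderiv (𝕜 := ℝ))
  have hC0 : 0 ≤ C := (norm_nonneg _).trans (hC 0)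
  have e1 : ∀ i, ‖e3 i‖ = 1 := fun i => by simp [e3]
  have key : ∀ n i x, ‖dcut n i x‖ ≤ C * ((n:ℝ)+1)⁻¹ := by
    intro n i x
    unfold dcut
    have hn : (0:ℝ) < (n:ℝ)+1 := by positivity
    rw [norm_mul, norm_inv, Real.norm_eq_abs, abs_of_pos hn, mul_comm]
    gcongr
    calc _ ≤ ‖fderiv ℝ bmp (((n:ℝ)+1)⁻¹ • x)‖ * ‖e3 i‖ := ContinuousLinearMap.le_opNorm _ _
      _ ≤ C := by rw [e1, mul_one]; exact hC _
  refine ⟨3 * C, by positivity, fun n i x => ⟨(key n i x).trans ?_, ?_⟩⟩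
  · have hn : (0:ℝ) ≤ ((n:ℝ)+1)⁻¹ := by positivity
    nlinarith [mul_nonneg hC0 hn]
  · by_cases hx : 2 * ((n:ℝ)+1) < ‖x‖
    · rw [dcut_zero n i x hx]; simp; exact hC0
    · push Not at hx
      have hn : (0:ℝ) < (n:ℝ)+1 := by positivity
      have hn1 : (0:ℝ) ≤ (n:ℝ) := by positivity
      calc ‖dcut n i x‖ * (1+‖x‖) ≤ (C * ((n:ℝ)+1)⁻¹) * (3 * ((n:ℝ)+1)) := by
            gcongr
            · exact key n i x
            · linarith
        _ = 3 * C := by field_simp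

lemma dcut_lim (i : Fin 3) (x : E3) : Tendsto (fun n => dcut n i x) atTop (𝓝 0) := by
  obtain ⟨C, hC0, hC⟩ := dcut_bd_ex
  refine squeeze_zero_norm (fun n => (hC n i x).1) ?_
  have := (tendsto_one_div_add_atTop_nhds_zero_nat (𝕜 := ℝ)).const_mul C
  simpa using this

section
variable {F : Type*} [NormedAddCommGroup F] [NormedSpace ℝ F] [CompleteSpace F]

lemma cs_int {χ : E3 → ℝ} {f : E3 → F} (hχ : Continuous χ) (hc : HasCompactSupport χ) (hf : Continuous f) :
    Integrable (fun x => χ x • f x) :=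
  (hχ.smul hf).integrable_of_hasCompactSupport hc.smul_right

lemma cut_deriv (n : ℕ) (ρ ρt : ℝ → E3 → F)
    (h1 : ∀ t x, HasDerivAt (fun s => ρ s x) (ρt t x) t)
    (h2 : Continuous fun p : ℝ × E3 => ρt p.1 p.2) (h3 : ∀ t, Continuous (ρ t)) (t : ℝ) :
    HasDerivAt (fun s => ∫ x, cut n x • ρ s x) (∫ x, cut n x • ρt t x) t := by
  obtain ⟨C, hC⟩ := ((isCompact_Icc (a := t-1) (b := t+1)).prod
      (isCompact_closedBall (0:E3) (2 * ((n:ℝ)+1)))).exists_bound_of_continuousOn h2.continuousOn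
  have hs : Metric.ball t 1 ∈ 𝓝 t := Metric.ball_mem_nhds t one_pos
  have := hasDerivAt_integral_of_dominated_loc_of_deriv_le (𝕜 := ℝ) (μ := volume) (x₀ := t)
    (F := fun s x => cut n x • ρ s x) (F' := fun s x => cut n x • ρt s x)
    (bound := fun x => ‖cut n x‖ * C) hs
    (Eventually.of_forall fun s => (cs_int (cut_cont n) (cut_cs n) (h3 s)).aestronglyMeasurable)
    (cs_int (cut_cont n) (cut_cs n) (h3 t))
    (cs_int (cut_cont n) (cut_cs n) (h2.comp (Continuous.prodMk_right t))).aestronglyMeasurable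
    (Eventually.of_forall fun x s hs' => ?_) ?_ (Eventually.of_forall fun x s _ => (h1 s x).const_smul _)
  · exact this.2
  · rw [norm_smul]
    by_cases hx : 2 * ((n:ℝ)+1) < ‖x‖
    · rw [cut_zero n x hx]; simp
    · push Not at hx
      gcongr
      refine hC (s, x) ⟨?_, by simpa using hx⟩
      rw [Metric.mem_ball, Real.dist_eq, abs_lt] at hs'
      exact ⟨by linarith [hs'.1], by linarith [hs'.2]⟩
  · have := (((cut_cont n).integrable_of_hasCompactSupport (μ := volume) (cut_cs n)).norm).mul_const C
    exact this

lemma cut_dcont (n : ℕ) (ρt : ℝ → E3 → F)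
    (h2 : Continuous fun p : ℝ × E3 => ρt p.1 p.2) : Continuous fun t => ∫ x, cut n x • ρt t x := by
  rw [← continuousOn_univ]
  refine continuousOn_integral_of_compact_support (k := Metric.closedBall (0:E3) (2 * ((n:ℝ)+1))) (isCompact_closedBall _ _) ?_ ?_
  · exact (((cut_cont n).comp continuous_snd).smul h2).continuousOn
  · intro p x _ hx
    rw [mem_closedBall_zero_iff, not_le] at hx
    rw [cut_zero n x hx, zero_smul]

lemma cut_ibp (n : ℕ) (i : Fin 3) (j jd : E3 → F) (hj : Continuous j) (hjd : Continuous jd)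
    (h : ∀ x, HasLineDerivAt ℝ j (jd x) x (e3 i)) :
    ∫ x, cut n x • jd x = - ∫ x, dcut n i x • j x := by
  exact integral_bilinear_hasLineDerivAt_right_eq_neg_left_of_integrable (μ := volume)
    (B := ContinuousLinearMap.lsmul ℝ ℝ) (f := cut n) (g := j) (f' := dcut n i) (g' := jd)
    (cs_int (dcut_cont n i) (dcut_cs n i) hj) (cs_int (cut_cont n) (cut_cs n) hjd)
    (cs_int (cut_cont n) (cut_cs n) hj) (fun x _ => cut_hld n i x) (fun x _ => h x)

/-- Localised conservation law. -/
lemma cons_law (t0 t1 : ℝ) (h01 : t0 ≤ t1) (ρ ρt σ : ℝ → E3 → F) (j jd : Fin 3 → ℝ → E3 → F)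
    (M : ℝ → E3 → ℝ) (C : ℝ)
    (h1 : ∀ t x, HasDerivAt (fun s => ρ s x) (ρt t x) t)
    (h2 : Continuous fun p : ℝ × E3 => ρt p.1 p.2) (h3 : ∀ t, Continuous (ρ t))
    (hjc : ∀ i t, Continuous (j i t)) (hjdc : ∀ i t, Continuous (jd i t))
    (hj : ∀ i t x, HasLineDerivAt ℝ (j i t) (jd i t x) x (e3 i))
    (heq : ∀ t ∈ Set.Icc t0 t1, ∀ x, ρt t x = ∑ i, jd i t x + σ t x)
    (hi0 : Integrable (ρ t0)) (hi1 : Integrable (ρ t1))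
    (hM : ∀ t ∈ Set.Icc t0 t1, Integrable (M t) ∧ ∫ x, M t x ≤ C)
    (hMj : ∀ t ∈ Set.Icc t0 t1, ∀ x i, ‖j i t x‖ ≤ (1 + ‖x‖) * M t x)
    (hMσ : ∀ t ∈ Set.Icc t0 t1, ∀ x, ‖σ t x‖ ≤ M t x) :
    IntervalIntegrable (fun t => ∫ x, σ t x) volume t0 t1 ∧
    (∫ x, ρ t1 x) - ∫ x, ρ t0 x = ∫ t in t0..t1, ∫ x, σ t x := by
  obtain ⟨D, hD0, hD⟩ := dcut_bd_ex
  have hρtc : ∀ t, Continuous (ρt t) := fun t => h2.comp (Continuous.prodMk_right t)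
  have hσc : ∀ t ∈ Set.Icc t0 t1, Continuous (σ t) := by
    intro t ht
    have : σ t = fun x => ρt t x - ∑ i, jd i t x := by
      funext x; rw [heq t ht x]; abel
    rw [this]
    exact (hρtc t).sub (continuous_finsetSum _ fun i _ => hjdc i t)
  have hσi : ∀ t ∈ Set.Icc t0 t1, Integrable (σ t) := fun t ht =>
    (hM t ht).1.mono' (hσc t ht).aestronglyMeasurable (Eventually.of_forall (hMσ t ht))
  set m : ℕ → ℝ → F := fun n t => ∫ x, cut n x • ρt t x with hm
  have mform : ∀ n, ∀ t ∈ Set.Icc t0 t1, m n t =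
      (∑ i, - ∫ x, dcut n i x • j i t x) + ∫ x, cut n x • σ t x := by
    intro n t ht
    have : m n t = ∫ x, ((∑ i, cut n x • jd i t x) + cut n x • σ t x) := by
      apply integral_congr_ae; refine Eventually.of_forall fun x => ?_
      simp only; rw [heq t ht x, smul_add, Finset.smul_sum]
    rw [this, integral_add (integrable_finsetSum _ fun i _ => cs_int (cut_cont n) (cut_cs n) (hjdc i t))
      (cs_int (cut_cont n) (cut_cs n) (hσc t ht)),
      integral_finsetSum _ fun i _ => cs_int (cut_cont n) (cut_cs n) (hjdc i t)]
    congr 1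
    exact Finset.sum_congr rfl fun i _ => cut_ibp n i _ _ (hjc i t) (hjdc i t) (hj i t)
  have hMn : ∀ t ∈ Set.Icc t0 t1, ∀ x, 0 ≤ M t x := fun t ht x => (norm_nonneg _).trans (hMσ t ht x)
  have djb : ∀ n i, ∀ t ∈ Set.Icc t0 t1, ∀ x, ‖dcut n i x • j i t x‖ ≤ D * M t x := by
    intro n i t ht x
    rw [norm_smul]
    calc _ ≤ ‖dcut n i x‖ * ((1+‖x‖) * M t x) := by gcongr; exact hMj t ht x i
      _ = (‖dcut n i x‖ * (1+‖x‖)) * M t x := by ring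
      _ ≤ D * M t x := by
        have := hMn t ht x
        gcongr; exact (hD n i x).2
  have cσb : ∀ n, ∀ t ∈ Set.Icc t0 t1, ∀ x, ‖cut n x • σ t x‖ ≤ M t x := by
    intro n t ht x
    rw [norm_smul]
    calc _ ≤ 1 * M t x := by gcongr; exact cut_bd n x; exact hMσ t ht x
      _ = _ := one_mul _
  have mlim : ∀ t ∈ Set.Icc t0 t1, Tendsto (fun n => m n t) atTop (𝓝 (∫ x, σ t x)) := by
    intro t ht
    have e : ∀ n, m n t = _ := fun n => mform n t ht
    simp_rw [e]
    have l1 : ∀ i, Tendsto (fun n => ∫ x, dcut n i x • j i t x) atTop (𝓝 (∫ _x : E3, (0:F))) := by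
      intro i
      refine tendsto_integral_of_dominated_convergence (fun x => D * M t x)
        (fun n => (cs_int (dcut_cont n i) (dcut_cs n i) (hjc i t)).aestronglyMeasurable)
        ((hM t ht).1.const_mul D) (fun n => Eventually.of_forall (djb n i t ht)) (Eventually.of_forall fun x => ?_)
      have := (dcut_lim i x).smul_const (j i t x)
      rwa [zero_smul] at this
    have l2 : Tendsto (fun n => ∫ x, cut n x • σ t x) atTop (𝓝 (∫ x, σ t x)) := by
      refine tendsto_integral_of_dominated_convergence (M t)
        (fun n => (cs_int (cut_cont n) (cut_cs n) (hσc t ht)).aestronglyMeasurable)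
        (hM t ht).1 (fun n => Eventually.of_forall (cσb n t ht)) (Eventually.of_forall fun x => ?_)
      have := (cut_lim x).smul_const (σ t x)
      rwa [one_smul] at this
    have l3 := (tendsto_finsetSum (Finset.univ : Finset (Fin 3)) fun i _ => (l1 i).neg).add l2
    simpa using l3
  have mbd : ∀ n, ∀ t ∈ Set.Icc t0 t1, ‖m n t‖ ≤ 3 * (D * C) + C := by
    intro n t ht
    rw [mform n t ht]
    have b1 : ∀ i : Fin 3, ‖- ∫ x, dcut n i x • j i t x‖ ≤ D * C := by
      intro i
      rw [norm_neg]
      calc _ ≤ ∫ x, D * M t x := norm_integral_le_of_norm_le ((hM t ht).1.const_mul D)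
              (Eventually.of_forall (djb n i t ht))
        _ = D * ∫ x, M t x := integral_const_mul _ _
        _ ≤ D * C := by gcongr; exact (hM t ht).2
    have b2 : ‖∫ x, cut n x • σ t x‖ ≤ C :=
      (norm_integral_le_of_norm_le (hM t ht).1 (Eventually.of_forall (cσb n t ht))).trans (hM t ht).2
    refine (norm_add_le _ _).trans (add_le_add ((norm_sum_le _ _).trans ?_) b2)
    calc _ ≤ ∑ i : Fin 3, D * C := Finset.sum_le_sum fun i _ => b1 i
      _ = _ := by simp
  have mc : ∀ n, Continuous (m n) := fun n => cut_dcont n ρt h2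
  have hu : Set.uIoc t0 t1 ⊆ Set.Icc t0 t1 := by
    rw [Set.uIoc_of_le h01]; exact Set.Ioc_subset_Icc_self
  have L : Tendsto (fun n => ∫ t in t0..t1, m n t) atTop (𝓝 (∫ t in t0..t1, ∫ x, σ t x)) := by
    refine intervalIntegral.tendsto_integral_filter_of_dominated_convergence (fun _ => 3 * (D * C) + C)
      (Eventually.of_forall fun n => (mc n).aestronglyMeasurable)
      (Eventually.of_forall fun n => Eventually.of_forall fun t ht => mbd n t (hu ht))
      intervalIntegrable_const (Eventually.of_forall fun t ht => mlim t (hu ht))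
  have FT : ∀ n, ∫ t in t0..t1, m n t = (∫ x, cut n x • ρ t1 x) - ∫ x, cut n x • ρ t0 x := by
    intro n
    exact intervalIntegral.integral_eq_sub_of_hasDerivAt (fun t _ => cut_deriv n ρ ρt h1 h2 h3 t)
      ((mc n).intervalIntegrable _ _)
  have R : ∀ t, Integrable (ρ t) → Tendsto (fun n => ∫ x, cut n x • ρ t x) atTop (𝓝 (∫ x, ρ t x)) := by
    intro t ht
    refine tendsto_integral_of_dominated_convergence (fun x => ‖ρ t x‖)
      (fun n => (cs_int (cut_cont n) (cut_cs n) (h3 t)).aestronglyMeasurable) ht.norm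
      (fun n => Eventually.of_forall fun x => ?_) (Eventually.of_forall fun x => ?_)
    · rw [norm_smul]
      calc _ ≤ 1 * ‖ρ t x‖ := by gcongr; exact cut_bd n x
        _ = _ := one_mul _
    · have := (cut_lim x).smul_const (ρ t x)
      rwa [one_smul] at this
  refine ⟨?_, ?_⟩
  · rw [intervalIntegrable_iff_integrableOn_Ioc_of_le h01]
    have hae : ∀ᵐ t ∂(volume.restrict (Set.Ioc t0 t1)), t ∈ Set.Ioc t0 t1 :=
      ae_restrict_mem measurableSet_Ioc
    refine ⟨?_, HasFiniteIntegral.of_bounded (C := 3 * (D * C) + C) ?_⟩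
    · exact aestronglyMeasurable_of_tendsto_ae (μ := volume.restrict (Set.Ioc t0 t1)) atTop (f := fun n => m n)
        (fun n => (mc n).aestronglyMeasurable)
        (hae.mono fun t ht => mlim t (Set.Ioc_subset_Icc_self ht))
    · exact hae.mono fun t ht => le_of_tendsto (mlim t (Set.Ioc_subset_Icc_self ht)).norm
        (Eventually.of_forall fun n => mbd n t (Set.Ioc_subset_Icc_self ht))
  · simp_rw [FT] at L
    exact tendsto_nhds_unique ((R t1 hi1).sub (R t0 hi0)) L

end

end Part5

section Part6



abbrev R4 := ℝ × E3

/-- directional derivative on space-time -/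
def D {F : Type*} [NormedAddCommGroup F] [NormedSpace ℝ F] (v : R4) (f : R4 → F) (p : R4) : F :=
  fderiv ℝ f p v

def vT : R4 := (1, 0)
def vX (i : Fin 3) : R4 := (0, e3 i)

abbrev Sm {F : Type*} [NormedAddCommGroup F] [NormedSpace ℝ F] (f : R4 → F) : Prop := ContDiff ℝ ∞ f

section
variable {F : Type*} [NormedAddCommGroup F] [NormedSpace ℝ F]

@[fun_prop]
lemma D_sm {f : R4 → F} (hf : ContDiff ℝ ∞ f) (v : R4) : ContDiff ℝ ∞ (D v f) := by
  unfold D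
  exact (hf.fderiv_right (m := ∞) (by simp)).clm_apply contDiff_const

@[fun_prop]
lemma sm_diff {f : R4 → F} (hf : ContDiff ℝ ∞ f) : Differentiable ℝ f := hf.differentiable (by simp)

lemma D_comm {f : R4 → F} (hf : ContDiff ℝ ∞ f) (v w : R4) (p : R4) : D v (D w f) p = D w (D v f) p := by
  have h1 : ∀ a b : R4, D a (D b f) p = fderiv ℝ (fderiv ℝ f) p a b := by
    intro a b
    have hd : DifferentiableAt ℝ (fderiv ℝ f) p :=
      ((hf.fderiv_right (m := ∞) (by simp)).differentiable (by simp)) p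
    show fderiv ℝ (fun q => fderiv ℝ f q b) p a = _
    rw [fderiv_clm_apply hd (differentiableAt_const _)]
    simp
  rw [h1, h1]
  have hs : IsSymmSndFDerivAt ℝ f p := hf.contDiffAt.isSymmSndFDerivAt (by simp; exact WithTop.coe_le_coe.2 le_top)
  exact hs v w

lemma D_add {f g : R4 → F} (hf : Differentiable ℝ f) (hg : Differentiable ℝ g) (v p : R4) :
    D v (fun q => f q + g q) p = D v f p + D v g p := by
  unfold D; rw [fderiv_fun_add (hf p) (hg p)]; rfl

lemma D_sub {f g : R4 → F} (hf : Differentiable ℝ f) (hg : Differentiable ℝ g) (v p : R4) :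
    D v (fun q => f q - g q) p = D v f p - D v g p := by
  unfold D; rw [fderiv_fun_sub (hf p) (hg p)]; rfl

lemma D_neg {f : R4 → F} (v p : R4) :
    D v (fun q => - f q) p = - D v f p := by
  unfold D; rw [fderiv_fun_neg]; rfl

lemma D_const (c : F) (v p : R4) : D v (fun _ => c) p = 0 := by
  unfold D; simp

lemma D_mul {f g : R4 → ℝ} (hf : Differentiable ℝ f) (hg : Differentiable ℝ g) (v p : R4) :
    D v (fun q => f q * g q) p = f p * D v g p + D v f p * g p := by
  unfold D; rw [fderiv_fun_mul (hf p) (hg p)]; simp; ring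

lemma D_pow {f : R4 → ℝ} (hf : Differentiable ℝ f) (n : ℕ) (v p : R4) :
    D v (fun q => f q ^ n) p = n * f p ^ (n-1) * D v f p := by
  unfold D; rw [fderiv_fun_pow n (hf p)]; simp

lemma D_re {f : R4 → ℂ} (hf : Differentiable ℝ f) (v p : R4) :
    D v (fun q => (f q).re) p = (D v f p).re := by
  have := (Complex.reCLM.hasFDerivAt.comp p (hf p).hasFDerivAt).fderiv
  unfold D
  have e : (fun q => (f q).re) = Complex.reCLM ∘ f := rfl
  rw [e, this]; rfl

lemma D_im {f : R4 → ℂ} (hf : Differentiable ℝ f) (v p : R4) :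
    D v (fun q => (f q).im) p = (D v f p).im := by
  have := (Complex.imCLM.hasFDerivAt.comp p (hf p).hasFDerivAt).fderiv
  unfold D
  have e : (fun q => (f q).im) = Complex.imCLM ∘ f := rfl
  rw [e, this]; rfl

/-- coordinate functions -/
def xc (i : Fin 3) (p : R4) : ℝ := p.2 i
def tc (p : R4) : ℝ := p.1

@[fun_prop]
lemma xc_sm (i : Fin 3) : ContDiff ℝ ∞ (xc i) := by
  unfold xc; fun_prop

@[fun_prop]
lemma tc_sm : ContDiff ℝ ∞ tc := by
  unfold tc; fun_prop

lemma D_tc (v p : R4) : D v tc p = v.1 := by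
  have h : HasFDerivAt tc (ContinuousLinearMap.fst ℝ ℝ E3) p := hasFDerivAt_fst
  unfold D; rw [h.fderiv]; rfl

lemma D_xc (i : Fin 3) (v p : R4) : D v (xc i) p = v.2 i := by
  have h : HasFDerivAt (xc i) ((EuclideanSpace.proj (𝕜 := ℝ) i).comp (ContinuousLinearMap.snd ℝ ℝ E3)) p :=
    ((EuclideanSpace.proj (𝕜 := ℝ) i).comp (ContinuousLinearMap.snd ℝ ℝ E3) : R4 →L[ℝ] ℝ).hasFDerivAt
  unfold D; rw [h.fderiv]; rfl

lemma vX_snd (i k : Fin 3) : (vX i).2 k = if k = i then 1 else 0 := by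
  simp [vX, e3]

lemma D_time {f : R4 → F} (hf : ContDiff ℝ ∞ f) (t : ℝ) (x : E3) :
    HasDerivAt (fun s => f (s, x)) (D vT f (t, x)) t := by
  have h1 := ((sm_diff hf) (t, x)).hasFDerivAt
  have h2 : HasDerivAt (fun s : ℝ => ((s, x) : R4)) vT t :=
    (hasDerivAt_id t).prodMk (hasDerivAt_const t x)
  exact h1.comp_hasDerivAt t h2

lemma D_line {f : R4 → F} (hf : ContDiff ℝ ∞ f) (t : ℝ) (x : E3) (i : Fin 3) :
    HasLineDerivAt ℝ (fun y => f (t, y)) (D (vX i) f (t, x)) x (e3 i) := by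
  have h1 := ((sm_diff hf) (t, x)).hasFDerivAt
  have h2 : HasFDerivAt (fun y : E3 => ((t, y) : R4)) (ContinuousLinearMap.inr ℝ ℝ E3) x :=
    hasFDerivAt_prodMk_right t x
  have h3 := (h1.comp x h2).hasLineDerivAt (e3 i)
  exact h3

lemma D_slice {f : R4 → F} (hf : ContDiff ℝ ∞ f) (t : ℝ) (x : E3) (i : Fin 3) :
    D (vX i) f (t, x) = fderiv ℝ (fun y => f (t, y)) x (e3 i) := by
  have h1 := ((sm_diff hf) (t, x)).hasFDerivAt
  have h2 : HasFDerivAt (fun y : E3 => ((t, y) : R4)) (ContinuousLinearMap.inr ℝ ℝ E3) x :=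
    hasFDerivAt_prodMk_right t x
  exact (congrArg (fun L => L (e3 i)) (h1.comp x h2).fderiv).symm

/-- smooth version of the conservation law -/
lemma cons_sm [CompleteSpace F] (t0 t1 : ℝ) (h01 : t0 ≤ t1) (R : R4 → F) (J : Fin 3 → R4 → F) (σ : R4 → F)
    (M : R4 → ℝ) (C : ℝ) (hR : ContDiff ℝ ∞ R) (hJ : ∀ i, ContDiff ℝ ∞ (J i))
    (heq : ∀ p : R4, p.1 ∈ Set.Icc t0 t1 → D vT R p = ∑ i, D (vX i) (J i) p + σ p)
    (hi : ∀ t ∈ Set.Icc t0 t1, Integrable (fun x => R (t, x)))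
    (hM : ∀ t ∈ Set.Icc t0 t1, Integrable (fun x => M (t, x)) ∧ ∫ x, M (t, x) ≤ C)
    (hMj : ∀ p : R4, p.1 ∈ Set.Icc t0 t1 → ∀ i, ‖J i p‖ ≤ (1 + ‖p.2‖) * M p)
    (hMσ : ∀ p : R4, p.1 ∈ Set.Icc t0 t1 → ‖σ p‖ ≤ M p) :
    IntervalIntegrable (fun t => ∫ x, σ (t, x)) volume t0 t1 ∧
    (∫ x, R (t1, x)) - ∫ x, R (t0, x) = ∫ t in t0..t1, ∫ x, σ (t, x) := by
  refine cons_law t0 t1 h01 (fun t x => R (t, x)) (fun t x => D vT R (t, x)) (fun t x => σ (t, x))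
    (fun i t x => J i (t, x)) (fun i t x => D (vX i) (J i) (t, x)) (fun t x => M (t, x)) C
    (fun t x => D_time hR t x) (D_sm hR _).continuous
    (fun t => hR.continuous.comp (Continuous.prodMk_right t))
    (fun i t => (hJ i).continuous.comp (Continuous.prodMk_right t))
    (fun i t => (D_sm (hJ i) _).continuous.comp (Continuous.prodMk_right t))
    (fun i t x => D_line (hJ i) t x i) (fun t ht x => heq (t, x) ht)
    (hi t0 ⟨le_rfl, h01⟩) (hi t1 ⟨h01, le_rfl⟩) hM (fun t ht x i => hMj (t, x) ht i) (fun t ht x => hMσ (t, x) ht)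
end

/-- space-time function -/
def UU (u : ℝ → E3 → ℂ) (p : R4) : ℂ := u p.1 p.2
def Pr (u : ℝ → E3 → ℂ) (p : R4) : ℝ := (UU u p).re
def Qi (u : ℝ → E3 → ℂ) (p : R4) : ℝ := (UU u p).im

structure Sol (α β : ℝ) (u : ℝ → E3 → ℂ) : Prop where
  sm : ContDiff ℝ ∞ (UU u)
  sw : ∀ t, ∃ g : SW, ∀ x, u t x = g x
  swt : ∀ t, ∃ g : SW, ∀ x, D vT (UU u) (t, x) = g x
  eqn : ∀ p : R4, p.1 ∈ Set.Icc α β →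
    I * D vT (UU u) p + ∑ i, D (vX i) (D (vX i) (UU u)) p = ((normSq (UU u p) : ℝ) : ℂ) * UU u p

lemma Sol.mono {α β α' β' : ℝ} {u : ℝ → E3 → ℂ} (h : Sol α β u) (h1 : α ≤ α') (h2 : β' ≤ β) : Sol α' β' u :=
  ⟨h.sm, h.sw, h.swt, fun p hp => h.eqn p ⟨h1.trans hp.1, hp.2.trans h2⟩⟩

lemma Pr_sm {u : ℝ → E3 → ℂ} (h : ContDiff ℝ ∞ (UU u)) : ContDiff ℝ ∞ (Pr u) :=
  Complex.reCLM.contDiff.comp h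
lemma Qi_sm {u : ℝ → E3 → ℂ} (h : ContDiff ℝ ∞ (UU u)) : ContDiff ℝ ∞ (Qi u) :=
  Complex.imCLM.contDiff.comp h

lemma D_Pr {u : ℝ → E3 → ℂ} (h : ContDiff ℝ ∞ (UU u)) (v p : R4) : D v (Pr u) p = (D v (UU u) p).re :=
  D_re (sm_diff h) v p
lemma D_Qi {u : ℝ → E3 → ℂ} (h : ContDiff ℝ ∞ (UU u)) (v p : R4) : D v (Qi u) p = (D v (UU u) p).im :=
  D_im (sm_diff h) v p

lemma DD_Pr {u : ℝ → E3 → ℂ} (h : ContDiff ℝ ∞ (UU u)) (w v p : R4) :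
    D w (D v (Pr u)) p = (D w (D v (UU u)) p).re := by
  have e : D v (Pr u) = fun q => (D v (UU u) q).re := funext fun q => D_Pr h v q
  rw [e]; exact D_re (sm_diff (D_sm h v)) w p
lemma DD_Qi {u : ℝ → E3 → ℂ} (h : ContDiff ℝ ∞ (UU u)) (w v p : R4) :
    D w (D v (Qi u)) p = (D w (D v (UU u)) p).im := by
  have e : D v (Qi u) = fun q => (D v (UU u) q).im := funext fun q => D_Qi h v q
  rw [e]; exact D_im (sm_diff (D_sm h v)) w p

/-- real form of the equation -/
lemma Sol.real_eqn {α β : ℝ} {u : ℝ → E3 → ℂ} (h : Sol α β u) (p : R4) (hp : p.1 ∈ Set.Icc α β) :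
    D vT (Pr u) p = - (∑ i, D (vX i) (D (vX i) (Qi u)) p) + (Pr u p ^ 2 + Qi u p ^ 2) * Qi u p ∧
    D vT (Qi u) p = (∑ i, D (vX i) (D (vX i) (Pr u)) p) - (Pr u p ^ 2 + Qi u p ^ 2) * Pr u p := by
  have h1 := h.eqn p hp
  have hr := congrArg Complex.re h1
  have hi := congrArg Complex.im h1
  simp only [DD_Pr h.sm, DD_Qi h.sm, D_Pr h.sm, D_Qi h.sm]
  simp only [Complex.add_re, Complex.add_im, Complex.mul_re, Complex.mul_im, Complex.I_re, Complex.I_im,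
    Complex.re_sum, Complex.im_sum, Complex.ofReal_re, Complex.ofReal_im, Complex.normSq_apply] at hr hi
  have eP : Pr u p = (UU u p).re := rfl
  have eQ : Qi u p = (UU u p).im := rfl
  rw [eP, eQ]
  constructor
  · linear_combination hi
  · linear_combination -hr

end Part6

section Part7



def nD (P Q : R4 → ℝ) (p : R4) : ℝ := P p ^ 2 + Q p ^ 2
def gD (P Q : R4 → ℝ) (p : R4) : ℝ := ∑ i, (D (vX i) P p ^ 2 + D (vX i) Q p ^ 2)
def eD (P Q : R4 → ℝ) (p : R4) : ℝ := 1/2 * gD P Q p + 1/4 * nD P Q p ^ 2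
def mom (P Q : R4 → ℝ) (i : Fin 3) (p : R4) : ℝ := P p * D (vX i) Q p - Q p * D (vX i) P p
def tD (P Q : R4 → ℝ) (p : R4) : ℝ := D vT P p ^ 2 + D vT Q p ^ 2

lemma vT_snd (i : Fin 3) : vT.2 i = 0 := rfl
lemma f20 : ¬ ((2 : Fin 3) = 0) := by decide
lemma f21 : ¬ ((2 : Fin 3) = 1) := by decide
lemma f02 : ¬ ((0 : Fin 3) = 2) := by decide
lemma f12 : ¬ ((1 : Fin 3) = 2) := by decide
lemma f10 : ¬ ((1 : Fin 3) = 0) := by decide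
lemma f01 : ¬ ((0 : Fin 3) = 1) := by decide

section
variable {P Q : R4 → ℝ} (hP : ContDiff ℝ ∞ P) (hQ : ContDiff ℝ ∞ Q)
include hP hQ

@[fun_prop]
lemma nD_sm : ContDiff ℝ ∞ (nD P Q) := by unfold nD; fun_prop
@[fun_prop]
lemma gD_sm : ContDiff ℝ ∞ (gD P Q) := by
  unfold gD
  exact ContDiff.sum fun i _ => by fun_prop
@[fun_prop]
lemma eD_sm : ContDiff ℝ ∞ (eD P Q) := by
  unfold eD; fun_prop
@[fun_prop]
lemma mom_sm (i : Fin 3) : ContDiff ℝ ∞ (mom P Q i) := by unfold mom; fun_prop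
@[fun_prop]
lemma tD_sm : ContDiff ℝ ∞ (tD P Q) := by unfold tD; fun_prop

lemma D_nD (v p : R4) : D v (nD P Q) p = 2 * P p * D v P p + 2 * Q p * D v Q p := by
  unfold nD
  simp (disch := fun_prop) only [D_add, D_pow]
  norm_num

lemma D_gD (v p : R4) : D v (gD P Q) p =
    ∑ i, (2 * D (vX i) P p * D v (D (vX i) P) p + 2 * D (vX i) Q p * D v (D (vX i) Q) p) := by
  have e : gD P Q = fun p => (D (vX 0) P p ^ 2 + D (vX 0) Q p ^ 2) + (D (vX 1) P p ^ 2 + D (vX 1) Q p ^ 2)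
      + (D (vX 2) P p ^ 2 + D (vX 2) Q p ^ 2) := by
    funext p; simp [gD, Fin.sum_univ_three]
  rw [e, Fin.sum_univ_three]
  simp (disch := fun_prop) only [D_add, D_pow]
  norm_num

lemma D_mom (i : Fin 3) (v p : R4) : D v (mom P Q i) p =
    D v P p * D (vX i) Q p + P p * D v (D (vX i) Q) p - D v Q p * D (vX i) P p - Q p * D v (D (vX i) P) p := by
  unfold mom
  simp (disch := fun_prop) only [D_sub, D_mul]
  ring

lemma mass_id (p : R4)
    (e1 : D vT P p = - (∑ i, D (vX i) (D (vX i) Q) p) + (P p ^ 2 + Q p ^ 2) * Q p)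
    (e2 : D vT Q p = (∑ i, D (vX i) (D (vX i) P) p) - (P p ^ 2 + Q p ^ 2) * P p) :
    D vT (nD P Q) p = ∑ i, D (vX i) (fun q => (-2) * mom P Q i q) p + 0 := by
  rw [D_nD hP hQ, Fin.sum_univ_three]
  simp (disch := fun_prop) only [D_mul, D_const, D_mom hP hQ]
  rw [Fin.sum_univ_three] at e1 e2
  linear_combination 2 * P p * e1 + 2 * Q p * e2

lemma wmass_id (w : R4 → ℝ) (hw : ContDiff ℝ ∞ w) (p : R4)
    (e1 : D vT P p = - (∑ i, D (vX i) (D (vX i) Q) p) + (P p ^ 2 + Q p ^ 2) * Q p)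
    (e2 : D vT Q p = (∑ i, D (vX i) (D (vX i) P) p) - (P p ^ 2 + Q p ^ 2) * P p) :
    D vT (fun q => w q * nD P Q q) p = ∑ i, D (vX i) (fun q => (-2) * (w q * mom P Q i q)) p
      + (D vT w p * nD P Q p + 2 * ∑ i, D (vX i) w p * mom P Q i p) := by
  rw [Fin.sum_univ_three, Fin.sum_univ_three]
  simp (disch := fun_prop) only [D_mul, D_const, D_mom hP hQ, D_nD hP hQ]
  rw [Fin.sum_univ_three] at e1 e2
  linear_combination w p * (2 * P p * e1 + 2 * Q p * e2)

def eJ (P Q : R4 → ℝ) (i : Fin 3) (p : R4) : ℝ := D vT P p * D (vX i) P p + D vT Q p * D (vX i) Q p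

@[fun_prop]
lemma eJ_sm (i : Fin 3) : ContDiff ℝ ∞ (eJ P Q i) := by unfold eJ; fun_prop

lemma D_eJ (i : Fin 3) (v p : R4) : D v (eJ P Q i) p =
    D v (D vT P) p * D (vX i) P p + D vT P p * D v (D (vX i) P) p +
    D v (D vT Q) p * D (vX i) Q p + D vT Q p * D v (D (vX i) Q) p := by
  unfold eJ
  simp (disch := fun_prop) only [D_add, D_mul]
  ring

lemma D_eD (v p : R4) : D v (eD P Q) p =
    ∑ i, (D (vX i) P p * D v (D (vX i) P) p + D (vX i) Q p * D v (D (vX i) Q) p) +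
     nD P Q p * (P p * D v P p + Q p * D v Q p) := by
  unfold eD
  simp (disch := fun_prop) only [D_add, D_mul, D_const, D_pow, D_gD hP hQ, D_nD hP hQ]
  rw [Fin.sum_univ_three, Fin.sum_univ_three]
  norm_num
  ring

lemma energy_id (p : R4)
    (e1 : D vT P p = - (∑ i, D (vX i) (D (vX i) Q) p) + (P p ^ 2 + Q p ^ 2) * Q p)
    (e2 : D vT Q p = (∑ i, D (vX i) (D (vX i) P) p) - (P p ^ 2 + Q p ^ 2) * P p) :
    D vT (eD P Q) p = ∑ i, D (vX i) (eJ P Q i) p + 0 := by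
  rw [D_eD hP hQ]
  simp only [D_eJ hP hQ, Fin.sum_univ_three] at *
  simp only [D_comm hP (vX _) vT, D_comm hQ (vX _) vT]
  unfold nD
  linear_combination D vT P p * e2 - D vT Q p * e1

/-- pseudoconformal density and flux -/
def xP (P Q : R4 → ℝ) (p : R4) : ℝ := ∑ i, xc i p * mom P Q i p
def r2 (p : R4) : ℝ := ∑ i, xc i p ^ 2
def pcD (P Q : R4 → ℝ) (p : R4) : ℝ :=
  r2 p * nD P Q p - 4 * tc p * xP P Q p + 8 * tc p ^ 2 * eD P Q p
def imt (P Q : R4 → ℝ) (p : R4) : ℝ := P p * D vT Q p - Q p * D vT P p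
def xg (P : R4 → ℝ) (p : R4) : ℝ := ∑ k, xc k p * D (vX k) P p
/-- flux of the momentum density -/
def xJ (P Q : R4 → ℝ) (i : Fin 3) (p : R4) : ℝ :=
  xc i p * imt P Q p - 3 * (P p * D (vX i) P p + Q p * D (vX i) Q p)
   - 2 * (D (vX i) P p * xg P p + D (vX i) Q p * xg Q p) + xc i p * gD P Q p + 1/2 * (xc i p * nD P Q p ^ 2)
def pcJ (P Q : R4 → ℝ) (i : Fin 3) (p : R4) : ℝ :=
  (-2) * (r2 p * mom P Q i p) - 4 * tc p * xJ P Q i p + 8 * tc p ^ 2 * eJ P Q i p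

omit hP hQ in
@[fun_prop]
lemma r2_sm : ContDiff ℝ ∞ r2 := by
  unfold r2; exact ContDiff.sum fun i _ => by fun_prop
@[fun_prop]
lemma xP_sm : ContDiff ℝ ∞ (xP P Q) := by
  unfold xP; exact ContDiff.sum fun i _ => by fun_prop
omit hQ in
@[fun_prop]
lemma xg_sm : ContDiff ℝ ∞ (xg P) := by
  unfold xg; exact ContDiff.sum fun i _ => by fun_prop
@[fun_prop]
lemma imt_sm : ContDiff ℝ ∞ (imt P Q) := by unfold imt; fun_prop
@[fun_prop]
lemma pcD_sm : ContDiff ℝ ∞ (pcD P Q) := by unfold pcD; fun_prop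
@[fun_prop]
lemma xJ_sm (i : Fin 3) : ContDiff ℝ ∞ (xJ P Q i) := by unfold xJ; fun_prop
@[fun_prop]
lemma pcJ_sm (i : Fin 3) : ContDiff ℝ ∞ (pcJ P Q i) := by unfold pcJ; fun_prop

omit hP hQ in
lemma D_r2 (v p : R4) : D v r2 p = 2 * ∑ i, xc i p * v.2 i := by
  have e : r2 = fun p => xc 0 p ^ 2 + xc 1 p ^ 2 + xc 2 p ^ 2 := by
    funext p; simp [r2, Fin.sum_univ_three]
  rw [e, Fin.sum_univ_three]
  simp (disch := fun_prop) only [D_add, D_pow, D_xc]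
  norm_num; ring

lemma D_xP (v p : R4) : D v (xP P Q) p = ∑ i, (v.2 i * mom P Q i p + xc i p * D v (mom P Q i) p) := by
  have e : xP P Q = fun p => xc 0 p * mom P Q 0 p + xc 1 p * mom P Q 1 p + xc 2 p * mom P Q 2 p := by
    funext p; simp [xP, Fin.sum_univ_three]
  rw [e, Fin.sum_univ_three]
  simp (disch := fun_prop) only [D_add, D_mul, D_xc]
  ring

omit hQ in
lemma D_xg (v p : R4) : D v (xg P) p = ∑ i, (v.2 i * D (vX i) P p + xc i p * D v (D (vX i) P) p) := by
  have e : xg P = fun p => xc 0 p * D (vX 0) P p + xc 1 p * D (vX 1) P p + xc 2 p * D (vX 2) P p := by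
    funext p; simp [xg, Fin.sum_univ_three]
  rw [e, Fin.sum_univ_three]
  simp (disch := fun_prop) only [D_add, D_mul, D_xc]
  ring

lemma D_imt (v p : R4) : D v (imt P Q) p = D v P p * D vT Q p + P p * D v (D vT Q) p
    - D v Q p * D vT P p - Q p * D v (D vT P) p := by
  unfold imt
  simp (disch := fun_prop) only [D_sub, D_mul]
  ring

lemma xP_id (p : R4)
    (e1 : D vT P p = - (∑ i, D (vX i) (D (vX i) Q) p) + (P p ^ 2 + Q p ^ 2) * Q p)
    (e2 : D vT Q p = (∑ i, D (vX i) (D (vX i) P) p) - (P p ^ 2 + Q p ^ 2) * P p) :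
    D vT (xP P Q) p = ∑ i, D (vX i) (xJ P Q i) p + (2 * gD P Q p + 3/2 * nD P Q p ^ 2) := by
  have hx : ∀ i, D (vX i) (xJ P Q i) p =
     imt P Q p + xc i p * D (vX i) (imt P Q) p
     - 3 * (D (vX i) P p ^ 2 + P p * D (vX i) (D (vX i) P) p + D (vX i) Q p ^ 2 + Q p * D (vX i) (D (vX i) Q) p)
     - 2 * (D (vX i) (D (vX i) P) p * xg P p + D (vX i) P p * D (vX i) (xg P) p
       + D (vX i) (D (vX i) Q) p * xg Q p + D (vX i) Q p * D (vX i) (xg Q) p)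
     + gD P Q p + xc i p * D (vX i) (gD P Q) p + 1/2 * (nD P Q p ^ 2)
     + xc i p * nD P Q p * D (vX i) (nD P Q) p := by
    intro i
    unfold xJ
    simp (disch := fun_prop) only [D_add, D_sub, D_mul, D_const, D_pow, D_xc, vX_snd]
    norm_num
    ring
  rw [D_xP hP hQ]
  simp only [hx, D_mom hP hQ, D_imt hP hQ, D_xg hP, D_xg hQ, D_gD hP hQ, D_nD hP hQ, vX_snd, Fin.sum_univ_three] at *
  simp only [D_comm hP (vX _) vT, D_comm hQ (vX _) vT,
    D_comm hP (vX 1) (vX 0), D_comm hP (vX 2) (vX 0), D_comm hP (vX 2) (vX 1),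
    D_comm hQ (vX 1) (vX 0), D_comm hQ (vX 2) (vX 0), D_comm hQ (vX 2) (vX 1)]
  simp only [imt, xg, gD, nD, Fin.sum_univ_three, vT_snd, f20, f21, f02, f12, f10, f01, if_true, if_false]
  linear_combination (2 * (xc 0 p * D (vX 0) Q p + xc 1 p * D (vX 1) Q p + xc 2 p * D (vX 2) Q p) + 3 * Q p) * e1
    - (2 * (xc 0 p * D (vX 0) P p + xc 1 p * D (vX 1) P p + xc 2 p * D (vX 2) P p) + 3 * P p) * e2

lemma pc_id (p : R4)
    (e1 : D vT P p = - (∑ i, D (vX i) (D (vX i) Q) p) + (P p ^ 2 + Q p ^ 2) * Q p)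
    (e2 : D vT Q p = (∑ i, D (vX i) (D (vX i) P) p) - (P p ^ 2 + Q p ^ 2) * P p) :
    D vT (pcD P Q) p = ∑ i, D (vX i) (pcJ P Q i) p + (-2) * tc p * nD P Q p ^ 2 := by
  have a1 := wmass_id hP hQ r2 r2_sm p e1 e2
  have a2 := energy_id hP hQ p e1 e2
  have a3 := xP_id hP hQ p e1 e2
  have hJ : ∀ i, D (vX i) (pcJ P Q i) p = D (vX i) (fun q => (-2) * (r2 q * mom P Q i q)) p
     - 4 * tc p * D (vX i) (xJ P Q i) p + 8 * tc p ^ 2 * D (vX i) (eJ P Q i) p := by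
    intro i
    unfold pcJ
    simp (disch := fun_prop) only [D_add, D_sub, D_mul, D_const, D_pow, D_tc]
    simp [vX]
  have hD : D vT (pcD P Q) p = D vT (fun q => r2 q * nD P Q q) p - 4 * xP P Q p - 4 * tc p * D vT (xP P Q) p
     + 16 * tc p * eD P Q p + 8 * tc p ^ 2 * D vT (eD P Q) p := by
    unfold pcD
    simp (disch := fun_prop) only [D_add, D_sub, D_mul, D_const, D_pow, D_tc]
    simp [vT]
    ring
  rw [hD, a1, a2, a3]
  simp only [hJ, Finset.sum_add_distrib, Finset.sum_sub_distrib, ← Finset.mul_sum, D_r2, vX_snd, xP, eD, Fin.sum_univ_three, vT_snd, f20, f21, f02, f12, f10, f01, if_true, if_false]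
  ring
end

end Part7

section Part8



abbrev nU (u : ℝ → E3 → ℂ) : R4 → ℝ := nD (Pr u) (Qi u)
abbrev gU (u : ℝ → E3 → ℂ) : R4 → ℝ := gD (Pr u) (Qi u)
abbrev tU (u : ℝ → E3 → ℂ) : R4 → ℝ := tD (Pr u) (Qi u)
abbrev eU (u : ℝ → E3 → ℂ) : R4 → ℝ := eD (Pr u) (Qi u)

def Imass (u : ℝ → E3 → ℂ) (t : ℝ) : ℝ := ∫ x, nU u (t, x)
def Igr (u : ℝ → E3 → ℂ) (t : ℝ) : ℝ := ∫ x, gU u (t, x)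
def Iq (u : ℝ → E3 → ℂ) (t : ℝ) : ℝ := ∫ x, nU u (t, x) ^ 2
def It (u : ℝ → E3 → ℂ) (t : ℝ) : ℝ := ∫ x, tU u (t, x) ^ 2
def Ivar (u : ℝ → E3 → ℂ) (t : ℝ) : ℝ := ∫ x, r2 (t, x) * nU u (t, x)
def Ien (u : ℝ → E3 → ℂ) (t : ℝ) : ℝ := ∫ x, eU u (t, x)

def wt (x : E3) : ℝ := (1 + ‖x‖) ^ (-(4:ℝ))

lemma wt_int : Integrable wt := integrable_one_add_norm (by simp; norm_num)

lemma wt_eq (x : E3) : wt x = ((1 + ‖x‖)⁻¹) ^ 4 := by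
  unfold wt
  rw [Real.rpow_neg (by positivity), inv_pow]
  norm_cast

lemma sq_norm_ri (z : ℂ) : z.re ^ 2 + z.im ^ 2 = ‖z‖ ^ 2 := by
  rw [Complex.sq_norm, Complex.normSq_apply]; ring

lemma nU_eq (u : ℝ → E3 → ℂ) (p : R4) : nU u p = ‖UU u p‖ ^ 2 := sq_norm_ri _
lemma gU_eq {u : ℝ → E3 → ℂ} (h : ContDiff ℝ ∞ (UU u)) (p : R4) :
    gU u p = ∑ i, ‖D (vX i) (UU u) p‖ ^ 2 := by
  unfold gU gD
  simp_rw [D_Pr h, D_Qi h, sq_norm_ri]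
lemma tU_eq {u : ℝ → E3 → ℂ} (h : ContDiff ℝ ∞ (UU u)) (p : R4) :
    tU u p = ‖D vT (UU u) p‖ ^ 2 := by
  unfold tU tD
  simp_rw [D_Pr h, D_Qi h, sq_norm_ri]
lemma r2_eq (p : R4) : r2 p = ‖p.2‖ ^ 2 := by
  rw [EuclideanSpace.norm_sq_eq]; simp [r2, xc]

lemma nD_nn (P Q : R4 → ℝ) (p : R4) : 0 ≤ nD P Q p := by unfold nD; positivity
lemma gD_nn (P Q : R4 → ℝ) (p : R4) : 0 ≤ gD P Q p := by unfold gD; positivity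
lemma tD_nn (P Q : R4 → ℝ) (p : R4) : 0 ≤ tD P Q p := by unfold tD; positivity
lemma r2_nn (p : R4) : 0 ≤ r2 p := by unfold r2; positivity

lemma Sol.slice {α β : ℝ} {u : ℝ → E3 → ℂ} (h : Sol α β u) (t : ℝ) (g : SW) (hg : ∀ x, u t x = g x) (i : Fin 3) (x : E3) :
    D (vX i) (UU u) (t, x) = dS i g x := by
  rw [D_slice h.sm, dS_apply]
  have : (fun y => UU u (t, y)) = g := funext hg
  rw [this]

section
variable {α β : ℝ} {u : ℝ → E3 → ℂ} (h : Sol α β u) (t : ℝ)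
include h

lemma int_n : Integrable (fun x => nU u (t, x)) := by
  obtain ⟨g, hg⟩ := h.sw t
  refine (sw_sq_int g).congr (Eventually.of_forall fun x => ?_)
  simp only; rw [nU_eq, ← hg]; rfl

lemma int_g : Integrable (fun x => gU u (t, x)) := by
  obtain ⟨g, hg⟩ := h.sw t
  refine (integrable_finsetSum Finset.univ fun i _ => sw_sq_int (dS i g)).congr (Eventually.of_forall fun x => ?_)
  simp only; rw [gU_eq h.sm]; simp_rw [h.slice t g hg]

lemma int_n2 : Integrable (fun x => nU u (t, x) ^ 2) := by
  obtain ⟨g, hg⟩ := h.sw t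
  refine ((sw_memLp g 4).integrable_norm_pow (p := 4) (by norm_num)).congr (Eventually.of_forall fun x => ?_)
  simp only; rw [nU_eq, ← hg, ← pow_mul]; rfl

lemma int_t2 : Integrable (fun x => tU u (t, x) ^ 2) := by
  obtain ⟨g, hg⟩ := h.swt t
  refine ((sw_memLp g 4).integrable_norm_pow (p := 4) (by norm_num)).congr (Eventually.of_forall fun x => ?_)
  simp only; rw [tU_eq h.sm, ← hg, ← pow_mul]

lemma int_v : Integrable (fun x => r2 (t, x) * nU u (t, x)) := by
  obtain ⟨g, hg⟩ := h.sw t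
  have h1 := g.integrable_pow_mul volume 2
  obtain ⟨C, hC⟩ := g.decay 0 0
  have h2 := h1.mul_const C
  refine h2.mono' ?_ (Eventually.of_forall fun x => ?_)
  · have hc : Continuous fun p => r2 p * nU u p := (r2_sm.mul (nD_sm (Pr_sm h.sm) (Qi_sm h.sm))).continuous
    exact (hc.comp (Continuous.prodMk_right t)).aestronglyMeasurable
  · have hx := hC.2 x
    simp at hx
    rw [Real.norm_of_nonneg (mul_nonneg (r2_nn _) (nD_nn _ _ _)), show nD (Pr u) (Qi u) (t, x) = _ from nU_eq u (t, x), r2_eq]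
    have e : UU u (t, x) = g x := hg x
    rw [e]
    have h0 := norm_nonneg (g x)
    have : 0 ≤ ‖x‖ ^ 2 * ‖g x‖ := by positivity
    simp only
    nlinarith

lemma int_e : Integrable (fun x => eU u (t, x)) := by
  have := ((int_g h t).const_mul (1/2)).add ((int_n2 h t).const_mul (1/4))
  exact this

lemma Ien_eq : Ien u t = 1/2 * Igr u t + 1/4 * Iq u t := by
  unfold Ien Igr Iq
  rw [← integral_const_mul, ← integral_const_mul, ← integral_add ((int_g h t).const_mul (1/2)) ((int_n2 h t).const_mul (1/4))]
  rfl
end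

lemma cont_slice {f : R4 → ℝ} (hf : ContDiff ℝ ∞ f) (t : ℝ) : Continuous fun x => f (t, x) :=
  hf.continuous.comp (Continuous.prodMk_right t)

lemma Imass_nn (u : ℝ → E3 → ℂ) (t : ℝ) : 0 ≤ Imass u t := integral_nonneg fun _ => nD_nn _ _ _
lemma Igr_nn (u : ℝ → E3 → ℂ) (t : ℝ) : 0 ≤ Igr u t := integral_nonneg fun _ => gD_nn _ _ _
lemma Iq_nn (u : ℝ → E3 → ℂ) (t : ℝ) : 0 ≤ Iq u t := integral_nonneg fun _ => by positivity
lemma It_nn (u : ℝ → E3 → ℂ) (t : ℝ) : 0 ≤ It u t := integral_nonneg fun _ => by positivity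

/-- pointwise flux bounds -/
lemma g_ge (P Q : R4 → ℝ) (p : R4) (i : Fin 3) : D (vX i) P p ^ 2 + D (vX i) Q p ^ 2 ≤ gD P Q p :=
  Finset.single_le_sum (f := fun i => D (vX i) P p ^ 2 + D (vX i) Q p ^ 2) (fun i _ => by positivity) (Finset.mem_univ i)

lemma mom_bd (P Q : R4 → ℝ) (p : R4) (i : Fin 3) : |2 * mom P Q i p| ≤ nD P Q p + gD P Q p := by
  have := g_ge P Q p i
  unfold mom nD
  rw [abs_le]
  constructor <;> nlinarith [sq_nonneg (P p + D (vX i) Q p), sq_nonneg (P p - D (vX i) Q p),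
    sq_nonneg (Q p + D (vX i) P p), sq_nonneg (Q p - D (vX i) P p)]

lemma mass_law {t0 t1 : ℝ} {u : ℝ → E3 → ℂ} (h : Sol t0 t1 u) (h01 : t0 ≤ t1) (C : ℝ)
    (hC : ∀ t ∈ Set.Icc t0 t1, Imass u t ≤ C ∧ Igr u t ≤ C) : Imass u t1 = Imass u t0 := by
  have hP := Pr_sm h.sm
  have hQ := Qi_sm h.sm
  have := (cons_sm t0 t1 h01 (nU u) (fun i q => (-2) * mom (Pr u) (Qi u) i q) (fun _ => 0)
    (fun p => nU u p + gU u p) (2 * C) (nD_sm hP hQ) (fun i => by fun_prop)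
    (fun p hp => mass_id hP hQ p (h.real_eqn p hp).1 (h.real_eqn p hp).2)
    (fun t ht => int_n h t) (fun t ht => ⟨(int_n h t).add (int_g h t), ?_⟩) (fun p hp i => ?_) (fun p hp => ?_)).2
  · simp at this
    unfold Imass; linarith
  · rw [integral_add (int_n h t) (int_g h t)]
    have := hC t ht; unfold Imass Igr at this; linarith
  · have h1 := mom_bd (Pr u) (Qi u) p i
    have h2 : 0 ≤ nU u p + gU u p := add_nonneg (nD_nn _ _ _) (gD_nn _ _ _)
    rw [Real.norm_eq_abs, show (-2) * mom (Pr u) (Qi u) i p = -(2 * mom (Pr u) (Qi u) i p) by ring, abs_neg]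
    nlinarith [norm_nonneg p.2, mul_nonneg (norm_nonneg p.2) h2]
  · simp only [norm_zero]; exact add_nonneg (nD_nn _ _ _) (gD_nn _ _ _)

lemma abc_bd (a b c : ℝ) : |a * b * c| ≤ a ^ 2 + b ^ 4 + c ^ 4 := by
  rw [abs_le]
  constructor <;> nlinarith [sq_nonneg (a + b * c), sq_nonneg (a - b * c), sq_nonneg (b ^ 2 - c ^ 2),
    sq_nonneg (b ^ 2), sq_nonneg (c^2), sq_nonneg (b * c), sq_nonneg a]

/-- dividing flux bounds by the weight -/
lemma flux_bd (x : E3) (a b : ℝ) : |a * b| ≤ (1 + ‖x‖) * (a ^ 2 + b ^ 4 + wt x) := by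
  have hx : (0:ℝ) < 1 + ‖x‖ := by positivity
  have h := abc_bd a b ((1 + ‖x‖)⁻¹)
  rw [wt_eq]
  rw [abs_mul, abs_of_pos (inv_pos.2 hx)] at h
  calc |a * b| = (1 + ‖x‖) * (|a * b| * (1 + ‖x‖)⁻¹) := by field_simp
    _ ≤ _ := by gcongr

lemma eJ_bd (P Q : R4 → ℝ) (p : R4) (i : Fin 3) :
    |eJ P Q i p| ≤ (1 + ‖p.2‖) * (gD P Q p + tD P Q p ^ 2 + 2 * wt p.2) := by
  have h1 := flux_bd p.2 (D (vX i) P p) (D vT P p)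
  have h2 := flux_bd p.2 (D (vX i) Q p) (D vT Q p)
  have hg := g_ge P Q p i
  unfold eJ
  have e : D vT P p * D (vX i) P p + D vT Q p * D (vX i) Q p = D (vX i) P p * D vT P p + D (vX i) Q p * D vT Q p := by ring
  rw [e]
  refine (abs_add_le _ _).trans ((add_le_add h1 h2).trans ?_)
  rw [← mul_add]
  refine mul_le_mul_of_nonneg_left ?_ (by positivity)
  unfold tD
  nlinarith [sq_nonneg (D vT P p * D vT Q p)]

structure Bd (α β : ℝ) (u : ℝ → E3 → ℂ) (C : ℝ) : Prop where
  m : ∀ t ∈ Set.Icc α β, Imass u t ≤ C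
  g : ∀ t ∈ Set.Icc α β, Igr u t ≤ C
  q : ∀ t ∈ Set.Icc α β, Iq u t ≤ C
  t : ∀ t ∈ Set.Icc α β, It u t ≤ C

lemma Bd.mono {α β α' β' C : ℝ} {u : ℝ → E3 → ℂ} (h : Bd α β u C) (h1 : α ≤ α') (h2 : β' ≤ β) : Bd α' β' u C :=
  have hs : Set.Icc α' β' ⊆ Set.Icc α β := Set.Icc_subset_Icc h1 h2
  ⟨fun t ht => h.m t (hs ht), fun t ht => h.g t (hs ht), fun t ht => h.q t (hs ht), fun t ht => h.t t (hs ht)⟩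

lemma energy_law {t0 t1 : ℝ} {u : ℝ → E3 → ℂ} (h : Sol t0 t1 u) (h01 : t0 ≤ t1) (C : ℝ)
    (hC : Bd t0 t1 u C) : Ien u t1 = Ien u t0 := by
  have hP := Pr_sm h.sm
  have hQ := Qi_sm h.sm
  have hMi : ∀ t, Integrable (fun x => gU u (t, x) + tU u (t, x) ^ 2 + 2 * wt x) := fun t =>
    ((int_g h t).add (int_t2 h t)).add (wt_int.const_mul 2)
  have := (cons_sm t0 t1 h01 (eU u) (eJ (Pr u) (Qi u)) (fun _ => 0)
    (fun p => gU u p + tU u p ^ 2 + 2 * wt p.2) (2 * C + 2 * ∫ x, wt x) (eD_sm hP hQ) (fun i => by fun_prop)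
    (fun p hp => energy_id hP hQ p (h.real_eqn p hp).1 (h.real_eqn p hp).2)
    (fun t ht => int_e h t) (fun t ht => ⟨hMi t, ?_⟩) (fun p hp i => ?_) (fun p hp => ?_)).2
  · simp at this
    unfold Ien; linarith
  · have e := integral_add ((int_g h t).add (int_t2 h t)) (wt_int.const_mul 2)
    have e2 := integral_add (int_g h t) (int_t2 h t)
    simp only [Pi.add_apply] at e e2
    rw [integral_const_mul] at e
    have h1 := hC.g t ht; have h2 := hC.t t ht; unfold Igr at h1; unfold It at h2
    simp only
    linarith
  · exact eJ_bd _ _ _ _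
  · simp only [norm_zero]
    have : 0 ≤ wt p.2 := by unfold wt; positivity
    have := gD_nn (Pr u) (Qi u) p
    positivity

end Part8

section Part9



def cE (ε : ℝ) (p : R4) : ℝ := (1 + ε * r2 p)⁻¹
def wE (ε : ℝ) (p : R4) : ℝ := Real.exp (- tc p) * (r2 p * cE ε p)

section
variable {ε : ℝ} (hε : 0 < ε)
include hε

lemma cE_pos (p : R4) : 0 < cE ε p := by
  have := r2_nn p
  unfold cE; positivity

lemma cE_mul (p : R4) : cE ε p * (1 + ε * r2 p) = 1 := by
  have := r2_nn p
  unfold cE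
  exact inv_mul_cancel₀ (by positivity)

lemma cE_le (p : R4) : cE ε p ≤ 1 := by
  have := r2_nn p
  have h1 := cE_pos hε p
  have h2 := cE_mul hε p
  nlinarith [mul_nonneg h1.le (mul_nonneg hε.le this)]

lemma cE_r2 (p : R4) : ε * (r2 p * cE ε p) ≤ 1 := by
  have h1 := cE_pos hε p
  have h2 := cE_mul hε p
  nlinarith

lemma cE_sm : ContDiff ℝ ∞ (cE ε) := by
  unfold cE
  refine ContDiff.inv (by fun_prop) fun p => ?_
  have := r2_nn p
  positivity

lemma wE_sm : ContDiff ℝ ∞ (wE ε) := by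
  have := cE_sm hε
  unfold wE; fun_prop

lemma D_cE (v p : R4) : D v (cE ε) p = - ε * cE ε p ^ 2 * D v r2 p := by
  have h0 : (1 + ε * r2 p) ≠ 0 := by have := r2_nn p; positivity
  have h1 : HasFDerivAt (fun q => 1 + ε * r2 q) (ε • fderiv ℝ r2 p) p :=
    ((sm_diff r2_sm p).hasFDerivAt.const_mul ε).const_add 1
  have h2 := (hasDerivAt_inv h0).comp_hasFDerivAt p h1
  have h3 : D v (cE ε) p = _ := congrArg (fun L => L v) h2.fderiv
  rw [h3]
  simp [D, cE]
  ring

lemma D_wE (v p : R4) : D v (wE ε) p = - (v.1 * wE ε p) + Real.exp (- tc p) * (cE ε p ^ 2 * D v r2 p) := by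
  have hc := cE_sm hε
  have he : D v (fun q => Real.exp (- tc q)) p = - v.1 * Real.exp (- tc p) := by
    have h1 : HasFDerivAt (fun q : R4 => - tc q) (- fderiv ℝ tc p) p := (sm_diff tc_sm p).hasFDerivAt.neg
    have h2 := h1.exp
    have h3 : D v (fun q => Real.exp (- tc q)) p = _ := congrArg (fun L => L v) h2.fderiv
    have h4 := D_tc v p
    unfold D at h4
    rw [h3]; simp [h4]; ring
  have hm := cE_mul hε p
  unfold wE
  simp (disch := fun_prop) only [D_mul, he, D_cE hε]
  linear_combination (- Real.exp (-tc p) * D v r2 p * cE ε p) * hm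

lemma wE_bd (p : R4) (hp : 0 ≤ p.1) : 0 ≤ wE ε p ∧ wE ε p ≤ 1/ε ∧ wE ε p ≤ r2 p := by
  have h1 := cE_pos hε p
  have h2 := cE_r2 hε p
  have h3 := r2_nn p
  have h4 := cE_le hε p
  have h5 : Real.exp (- tc p) ≤ 1 := Real.exp_le_one_iff.2 (by unfold tc; linarith)
  have h6 := Real.exp_pos (- tc p)
  have h7 : 0 ≤ r2 p * cE ε p := by positivity
  have h8 : wE ε p ≤ r2 p * cE ε p := by unfold wE; nlinarith
  refine ⟨by unfold wE; positivity, ?_, ?_⟩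
  · rw [le_div_iff₀ hε]; nlinarith
  · nlinarith
end

def sE (P Q : R4 → ℝ) (ε : ℝ) (p : R4) : ℝ :=
  D vT (wE ε) p * nD P Q p + 2 * ∑ i, D (vX i) (wE ε) p * mom P Q i p

lemma sE_eq (P Q : R4 → ℝ) {ε : ℝ} (hε : 0 < ε) (p : R4) : sE P Q ε p =
    - (wE ε p * nD P Q p) + 4 * (Real.exp (- tc p) * (cE ε p ^ 2 * ∑ i, xc i p * mom P Q i p)) := by
  unfold sE
  simp only [D_wE hε, D_r2, vX_snd, vT_snd, Fin.sum_univ_three, f20, f21, f02, f12, f10, f01, if_true, if_false]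
  simp only [vX, vT]
  ring

lemma sE_le (P Q : R4 → ℝ) {ε : ℝ} (hε : 0 < ε) (p : R4) (hp : 0 ≤ p.1) : sE P Q ε p ≤ 4 * gD P Q p := by
  rw [sE_eq P Q hε]
  have h1 := cE_pos hε p
  have h4 := cE_le hε p
  have h5 : Real.exp (- tc p) ≤ 1 := Real.exp_le_one_iff.2 (by unfold tc; linarith)
  have h6 := Real.exp_pos (- tc p)
  have hg := gD_nn P Q p
  set c := cE ε p
  have key : ∀ i, 4 * (c ^ 2 * (xc i p * mom P Q i p)) ≤
      c * (xc i p ^ 2 * nD P Q p) + 4 * c ^ 3 * (D (vX i) P p ^ 2 + D (vX i) Q p ^ 2) := by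
    intro i
    unfold mom nD
    have a := mul_nonneg h1.le (sq_nonneg (xc i p * P p - 2 * c * D (vX i) Q p))
    have b := mul_nonneg h1.le (sq_nonneg (xc i p * Q p + 2 * c * D (vX i) P p))
    nlinarith
  have sum : 4 * (c ^ 2 * ∑ i, xc i p * mom P Q i p) ≤ c * (r2 p * nD P Q p) + 4 * c ^ 3 * gD P Q p := by
    have := Finset.sum_le_sum fun i (_ : i ∈ Finset.univ) => key i
    rw [Finset.sum_add_distrib, ← Finset.mul_sum, ← Finset.mul_sum, ← Finset.mul_sum, ← Finset.mul_sum,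
      ← Finset.sum_mul] at this
    exact this
  have hc3 : c ^ 3 ≤ 1 := pow_le_one₀ h1.le h4
  have s2 : 4 * (c ^ 2 * ∑ i, xc i p * mom P Q i p) - c * (r2 p * nD P Q p) ≤ 4 * gD P Q p := by
    nlinarith
  calc _ = Real.exp (- tc p) * (4 * (c ^ 2 * ∑ i, xc i p * mom P Q i p) - c * (r2 p * nD P Q p)) := by
        unfold wE; ring
    _ ≤ Real.exp (- tc p) * (4 * gD P Q p) := by gcongr
    _ ≤ 1 * (4 * gD P Q p) := by gcongr
    _ = _ := one_mul _

lemma xc_sq_le (p : R4) (i : Fin 3) : xc i p ^ 2 ≤ r2 p :=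
  Finset.single_le_sum (f := fun i => xc i p ^ 2) (fun i _ => by positivity) (Finset.mem_univ i)

lemma xc_abs_le (p : R4) (i : Fin 3) : |xc i p| ≤ ‖p.2‖ := by
  refine abs_le_of_sq_le_sq ?_ (norm_nonneg _)
  rw [← r2_eq]; exact xc_sq_le p i

lemma sE_abs (P Q : R4 → ℝ) {ε : ℝ} (hε : 0 < ε) (p : R4) (hp : 0 ≤ p.1) :
    |sE P Q ε p| ≤ (10 * (1 + 1/ε)) * (nD P Q p + gD P Q p) := by
  rw [sE_eq P Q hε]
  have h1 := cE_pos hε p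
  have h4 := cE_le hε p
  have h5 : Real.exp (- tc p) ≤ 1 := Real.exp_le_one_iff.2 (by unfold tc; linarith)
  have h6 := Real.exp_pos (- tc p)
  have hg := gD_nn P Q p
  have hn := nD_nn P Q p
  have hw := wE_bd hε p hp
  have hcr : r2 p * cE ε p ≤ 1/ε := by
    rw [le_div_iff₀ hε]; linarith [cE_r2 hε p]
  set c := cE ε p
  have hi : ∀ i, |c ^ 2 * (xc i p * mom P Q i p)| ≤ (1 + 1/ε) / 2 * (nD P Q p + gD P Q p) := by
    intro i
    have hm := mom_bd P Q p i
    rw [abs_mul, abs_of_pos (two_pos)] at hm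
    rw [abs_mul, abs_mul, abs_of_nonneg (sq_nonneg c), ← mul_assoc]
    have hx : c ^ 2 * |xc i p| ≤ 1 + 1/ε := by
      have a := xc_sq_le p i
      have b : |xc i p| ≤ 1 + r2 p := by
        nlinarith [sq_nonneg (|xc i p| - 1), sq_abs (xc i p), abs_nonneg (xc i p)]
      have d := r2_nn p
      calc c ^ 2 * |xc i p| ≤ c ^ 2 * (1 + r2 p) := by gcongr
        _ = c * (c + r2 p * c) := by ring
        _ ≤ 1 * (1 + 1/ε) := by gcongr
        _ = _ := one_mul _
    calc _ ≤ (1 + 1/ε) * ((nD P Q p + gD P Q p) / 2) := by gcongr; linarith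
      _ = _ := by ring
  have hsum : |c ^ 2 * ∑ i, xc i p * mom P Q i p| ≤ 3 * ((1 + 1/ε) / 2 * (nD P Q p + gD P Q p)) := by
    rw [Finset.mul_sum]
    refine (Finset.abs_sum_le_sum_abs _ _).trans ((Finset.sum_le_sum fun i _ => hi i).trans (by simp))
  have hK : 0 ≤ (1 + 1/ε) * (nD P Q p + gD P Q p) := by positivity
  have a1 : |Real.exp (- tc p) * (c ^ 2 * ∑ i, xc i p * mom P Q i p)| ≤ 1 * (3 * ((1 + 1/ε) / 2 * (nD P Q p + gD P Q p))) := by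
    rw [abs_mul, abs_of_pos h6]; gcongr
  have a2 : |-(wE ε p * nD P Q p)| ≤ (1 + 1/ε) * (nD P Q p + gD P Q p) := by
    rw [abs_neg, abs_of_nonneg (mul_nonneg hw.1 hn)]
    calc _ ≤ (1/ε) * nD P Q p := by gcongr; exact hw.2.1
      _ ≤ _ := by gcongr <;> linarith
  refine (abs_add_le _ _).trans ?_
  rw [abs_mul 4, abs_of_pos (four_pos : (0:ℝ) < 4)]
  nlinarith

lemma virial_eps {T : ℝ} {u : ℝ → E3 → ℂ} (h : Sol 0 T u) (hT : 0 ≤ T) (C : ℝ)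
    (hC : ∀ t ∈ Set.Icc 0 T, Imass u t ≤ C ∧ Igr u t ≤ C) {ε : ℝ} (hε : 0 < ε) :
    ∫ x, wE ε (T, x) * nU u (T, x) ≤ Ivar u 0 + 4 * C * T := by
  have hP := Pr_sm h.sm
  have hQ := Qi_sm h.sm
  have hw := wE_sm hε
  have hMi : ∀ t, Integrable (fun x => (10 * (1 + 1/ε)) * (nU u (t, x) + gU u (t, x))) := fun t =>
    ((int_n h t).add (int_g h t)).const_mul _
  have hwi : ∀ t ≥ 0, Integrable (fun x => wE ε (t, x) * nU u (t, x)) := fun t ht => by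
    refine ((int_n h t).const_mul (1/ε)).mono' (cont_slice (f := fun p => wE ε p * nU u p) (by fun_prop) t).aestronglyMeasurable
      (Eventually.of_forall fun x => ?_)
    have a := wE_bd hε (t, x) ht
    have b := nD_nn (Pr u) (Qi u) (t, x)
    rw [Real.norm_of_nonneg (mul_nonneg a.1 b)]
    gcongr; exact a.2.1
  have law := cons_sm 0 T hT (fun p => wE ε p * nU u p) (fun i q => (-2) * (wE ε q * mom (Pr u) (Qi u) i q))
    (sE (Pr u) (Qi u) ε) (fun p => (10 * (1 + 1/ε)) * (nU u p + gU u p)) ((10 * (1 + 1/ε)) * (2 * C))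
    (by fun_prop) (fun i => by fun_prop)
    (fun p hp => wmass_id hP hQ (wE ε) hw p (h.real_eqn p hp).1 (h.real_eqn p hp).2)
    (fun t ht => hwi t ht.1) (fun t ht => ⟨hMi t, ?_⟩) (fun p hp i => ?_) (fun p hp => sE_abs _ _ hε p hp.1)
  · obtain ⟨li, le⟩ := law
    have hs : ∀ t ∈ Set.Icc 0 T, ∫ x, sE (Pr u) (Qi u) ε (t, x) ≤ 4 * C := by
      intro t ht
      have hsc : ContDiff ℝ ∞ (sE (Pr u) (Qi u) ε) := by
        unfold sE
        have : ContDiff ℝ ∞ fun p => ∑ i, D (vX i) (wE ε) p * mom (Pr u) (Qi u) i p :=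
          ContDiff.sum fun i _ => by fun_prop
        fun_prop
      have hsi : Integrable fun x => sE (Pr u) (Qi u) ε (t, x) :=
        (hMi t).mono' (cont_slice hsc t).aestronglyMeasurable (Eventually.of_forall fun x => sE_abs _ _ hε (t, x) ht.1)
      calc _ ≤ ∫ x, 4 * gU u (t, x) := integral_mono hsi ((int_g h t).const_mul 4) (fun x => sE_le _ _ hε (t, x) ht.1)
        _ = 4 * Igr u t := integral_const_mul _ _
        _ ≤ 4 * C := by gcongr; exact (hC t ht).2
    have b1 : ∫ t in (0:ℝ)..T, ∫ x, sE (Pr u) (Qi u) ε (t, x) ≤ ∫ t in (0:ℝ)..T, (4 * C) :=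
      intervalIntegral.integral_mono_on hT li intervalIntegrable_const hs
    have b2 : ∫ x, wE ε (0, x) * nU u (0, x) ≤ Ivar u 0 := by
      refine integral_mono (hwi 0 le_rfl) (int_v h 0) (fun x => ?_)
      have := nD_nn (Pr u) (Qi u) (0, x)
      have := (wE_bd hε (0, x) le_rfl).2.2
      simp only
      gcongr
    simp at b1
    linarith
  · rw [integral_const_mul]
    have : (0:ℝ) < 1/ε := by positivity
    rw [integral_add (int_n h t) (int_g h t)]
    have h3 := hC t ht; unfold Imass Igr at h3
    gcongr; linarith
  · have h1 := mom_bd (Pr u) (Qi u) p i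
    have a := wE_bd hε p hp.1
    have h2 : 0 ≤ nU u p + gU u p := add_nonneg (nD_nn _ _ _) (gD_nn _ _ _)
    rw [Real.norm_eq_abs, show (-2) * (wE ε p * mom (Pr u) (Qi u) i p) = -(wE ε p * (2 * mom (Pr u) (Qi u) i p)) by ring,
      abs_neg, abs_mul, abs_of_nonneg a.1]
    have hpos : (0:ℝ) < 1/ε := by positivity
    calc _ ≤ (1/ε) * (nU u p + gU u p) := by gcongr; exact a.2.1
      _ ≤ 1 * ((10 * (1 + 1/ε)) * (nU u p + gU u p)) := by rw [one_mul]; gcongr; linarith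
      _ ≤ _ := by gcongr; linarith [norm_nonneg p.2]

lemma virial {T : ℝ} {u : ℝ → E3 → ℂ} (h : Sol 0 T u) (hT : 0 ≤ T) (C : ℝ)
    (hC : ∀ t ∈ Set.Icc 0 T, Imass u t ≤ C ∧ Igr u t ≤ C) :
    Ivar u T ≤ Real.exp T * (Ivar u 0 + 4 * C * T) := by
  have hP := Pr_sm h.sm
  have hQ := Qi_sm h.sm
  have hpos : ∀ n : ℕ, (0:ℝ) < 1 / ((n:ℝ) + 1) := fun n => by positivity
  have lim : Tendsto (fun n : ℕ => ∫ x, wE (1 / ((n:ℝ) + 1)) (T, x) * nU u (T, x)) atTop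
      (𝓝 (∫ x, Real.exp (-T) * (r2 (T, x) * nU u (T, x)))) := by
    refine tendsto_integral_of_dominated_convergence (fun x => r2 (T, x) * nU u (T, x)) (fun n => ?_) (int_v h T)
      (fun n => Eventually.of_forall fun x => ?_) (Eventually.of_forall fun x => ?_)
    · have hw := wE_sm (hpos n)
      exact (cont_slice (f := fun p => wE (1 / ((n:ℝ) + 1)) p * nU u p) (by fun_prop) T).aestronglyMeasurable
    · have a := wE_bd (hpos n) (T, x) hT
      have b := nD_nn (Pr u) (Qi u) (T, x)
      rw [Real.norm_of_nonneg (mul_nonneg a.1 b)]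
      gcongr; exact a.2.2
    · have l1 : Tendsto (fun n : ℕ => 1 + 1 / ((n:ℝ) + 1) * r2 (T, x)) atTop (𝓝 (1 + 0 * r2 (T, x))) :=
        (tendsto_one_div_add_atTop_nhds_zero_nat.mul_const _).const_add 1
      have l2 := l1.inv₀ (by simp)
      have l3 := ((l2.const_mul (r2 (T, x))).const_mul (Real.exp (-T))).mul_const (nU u (T, x))
      simp only [zero_mul, add_zero, inv_one, mul_one] at l3
      rw [← mul_assoc]
      exact l3
  have le := le_of_tendsto lim (Eventually.of_forall fun n => virial_eps h hT C hC (hpos n))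
  rw [integral_const_mul] at le
  have := mul_le_mul_of_nonneg_left le (Real.exp_pos T).le
  rw [← mul_assoc, ← Real.exp_add, add_neg_cancel, Real.exp_zero, one_mul] at this
  exact this

end Part9

section Part10



/-- master dominating function -/
def mst (P Q : R4 → ℝ) (p : R4) : ℝ :=
  nD P Q p + gD P Q p + nD P Q p ^ 2 + tD P Q p ^ 2 + r2 p * nD P Q p + wt p.2

lemma wt_nn (x : E3) : 0 ≤ wt x := by unfold wt; positivity

lemma mst_nn (P Q : R4 → ℝ) (p : R4) : 0 ≤ mst P Q p := by
  have h1 := nD_nn P Q p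
  have h2 := gD_nn P Q p
  have h3 := tD_nn P Q p
  have h4 := r2_nn p
  have h5 := wt_nn p.2
  unfold mst; positivity

lemma rmom_bd (P Q : R4 → ℝ) (p : R4) (i : Fin 3) : ‖p.2‖ * |2 * mom P Q i p| ≤ r2 p * nD P Q p + gD P Q p := by
  have := g_ge P Q p i
  have hr := r2_eq p
  rw [← abs_of_nonneg (norm_nonneg p.2), ← abs_mul, hr]
  set r := ‖p.2‖
  unfold mom nD
  rw [abs_le]
  constructor <;> nlinarith [sq_nonneg (r * P p + D (vX i) Q p), sq_nonneg (r * P p - D (vX i) Q p),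
    sq_nonneg (r * Q p + D (vX i) P p), sq_nonneg (r * Q p - D (vX i) P p)]

lemma abs_prod_le (a b : ℝ) : |a * b| ≤ (a ^ 2 + b ^ 2) / 2 := by
  rw [abs_le]; constructor <;> nlinarith [sq_nonneg (a + b), sq_nonneg (a - b)]

lemma xg_bd (P Q : R4 → ℝ) (p : R4) (i : Fin 3) :
    |D (vX i) P p * xg P p + D (vX i) Q p * xg Q p| ≤ 3 * ((1 + ‖p.2‖) * gD P Q p) := by
  have hk : ∀ k : Fin 3, |xc k p * (D (vX i) P p * D (vX k) P p + D (vX i) Q p * D (vX k) Q p)| ≤ (1 + ‖p.2‖) * gD P Q p := by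
    intro k
    rw [abs_mul]
    have h1 := g_ge P Q p i
    have h2 := g_ge P Q p k
    have h3 := xc_abs_le p k
    have h4 : |D (vX i) P p * D (vX k) P p + D (vX i) Q p * D (vX k) Q p| ≤ gD P Q p := by
      refine (abs_add_le _ _).trans ?_
      have := abs_prod_le (D (vX i) P p) (D (vX k) P p)
      have := abs_prod_le (D (vX i) Q p) (D (vX k) Q p)
      linarith
    gcongr
    linarith
  have e : D (vX i) P p * xg P p + D (vX i) Q p * xg Q p =
      ∑ k, xc k p * (D (vX i) P p * D (vX k) P p + D (vX i) Q p * D (vX k) Q p) := by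
    simp only [xg, Fin.sum_univ_three]; ring
  rw [e]
  exact (Finset.abs_sum_le_sum_abs _ _).trans ((Finset.sum_le_sum fun k _ => hk k).trans (by simp))

lemma imt_bd (P Q : R4 → ℝ) (p : R4) : |imt P Q p| ≤ 2 * nD P Q p + 2 * (r2 p * nD P Q p) + tD P Q p ^ 2 + 2 * wt p.2 := by
  have hx : (0:ℝ) < 1 + ‖p.2‖ := by positivity
  have key : ∀ a b : ℝ, |a * b| ≤ (2 + 2 * ‖p.2‖ ^ 2) * a ^ 2 + b ^ 4 + wt p.2 := by
    intro a b
    have h := abc_bd ((1 + ‖p.2‖) * a) b ((1 + ‖p.2‖)⁻¹)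
    rw [wt_eq]
    have e : (1 + ‖p.2‖) * a * b * (1 + ‖p.2‖)⁻¹ = a * b := by field_simp
    rw [e] at h
    nlinarith [mul_nonneg (sq_nonneg (1 - ‖p.2‖)) (sq_nonneg a)]
  have h1 := key (P p) (D vT Q p)
  have h2 := key (Q p) (D vT P p)
  have h3 : |imt P Q p| ≤ |P p * D vT Q p| + |Q p * D vT P p| := abs_sub _ _
  rw [r2_eq]
  unfold nD tD
  nlinarith [sq_nonneg (D vT P p * D vT Q p)]

lemma xJ_bd (P Q : R4 → ℝ) (p : R4) (i : Fin 3) : |xJ P Q i p| ≤ 20 * ((1 + ‖p.2‖) * mst P Q p) := by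
  have h1 := nD_nn P Q p
  have h2 := gD_nn P Q p
  have h3 := tD_nn P Q p
  have h4 := r2_nn p
  have h5 := wt_nn p.2
  have hr := norm_nonneg p.2
  have hm := mst_nn P Q p
  have hx : |xc i p| ≤ 1 + ‖p.2‖ := (xc_abs_le p i).trans (by linarith)
  have b1 : |xc i p * imt P Q p| ≤ (1 + ‖p.2‖) * (2 * mst P Q p) := by
    rw [abs_mul]
    gcongr
    have := imt_bd P Q p
    unfold mst; nlinarith [sq_nonneg (nD P Q p), sq_nonneg (tD P Q p)]
  have b2 : |3 * (P p * D (vX i) P p + Q p * D (vX i) Q p)| ≤ (1 + ‖p.2‖) * (3 * mst P Q p) := by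
    have a1 := abs_prod_le (P p) (D (vX i) P p)
    have a2 := abs_prod_le (Q p) (D (vX i) Q p)
    have a3 := g_ge P Q p i
    have a4 : |P p * D (vX i) P p + Q p * D (vX i) Q p| ≤ mst P Q p := by
      refine (abs_add_le _ _).trans ?_
      have : nD P Q p = P p ^ 2 + Q p ^ 2 := rfl
      unfold mst
      nlinarith [sq_nonneg (nD P Q p), sq_nonneg (tD P Q p), mul_nonneg h4 h1]
    rw [abs_mul, abs_of_pos (three_pos : (0:ℝ) < 3)]
    nlinarith [mul_nonneg hr hm]
  have b3 : |2 * (D (vX i) P p * xg P p + D (vX i) Q p * xg Q p)| ≤ (1 + ‖p.2‖) * (6 * mst P Q p) := by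
    rw [abs_mul, abs_of_pos (two_pos : (0:ℝ) < 2)]
    have a := xg_bd P Q p i
    have : gD P Q p ≤ mst P Q p := by unfold mst; nlinarith [sq_nonneg (nD P Q p), sq_nonneg (tD P Q p), mul_nonneg h4 h1]
    nlinarith
  have b4 : |xc i p * gD P Q p| ≤ (1 + ‖p.2‖) * mst P Q p := by
    rw [abs_mul, abs_of_nonneg h2]
    have : gD P Q p ≤ mst P Q p := by unfold mst; nlinarith [sq_nonneg (nD P Q p), sq_nonneg (tD P Q p), mul_nonneg h4 h1]
    gcongr
  have b5 : |1/2 * (xc i p * nD P Q p ^ 2)| ≤ (1 + ‖p.2‖) * mst P Q p := by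
    rw [abs_mul, abs_of_pos (by norm_num : (0:ℝ) < 1/2), abs_mul, abs_of_nonneg (sq_nonneg (nD P Q p))]
    have : nD P Q p ^ 2 ≤ mst P Q p := by unfold mst; nlinarith [sq_nonneg (nD P Q p), sq_nonneg (tD P Q p), mul_nonneg h4 h1]
    have : |xc i p| * nD P Q p ^ 2 ≤ (1 + ‖p.2‖) * mst P Q p := by gcongr
    have := mul_nonneg (abs_nonneg (xc i p)) (sq_nonneg (nD P Q p))
    linarith
  unfold xJ
  refine (abs_add_le _ _).trans ?_
  have c1 := abs_add_le (xc i p * imt P Q p - 3 * (P p * D (vX i) P p + Q p * D (vX i) Q p)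
   - 2 * (D (vX i) P p * xg P p + D (vX i) Q p * xg Q p)) (xc i p * gD P Q p)
  have c2 := abs_sub (xc i p * imt P Q p - 3 * (P p * D (vX i) P p + Q p * D (vX i) Q p))
    (2 * (D (vX i) P p * xg P p + D (vX i) Q p * xg Q p))
  have c3 := abs_sub (xc i p * imt P Q p) (3 * (P p * D (vX i) P p + Q p * D (vX i) Q p))
  nlinarith [mul_nonneg hr hm]

lemma pcJ_bd (P Q : R4 → ℝ) (p : R4) (hp : 0 ≤ p.1) (i : Fin 3) :
    |pcJ P Q i p| ≤ (1 + ‖p.2‖) * ((1 + 80 * p.1 + 16 * p.1 ^ 2) * mst P Q p) := by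
  have h1 := nD_nn P Q p
  have h2 := gD_nn P Q p
  have h3 := tD_nn P Q p
  have h4 := r2_nn p
  have h5 := wt_nn p.2
  have hr := norm_nonneg p.2
  have hm := mst_nn P Q p
  have b1 : |(-2) * (r2 p * mom P Q i p)| ≤ (1 + ‖p.2‖) * mst P Q p := by
    have a := rmom_bd P Q p i
    have e : (-2) * (r2 p * mom P Q i p) = -(‖p.2‖ * (‖p.2‖ * (2 * mom P Q i p))) := by rw [r2_eq]; ring
    rw [e, abs_neg, abs_mul, abs_of_nonneg hr, abs_mul, abs_of_nonneg hr]
    have : r2 p * nD P Q p + gD P Q p ≤ mst P Q p := by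
      unfold mst; nlinarith [sq_nonneg (nD P Q p), sq_nonneg (tD P Q p)]
    gcongr
    · linarith
    · linarith
  have b2 : |4 * tc p * xJ P Q i p| ≤ 4 * p.1 * (20 * ((1 + ‖p.2‖) * mst P Q p)) := by
    rw [abs_mul, abs_of_nonneg (show (0:ℝ) ≤ 4 * tc p by unfold tc; positivity)]
    have := xJ_bd P Q p i
    unfold tc; gcongr
  have b3 : |8 * tc p ^ 2 * eJ P Q i p| ≤ 8 * p.1 ^ 2 * (2 * ((1 + ‖p.2‖) * mst P Q p)) := by
    rw [abs_mul, abs_of_nonneg (show (0:ℝ) ≤ 8 * tc p ^ 2 by unfold tc; positivity)]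
    have a := eJ_bd P Q p i
    have : gD P Q p + tD P Q p ^ 2 + 2 * wt p.2 ≤ 2 * mst P Q p := by
      unfold mst; nlinarith [sq_nonneg (nD P Q p), sq_nonneg (tD P Q p), mul_nonneg h4 h1]
    unfold tc; gcongr
    nlinarith
  unfold pcJ
  refine (abs_add_le _ _).trans ?_
  have c3 := abs_sub ((-2) * (r2 p * mom P Q i p)) (4 * tc p * xJ P Q i p)
  nlinarith [mul_nonneg hr hm]

lemma pcD_ge (P Q : R4 → ℝ) (p : R4) : 2 * p.1 ^ 2 * nD P Q p ^ 2 ≤ pcD P Q p := by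
  have e : pcD P Q p = 2 * p.1 ^ 2 * nD P Q p ^ 2 +
      ∑ i, ((xc i p * P p - 2 * p.1 * D (vX i) Q p) ^ 2 + (xc i p * Q p + 2 * p.1 * D (vX i) P p) ^ 2) := by
    simp only [pcD, tc, r2, xP, eD, gD, nD, mom, Fin.sum_univ_three]; ring
  rw [e]
  have : 0 ≤ ∑ i, ((xc i p * P p - 2 * p.1 * D (vX i) Q p) ^ 2 + (xc i p * Q p + 2 * p.1 * D (vX i) P p) ^ 2) := by positivity
  linarith

lemma pcD_le (P Q : R4 → ℝ) (p : R4) :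
    pcD P Q p ≤ 2 * (r2 p * nD P Q p) + 8 * p.1 ^ 2 * gD P Q p + 2 * p.1 ^ 2 * nD P Q p ^ 2 := by
  have e : 2 * (r2 p * nD P Q p) + 8 * p.1 ^ 2 * gD P Q p + 2 * p.1 ^ 2 * nD P Q p ^ 2 = pcD P Q p +
      ∑ i, ((xc i p * P p + 2 * p.1 * D (vX i) Q p) ^ 2 + (xc i p * Q p - 2 * p.1 * D (vX i) P p) ^ 2) := by
    simp only [pcD, tc, r2, xP, eD, gD, nD, mom, Fin.sum_univ_three]; ring
  rw [e]
  have : 0 ≤ ∑ i, ((xc i p * P p + 2 * p.1 * D (vX i) Q p) ^ 2 + (xc i p * Q p - 2 * p.1 * D (vX i) P p) ^ 2) := by positivity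
  linarith

lemma pseudo_conf {T : ℝ} {u : ℝ → E3 → ℂ} (h : Sol 0 T u) (hT : 0 ≤ T) (C : ℝ) (hC : Bd 0 T u C) :
    2 * T ^ 2 * Iq u T ≤ Ivar u 0 := by
  have hP := Pr_sm h.sm
  have hQ := Qi_sm h.sm
  have hC0 : 0 ≤ C := (Imass_nn u 0).trans (hC.m 0 ⟨le_rfl, hT⟩)
  have hV0 : 0 ≤ Ivar u 0 := integral_nonneg fun x => mul_nonneg (r2_nn _) (nD_nn _ _ _)
  obtain ⟨V, hV⟩ : ∃ V, ∀ t ∈ Set.Icc 0 T, Ivar u t ≤ V := by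
    refine ⟨Real.exp T * (Ivar u 0 + 4 * C * T), fun t ht => ?_⟩
    have := virial (h.mono le_rfl ht.2) ht.1 C (fun s hs => ⟨hC.m s ⟨hs.1, hs.2.trans ht.2⟩, hC.g s ⟨hs.1, hs.2.trans ht.2⟩⟩)
    refine this.trans ?_
    have a1 := ht.1
    have a2 := ht.2
    gcongr
  have hmi : ∀ t, Integrable (fun x => mst (Pr u) (Qi u) (t, x)) ∧
      ∫ x, mst (Pr u) (Qi u) (t, x) = Imass u t + Igr u t + Iq u t + It u t + Ivar u t + ∫ x, wt x := by
    intro t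
    have i1 := (int_n h t).add (int_g h t)
    have i2 := i1.add (int_n2 h t)
    have i3 := i2.add (int_t2 h t)
    have i4 := i3.add (int_v h t)
    have i5 := i4.add wt_int
    refine ⟨i5, ?_⟩
    have e5 := integral_add i4 wt_int
    have e4 := integral_add i3 (int_v h t)
    have e3 := integral_add i2 (int_t2 h t)
    have e2 := integral_add i1 (int_n2 h t)
    have e1 := integral_add (int_n h t) (int_g h t)
    simp only [Pi.add_apply] at e1 e2 e3 e4 e5
    unfold mst Imass Igr Iq It Ivar
    linarith
  set K := 1 + 80 * T + 16 * T ^ 2 with hK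
  have hpi : ∀ t ∈ Set.Icc 0 T, Integrable fun x => pcD (Pr u) (Qi u) (t, x) := by
    intro t ht
    have i0 := (((int_v h t).const_mul 2).add ((int_g h t).const_mul (8 * t ^ 2))).add ((int_n2 h t).const_mul (2 * t ^ 2))
    refine i0.mono' (cont_slice (pcD_sm hP hQ) t).aestronglyMeasurable (Eventually.of_forall fun x => ?_)
    have a := pcD_ge (Pr u) (Qi u) (t, x)
    have b := pcD_le (Pr u) (Qi u) (t, x)
    have : 0 ≤ 2 * t ^ 2 * nD (Pr u) (Qi u) (t, x) ^ 2 := by positivity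
    rw [Real.norm_of_nonneg (this.trans a)]
    exact b
  have law := (cons_sm 0 T hT (pcD (Pr u) (Qi u)) (pcJ (Pr u) (Qi u)) (fun p => (-2) * tc p * nU u p ^ 2)
    (fun p => K * mst (Pr u) (Qi u) p) (K * (4 * C + V + ∫ x, wt x)) (pcD_sm hP hQ) (fun i => pcJ_sm hP hQ i)
    (fun p hp => pc_id hP hQ p (h.real_eqn p hp).1 (h.real_eqn p hp).2) hpi
    (fun t ht => ⟨(hmi t).1.const_mul K, ?_⟩) (fun p hp i => ?_) (fun p hp => ?_)).2
  · have n1 : ∫ t in (0:ℝ)..T, ∫ x, (-2) * tc (t, x) * nU u (t, x) ^ 2 ≤ 0 := by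
      rw [← neg_nonneg, ← intervalIntegral.integral_neg]
      refine intervalIntegral.integral_nonneg hT fun t ht => ?_
      rw [← integral_neg]
      refine integral_nonneg fun x => ?_
      have : 0 ≤ t * nU u (t, x) ^ 2 := mul_nonneg ht.1 (sq_nonneg _)
      simp only [tc, Pi.zero_apply]
      linarith
    have n2 : ∫ x, pcD (Pr u) (Qi u) (0, x) = Ivar u 0 := by
      unfold Ivar
      congr 1; funext x
      simp [pcD, tc]
    have n3 : 2 * T ^ 2 * Iq u T ≤ ∫ x, pcD (Pr u) (Qi u) (T, x) := by
      unfold Iq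
      rw [← integral_const_mul]
      exact integral_mono ((int_n2 h T).const_mul _) (hpi T ⟨hT, le_rfl⟩) fun x => pcD_ge _ _ (T, x)
    linarith
  · rw [integral_const_mul, (hmi t).2]
    have := hC.m t ht
    have := hC.g t ht
    have := hC.q t ht
    have := hC.t t ht
    have := hV t ht
    gcongr; linarith
  · have a := pcJ_bd (Pr u) (Qi u) p hp.1 i
    refine a.trans ?_
    have := mst_nn (Pr u) (Qi u) p
    have a1 := hp.1
    have a2 := hp.2
    rw [hK]
    gcongr
  · have a1 := hp.1
    have a2 := hp.2
    have h1 := mst_nn (Pr u) (Qi u) p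
    have e : ‖(-2) * tc p * nU u p ^ 2‖ = 2 * p.1 * nU u p ^ 2 := by
      rw [Real.norm_eq_abs, show (-2) * tc p * nU u p ^ 2 = -(2 * p.1 * nU u p ^ 2) by unfold tc; ring, abs_neg,
        abs_of_nonneg (by positivity)]
    rw [e]
    have h2 : nU u p ^ 2 ≤ mst (Pr u) (Qi u) p := by
      unfold mst
      nlinarith [sq_nonneg (tU u p), nD_nn (Pr u) (Qi u) p, gD_nn (Pr u) (Qi u) p, mul_nonneg (r2_nn p) (nD_nn (Pr u) (Qi u) p), wt_nn p.2]
    have : 2 * p.1 ≤ K := by rw [hK]; nlinarith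
    gcongr

end Part10

section Part11



attribute [local irreducible] S dS lS

/-- curve of Schwartz functions as space-time function -/
def VV (V : ℝ → SW) (p : R4) : ℂ := V p.1 p.2

/-- linear inhomogeneous Schroedinger equation on a time interval -/
structure LS (a b : ℝ) (V G : ℝ → SW) : Prop where
  sm : ContDiff ℝ ∞ (VV V)
  eqn : ∀ t ∈ Set.Icc a b, ∀ x, I * D vT (VV V) (t, x) + lS (V t) x = G t x
  bd : ∃ C, ∀ t ∈ Set.Icc a b, H1sq (V t) ≤ C
  gbd : ∃ C, ∀ t ∈ Set.Icc a b, N43 (G t) ≤ C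

lemma LS.mono {a b a' b' : ℝ} {V G : ℝ → SW} (h : LS a b V G) (h1 : a ≤ a') (h2 : b' ≤ b) : LS a' b' V G := by
  obtain ⟨C, hC⟩ := h.bd
  obtain ⟨C', hC'⟩ := h.gbd
  exact ⟨h.sm, fun t ht => h.eqn t ⟨h1.trans ht.1, ht.2.trans h2⟩,
    ⟨C, fun t ht => hC t ⟨h1.trans ht.1, ht.2.trans h2⟩⟩, ⟨C', fun t ht => hC' t ⟨h1.trans ht.1, ht.2.trans h2⟩⟩⟩

lemma sw_line (f : SW) (i : Fin 3) (x : E3) : HasLineDerivAt ℝ (fun y => f y) (dS i f x) x (e3 i) := by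
  rw [dS_apply]
  exact (f.differentiableAt.hasFDerivAt).hasLineDerivAt _

lemma HasLineDerivAt.conj' {f : E3 → ℂ} {f' : ℂ} {x v : E3} (h : HasLineDerivAt ℝ f f' x v) :
    HasLineDerivAt ℝ (fun y => (starRingEnd ℂ) (f y)) ((starRingEnd ℂ) f') x v := by
  have := (Complex.conjCLE : ℂ →L[ℝ] ℂ).hasFDerivAt (x := f (x + (0:ℝ) • v))
  exact this.comp_hasDerivAt (0:ℝ) h

lemma HasLineDerivAt.mul' {f g : E3 → ℂ} {f' g' : ℂ} {x v : E3} (h : HasLineDerivAt ℝ f f' x v)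
    (hg : HasLineDerivAt ℝ g g' x v) :
    HasLineDerivAt ℝ (fun y => f y * g y) (f' * g x + f x * g') x v := by
  have := HasDerivAt.mul h hg
  unfold HasLineDerivAt
  exact this.congr_deriv (by simp)

lemma sw_prod_int (f g : SW) : Integrable (fun x => f x * (starRingEnd ℂ) (g x)) volume := by
  have h1 : MemLp (fun x => (starRingEnd ℂ) (g x)) 4 volume := (sw_memLp g 4).star
  exact (holder43 (sw_memLp f (4/3)) h1).1

lemma conj_N4 (g : SW) : N4 (fun x => (starRingEnd ℂ) (g x)) = N4 g := by
  unfold N4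
  exact lpNorm_congr_norm 4 (sw_memLp g 4).star.1 (sw_m g) (fun x => by simp)

lemma pair_le (f g : SW) : ∫ x, ‖f x * (starRingEnd ℂ) (g x)‖ ≤ N43 f * N4 g := by
  have h1 : MemLp (fun x => (starRingEnd ℂ) (g x)) 4 volume := (sw_memLp g 4).star
  have := (holder43 (sw_memLp f (4/3)) h1).2
  rwa [conj_N4] at this

lemma conj_N43 (g : SW) : N43 (fun x => (starRingEnd ℂ) (g x)) = N43 g := by
  unfold N43
  exact lpNorm_congr_norm _ (sw_memLp g (4/3)).star.1 (sw_m g) (fun x => by simp)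

lemma pair_le' (f g : SW) : ‖∫ x, f x * (starRingEnd ℂ) (g x)‖ ≤ N4 f * N43 g := by
  have h1 : MemLp (fun x => (starRingEnd ℂ) (g x)) (4/3) volume := (sw_memLp g (4/3)).star
  have := (holder43 h1 (sw_memLp f 4)).2
  rw [conj_N43] at this
  refine (norm_integral_le_integral_norm _).trans ?_
  rw [mul_comm (N4 _)]
  refine le_trans (le_of_eq ?_) this
  congr 1; ext x; rw [mul_comm]

lemma S_deriv_sub (b : ℝ) (ψ : SW) (t : ℝ) (x : E3) :
    HasDerivAt (fun s => S (s - b) ψ x) (I * S (t - b) (lS ψ) x) t := by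
  have h1 := S_deriv ψ (t - b) x
  generalize I * S (t - b) (lS ψ) x = c at h1 ⊢
  have h2 : HasDerivAt (fun s : ℝ => s - b) 1 t := (hasDerivAt_id t).sub_const b
  have h3 := h1.scomp t h2
  rw [one_smul] at h3
  exact h3

lemma S_cont_sub (b : ℝ) (f : SW) : Continuous fun p : ℝ × E3 => S (p.1 - b) f p.2 := by
  have h1 : Continuous fun p : ℝ × E3 => (p.1 - b, p.2) := by fun_prop
  exact Continuous.comp (g := fun p : ℝ × E3 => S p.1 f p.2) (S_cont f) h1

lemma PI {a b : ℝ} {V G : ℝ → SW} (h : LS a b V G) (hab : a ≤ b) (ψ : SW) :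
    IntervalIntegrable (fun t => ∫ x, -I * (G t x * (starRingEnd ℂ) (S (t - b) ψ x))) volume a b ∧
    (∫ x, V b x * (starRingEnd ℂ) (ψ x)) - (∫ x, V a x * (starRingEnd ℂ) (S (a - b) ψ x)) =
      ∫ t in a..b, ∫ x, -I * (G t x * (starRingEnd ℂ) (S (t - b) ψ x)) := by
  obtain ⟨C, hC⟩ := h.bd
  obtain ⟨C', hC'⟩ := h.gbd
  have key := cons_law a b hab (fun t x => V t x * (starRingEnd ℂ) (S (t - b) ψ x))
    (fun t x => D vT (VV V) (t, x) * (starRingEnd ℂ) (S (t - b) ψ x) +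
      V t x * (starRingEnd ℂ) (I * S (t - b) (lS ψ) x))
    (fun t x => -I * (G t x * (starRingEnd ℂ) (S (t - b) ψ x)))
    (fun i t x => I * (dS i (V t) x * (starRingEnd ℂ) (S (t - b) ψ x)
        - V t x * (starRingEnd ℂ) (dS i (S (t - b) ψ) x)))
    (fun i t x => I * (dS i (dS i (V t)) x * (starRingEnd ℂ) (S (t - b) ψ x)
        - V t x * (starRingEnd ℂ) (dS i (dS i (S (t - b) ψ)) x)))
    (fun t x => (‖V t x‖ ^ 2 + ∑ i, ‖dS i (V t) x‖ ^ 2) + (‖S (t-b) ψ x‖ ^ 2 + ∑ i, ‖dS i (S (t-b) ψ) x‖ ^ 2)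
      + ‖G t x * (starRingEnd ℂ) (S (t - b) ψ x)‖)
    (C + H1sq ψ + C' * (CS * √(H1sq ψ))) ?_ ?_ ?_ ?_ ?_ ?_ ?_ ?_ ?_ ?_ ?_ ?_
  · refine ⟨key.1, ?_⟩
    rw [← key.2]
    simp [S_zero]
  · intro t x
    have h1 := D_time h.sm t x
    have h2 : HasDerivAt (fun s => S (s - b) ψ x) (I * S (t - b) (lS ψ) x) t := S_deriv_sub b ψ t x
    have h3 := (Complex.conjCLE : ℂ →L[ℝ] ℂ).hasFDerivAt.comp_hasDerivAt t h2
    exact (h1.mul h3).congr_deriv rfl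
  · have c1 : Continuous (D vT (VV V)) := (D_sm h.sm _).continuous
    have c2 : ∀ f : SW, Continuous fun p : ℝ × E3 => S (p.1 - b) f p.2 := fun f => S_cont_sub b f
    have c3 : Continuous (VV V) := h.sm.continuous
    exact (c1.mul (Complex.continuous_conj.comp (c2 ψ))).add
      (c3.mul (Complex.continuous_conj.comp (continuous_const.mul (c2 (lS ψ)))))
  · intro t
    exact (V t).continuous.mul (Complex.continuous_conj.comp (S (t - b) ψ).continuous)
  · intro i t
    exact continuous_const.mul (((dS i (V t)).continuous.mul (Complex.continuous_conj.comp (S (t - b) ψ).continuous)).sub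
      ((V t).continuous.mul (Complex.continuous_conj.comp (dS i (S (t - b) ψ)).continuous)))
  · intro i t
    exact continuous_const.mul (((dS i (dS i (V t))).continuous.mul (Complex.continuous_conj.comp (S (t - b) ψ).continuous)).sub
      ((V t).continuous.mul (Complex.continuous_conj.comp (dS i (dS i (S (t - b) ψ))).continuous)))
  · intro i t x
    have h1 := (sw_line (dS i (V t)) i x).mul' (sw_line (S (t-b) ψ) i x).conj'
    have h2 := (sw_line (V t) i x).mul' (sw_line (dS i (S (t-b) ψ)) i x).conj'
    have h3 := (HasDerivAt.sub h1 h2).const_mul I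
    unfold HasLineDerivAt
    exact h3.congr_deriv (by ring)
  · intro t ht x
    have e := h.eqn t ht x
    have e1 : S (t - b) (lS ψ) x = lS (S (t - b) ψ) x := by rw [S_lS]
    have e2 : D vT (VV V) (t, x) = I * lS (V t) x - I * G t x := by
      rw [← e]; ring_nf; rw [I_sq]; ring
    simp only [e1]
    rw [e2, lS_apply, lS_apply, map_mul, map_sum, Complex.conj_I]
    simp only [Fin.sum_univ_three]
    ring
  · exact sw_prod_int _ _
  · exact sw_prod_int _ _
  · intro t ht
    have iV : Integrable (fun x => ‖V t x‖ ^ 2 + ∑ i, ‖dS i (V t) x‖ ^ 2) volume :=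
      (sw_sq_int _).add (integrable_finsetSum _ fun i _ => sw_sq_int _)
    have iS : Integrable (fun x => ‖S (t-b) ψ x‖ ^ 2 + ∑ i, ‖dS i (S (t-b) ψ) x‖ ^ 2) volume :=
      (sw_sq_int _).add (integrable_finsetSum _ fun i _ => sw_sq_int _)
    have iG := (sw_prod_int (G t) (S (t-b) ψ)).norm
    have eH : ∀ f : SW, ∫ x, (‖f x‖ ^ 2 + ∑ i, ‖dS i f x‖ ^ 2) = H1sq f := by
      intro f
      rw [integral_add (sw_sq_int _) (integrable_finsetSum _ fun i _ => sw_sq_int _),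
        integral_finsetSum _ fun i _ => sw_sq_int _]
      rfl
    refine ⟨(iV.add iS).add iG, ?_⟩
    have iVS : Integrable (fun x => (‖V t x‖ ^ 2 + ∑ i, ‖dS i (V t) x‖ ^ 2) +
      (‖S (t-b) ψ x‖ ^ 2 + ∑ i, ‖dS i (S (t-b) ψ) x‖ ^ 2)) volume := iV.add iS
    rw [integral_add iVS iG, integral_add iV iS, eH, eH, H1sq_S]
    have h4 : ∫ x, ‖G t x * (starRingEnd ℂ) (S (t - b) ψ x)‖ ≤ C' * (CS * √(H1sq ψ)) :=
      (pair_le _ _).trans (mul_le_mul (hC' t ht) (sobolev_S _ _) (N4_nonneg _) ((N43_nonneg _).trans (hC' t ht)))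
    linarith [hC t ht]
  · intro t ht x i
    have hx : (1:ℝ) ≤ 1 + ‖x‖ := by linarith [norm_nonneg x]
    have s1 : ‖dS i (V t) x‖ ^ 2 ≤ ∑ i, ‖dS i (V t) x‖ ^ 2 :=
      Finset.single_le_sum (f := fun i => ‖dS i (V t) x‖ ^ 2) (fun j _ => by positivity) (Finset.mem_univ i)
    have s2 : ‖dS i (S (t-b) ψ) x‖ ^ 2 ≤ ∑ i, ‖dS i (S (t-b) ψ) x‖ ^ 2 :=
      Finset.single_le_sum (f := fun i => ‖dS i (S (t-b) ψ) x‖ ^ 2) (fun j _ => by positivity) (Finset.mem_univ i)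
    have n1 : ‖I * (dS i (V t) x * (starRingEnd ℂ) (S (t - b) ψ x)
        - V t x * (starRingEnd ℂ) (dS i (S (t - b) ψ) x))‖ ≤
        ‖dS i (V t) x‖ * ‖S (t - b) ψ x‖ + ‖V t x‖ * ‖dS i (S (t - b) ψ) x‖ := by
      rw [norm_mul, Complex.norm_I, one_mul]
      refine (norm_sub_le _ _).trans (le_of_eq ?_)
      simp
    have g0 := norm_nonneg (G t x * (starRingEnd ℂ) (S (t - b) ψ x))
    have m0 : 0 ≤ (‖V t x‖ ^ 2 + ∑ i, ‖dS i (V t) x‖ ^ 2) + (‖S (t-b) ψ x‖ ^ 2 + ∑ i, ‖dS i (S (t-b) ψ) x‖ ^ 2)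
      + ‖G t x * (starRingEnd ℂ) (S (t - b) ψ x)‖ := by positivity
    refine n1.trans (le_trans ?_ (le_mul_of_one_le_left m0 hx))
    nlinarith [sq_nonneg (‖dS i (V t) x‖ - ‖S (t - b) ψ x‖), sq_nonneg (‖V t x‖ - ‖dS i (S (t - b) ψ) x‖)]
  · intro t ht x
    rw [norm_mul, norm_neg, Complex.norm_I, one_mul]
    have : 0 ≤ (‖V t x‖ ^ 2 + ∑ i, ‖dS i (V t) x‖ ^ 2) + (‖S (t-b) ψ x‖ ^ 2 + ∑ i, ‖dS i (S (t-b) ψ) x‖ ^ 2) := by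
      positivity
    linarith

/-- Duhamel bound -/
lemma PI_bd {a b : ℝ} {V G : ℝ → SW} (h : LS a b V G) (hab : a ≤ b) (ψ : SW) (B : ℝ → ℝ)
    (hB : IntervalIntegrable B volume a b) (hGB : ∀ t ∈ Set.Ioo a b, N43 (G t) * N4 (S (t - b) ψ) ≤ B t) :
    ‖(∫ x, V b x * (starRingEnd ℂ) (ψ x)) - (∫ x, V a x * (starRingEnd ℂ) (S (a - b) ψ x))‖ ≤ ∫ t in a..b, B t := by
  rw [(PI h hab ψ).2]
  have hae : ∀ᵐ t : ℝ ∂volume, t ≠ b := by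
    rw [ae_iff]; simp
  refine intervalIntegral.norm_integral_le_of_norm_le hab ?_ hB
  filter_upwards [hae] with t htb ht
  have ht' : t ∈ Set.Ioo a b := ⟨ht.1, lt_of_le_of_ne ht.2 htb⟩
  refine le_trans ?_ (hGB t ht')
  refine (norm_integral_le_integral_norm _).trans (le_trans (le_of_eq ?_) (pair_le _ _))
  congr 1; ext x
  rw [norm_mul, norm_neg, Complex.norm_I, one_mul]

end Part11

section Part12



attribute [local irreducible] S dS lS

lemma ex_cube (f : SW) : ∃ g : SW, ∀ x, g x = ((normSq (f x) : ℝ) : ℂ) * f x := by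
  let B1 : ℂ →L[ℝ] ℂ →L[ℝ] ℂ := (ContinuousLinearMap.mul ℝ ℂ).bilinearComp (ContinuousLinearMap.id ℝ ℂ)
    (Complex.conjCLE : ℂ →L[ℝ] ℂ)
  refine ⟨SchwartzMap.pairing (ContinuousLinearMap.mul ℝ ℂ) (SchwartzMap.pairing B1 f f) f, fun x => ?_⟩
  rw [SchwartzMap.pairing_apply_apply, SchwartzMap.pairing_apply_apply]
  simp [B1, Complex.mul_conj]

def cubeS (f : SW) : SW := Classical.choose (ex_cube f)
lemma cubeS_apply (f : SW) (x : E3) : cubeS f x = ((normSq (f x) : ℝ) : ℂ) * f x := Classical.choose_spec (ex_cube f) x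

attribute [local irreducible] cubeS

lemma cubeS_norm (f : SW) (x : E3) : ‖cubeS f x‖ = ‖f x‖ ^ 3 := by
  rw [cubeS_apply, norm_mul, Complex.norm_real, Complex.normSq_eq_norm_sq, Real.norm_of_nonneg (by positivity)]
  ring

lemma cubeS_N43 (f : SW) : N43 (cubeS f) = N4 f ^ 3 := by
  rw [N43_eq (sw_m _)]
  have e : ∀ x, ‖cubeS f x‖ ^ (4/3:ℝ) = ‖f x‖ ^ 4 := by
    intro x
    rw [cubeS_norm, ← Real.rpow_natCast, ← Real.rpow_mul (norm_nonneg _), ← Real.rpow_natCast]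
    norm_num
  simp_rw [e]
  rw [← N4_pow (sw_m f), ← Real.rpow_natCast (N4 f) 4, ← Real.rpow_mul (N4_nonneg _), ← Real.rpow_natCast]
  norm_num

lemma cubeS_pair (f : SW) : ∫ x, f x * (starRingEnd ℂ) (cubeS f x) = ((N4 f ^ 4 : ℝ) : ℂ) := by
  rw [N4_pow (sw_m f), ← integral_complex_ofReal]
  congr 1; ext x
  rw [cubeS_apply, map_mul, Complex.conj_ofReal, Complex.normSq_eq_norm_sq]
  have : f x * (starRingEnd ℂ) (f x) = ((‖f x‖ ^ 2 : ℝ) : ℂ) := by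
    rw [Complex.mul_conj, Complex.normSq_eq_norm_sq]
  rw [show f x * (((‖f x‖ ^ 2 : ℝ) : ℂ) * (starRingEnd ℂ) (f x)) = ((‖f x‖ ^ 2 : ℝ) : ℂ) * (f x * (starRingEnd ℂ) (f x)) by ring, this]
  push_cast; ring

lemma cube_lip (z w : ℂ) : ‖((normSq z : ℝ) : ℂ) * z - ((normSq w : ℝ) : ℂ) * w‖ ≤ 2 * (‖z‖ ^ 2 + ‖w‖ ^ 2) * ‖z - w‖ := by
  have e : ((normSq z : ℝ) : ℂ) * z - ((normSq w : ℝ) : ℂ) * w =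
      ((‖z‖ ^ 2 : ℝ) : ℂ) * (z - w) + ((‖z‖ ^ 2 - ‖w‖ ^ 2 : ℝ) : ℂ) * w := by
    rw [Complex.normSq_eq_norm_sq, Complex.normSq_eq_norm_sq]; push_cast; ring
  rw [e]
  refine (norm_add_le _ _).trans ?_
  rw [norm_mul, norm_mul, Complex.norm_real, Complex.norm_real, Real.norm_of_nonneg (by positivity : (0:ℝ) ≤ ‖z‖^2)]
  have h1 : ‖(‖z‖ ^ 2 - ‖w‖ ^ 2 : ℝ)‖ ≤ (‖z‖ + ‖w‖) * ‖z - w‖ := by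
    rw [show ‖z‖ ^ 2 - ‖w‖ ^ 2 = (‖z‖ + ‖w‖) * (‖z‖ - ‖w‖) by ring, norm_mul,
      Real.norm_of_nonneg (by positivity : (0:ℝ) ≤ ‖z‖ + ‖w‖)]
    exact mul_le_mul_of_nonneg_left (abs_norm_sub_norm_le z w) (by positivity)
  have h2 := mul_le_mul_of_nonneg_right h1 (norm_nonneg w)
  nlinarith [mul_nonneg (sq_nonneg (‖z‖ - ‖w‖)) (norm_nonneg (z - w)), mul_nonneg (sq_nonneg (‖z‖)) (norm_nonneg (z - w)), norm_nonneg (z-w), mul_nonneg (sq_nonneg (‖w‖)) (norm_nonneg (z - w))]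

lemma N43_mono {f : E3 → ℂ} {g : E3 → ℂ} (hf : MemLp f (4/3) volume) (hg : MemLp g (4/3) volume) (h : ∀ x, ‖f x‖ ≤ ‖g x‖) :
    N43 f ≤ N43 g := by
  unfold N43
  rw [← toReal_eLpNorm hf.1, ← toReal_eLpNorm hg.1]
  exact ENNReal.toReal_mono hg.2.ne (eLpNorm_mono h)

lemma N43_sub (f g : SW) : N43 (f - g : SW) ≤ N43 f + N43 g :=
  lpNorm_sub_le (sw_memLp f (4/3)) one_le_43
lemma N43_add (f g : SW) : N43 (f + g : SW) ≤ N43 f + N43 g :=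
  lpNorm_add_le (sw_memLp f (4/3)) one_le_43
lemma N4_sub (f g : SW) : N4 (f - g : SW) ≤ N4 f + N4 g :=
  lpNorm_sub_le (sw_memLp f 4) (by norm_num)
lemma N4_add (f g : SW) : N4 (f + g : SW) ≤ N4 f + N4 g :=
  lpNorm_add_le (sw_memLp f 4) (by norm_num)
lemma N4_smul (c : ℂ) (f : SW) : N4 (c • f : SW) = ‖c‖ * N4 f :=
  lpNorm_const_smul c f volume
lemma N43_smul (c : ℂ) (f : SW) : N43 (c • f : SW) = ‖c‖ * N43 f :=
  lpNorm_const_smul c f volume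

lemma sq_L2 (f : SW) : MemLp (fun x => f x * f x) 2 volume ∧ lpNorm (fun x => f x * f x) 2 volume ≤ N4 f ^ 2 := by
  refine ⟨(sw_memLp f 4).mul' (r := 2) (sw_memLp f 4), ?_⟩
  rw [sq]
  exact lpNorm_mul_le (sw_memLp f 4) (sw_memLp f 4)

lemma cube_diff (f g : SW) : N43 (cubeS f - cubeS g : SW) ≤ 2 * (N4 f ^ 2 + N4 g ^ 2) * N4 (f - g : SW) := by
  obtain ⟨mf, nf⟩ := sq_L2 f
  obtain ⟨mg, ng⟩ := sq_L2 g
  have mfn : MemLp (fun x => ((‖f x * f x‖ : ℝ) : ℂ)) 2 volume := mf.norm.ofReal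
  have mgn : MemLp (fun x => ((‖g x * g x‖ : ℝ) : ℂ)) 2 volume := mg.norm.ofReal
  have ef : lpNorm (fun x => ((‖f x * f x‖ : ℝ) : ℂ)) 2 volume ≤ N4 f ^ 2 := by
    refine le_trans (le_of_eq ?_) nf
    exact lpNorm_congr_norm 2 mfn.1 mf.1 (fun x => by simp)
  have eg : lpNorm (fun x => ((‖g x * g x‖ : ℝ) : ℂ)) 2 volume ≤ N4 g ^ 2 := by
    refine le_trans (le_of_eq ?_) ng
    exact lpNorm_congr_norm 2 mgn.1 mg.1 (fun x => by simp)
  set A : E3 → ℂ := (fun x => ((‖f x * f x‖ : ℝ) : ℂ)) + (fun x => ((‖g x * g x‖ : ℝ) : ℂ)) with hA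
  have mA : MemLp A 2 volume := mfn.add mgn
  have mA2 : MemLp ((2:ℂ) • A) 2 volume := mA.const_smul 2
  have nA : lpNorm ((2:ℂ) • A) 2 volume ≤ 2 * (N4 f ^ 2 + N4 g ^ 2) := by
    rw [lpNorm_const_smul]
    have : lpNorm A 2 volume ≤ N4 f ^ 2 + N4 g ^ 2 := (lpNorm_add_le mfn (by norm_num)).trans (add_le_add ef eg)
    simpa using this
  have md := sw_memLp (f - g) 4
  have h1 := lpNorm_mul_le (r := 4/3) md mA2
  have m1 : MemLp (fun x => (f - g) x * ((2:ℂ) • A) x) (4/3) volume := mA2.mul' (r := 4/3) md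
  have h2 : N43 (cubeS f - cubeS g : SW) ≤ N43 (fun x => (f - g) x * ((2:ℂ) • A) x) := by
    refine N43_mono (sw_memLp _ _) m1 fun x => ?_
    have h3 : (cubeS f - cubeS g) x = ((normSq (f x) : ℝ) : ℂ) * f x - ((normSq (g x) : ℝ) : ℂ) * g x := by
      rw [← cubeS_apply, ← cubeS_apply]; rfl
    rw [h3]
    refine (cube_lip _ _).trans (le_of_eq ?_)
    have h4 : (f - g) x = f x - g x := rfl
    have h5 : ((2:ℂ) • A) x = ((2 * (‖f x * f x‖ + ‖g x * g x‖) : ℝ) : ℂ) := by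
      simp [hA]
    rw [norm_mul, h4, h5, Complex.norm_real, Real.norm_of_nonneg (by positivity), norm_mul, norm_mul]
    ring
  refine h2.trans (h1.trans ?_)
  rw [mul_comm]
  exact mul_le_mul_of_nonneg_right nA (N4_nonneg _)

lemma disp' (σ : ℝ) (hσ : σ < 0) (f : SW) : N4 (S σ f) ≤ (-σ) ^ (-(3/4) : ℝ) * N43 f := by
  refine (dispersive σ hσ.ne f).trans (mul_le_mul_of_nonneg_right ?_ (N43_nonneg _))
  rw [abs_of_neg hσ]
  refine Real.rpow_le_rpow_of_nonpos (by linarith) ?_ (by norm_num)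
  nlinarith [Real.pi_gt_three]

lemma int34 (a b : ℝ) (hab : a ≤ b) : IntervalIntegrable (fun t => (b - t) ^ (-(3/4) : ℝ)) volume a b ∧
    ∫ t in a..b, (b - t) ^ (-(3/4) : ℝ) = 4 * (b - a) ^ (1/4 : ℝ) := by
  have h1 : IntervalIntegrable (fun t : ℝ => t ^ (-(3/4) : ℝ)) volume 0 (b - a) :=
    intervalIntegral.intervalIntegrable_rpow' (by norm_num)
  constructor
  · have := (h1.comp_sub_left b).symm
    simpa using this
  · rw [intervalIntegral.integral_comp_sub_left (fun t : ℝ => t ^ (-(3/4) : ℝ)) b]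
    rw [integral_rpow (Or.inl (by norm_num))]
    norm_num
    ring

end Part12

section Part13



attribute [local irreducible] S dS lS cubeS

lemma absorb {a b : ℝ} {V G : ℝ → SW} (h : LS a b V G) (hab : a ≤ b) (K L I0 M0 : ℝ) (hK0 : 0 ≤ K) (hL0 : 0 ≤ L) (hI0 : 0 ≤ I0)
    (hG : ∀ t ∈ Set.Icc a b, N43 (G t) ≤ K * N4 (V t) + L)
    (hM : ∀ t ∈ Set.Icc a b, N4 (V t) ≤ M0)
    (hI : ∀ τ ∈ Set.Icc a b, ∀ ψ : SW, ‖∫ x, V a x * (starRingEnd ℂ) (S (a - τ) ψ x)‖ ≤ I0 * N43 ψ)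
    (hK : 4 * (b - a) ^ (1/4 : ℝ) * K ≤ 1/2) :
    ∀ τ ∈ Set.Icc a b, N4 (V τ) ≤ 2 * (I0 + 4 * (b - a) ^ (1/4 : ℝ) * L) := by
  have key : ∀ M, (∀ t ∈ Set.Icc a b, N4 (V t) ≤ M) → ∀ τ ∈ Set.Icc a b,
      N4 (V τ) ≤ I0 + 4 * (b - a) ^ (1/4 : ℝ) * (K * M + L) := by
    intro M hMM τ hτ
    have hM0 : 0 ≤ M := (N4_nonneg _).trans (hMM τ hτ)
    obtain ⟨hii, hie⟩ := int34 a τ hτ.1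
    have hl := PI_bd (h.mono le_rfl hτ.2) hτ.1 (cubeS (V τ))
      (fun t => ((K * M + L) * N4 (V τ) ^ 3) * (τ - t) ^ (-(3/4) : ℝ)) (hii.const_mul _) ?_
    · rw [intervalIntegral.integral_const_mul, hie, cubeS_pair] at hl
      have h2 := hI τ hτ (cubeS (V τ))
      rw [cubeS_N43] at h2
      have h3 : ‖((N4 (V τ) ^ 4 : ℝ) : ℂ)‖ ≤ ‖((N4 (V τ) ^ 4 : ℝ) : ℂ) - ∫ x, V a x * (starRingEnd ℂ) (S (a - τ) (cubeS (V τ)) x)‖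
          + ‖∫ x, V a x * (starRingEnd ℂ) (S (a - τ) (cubeS (V τ)) x)‖ := by
        have := norm_add_le (((N4 (V τ) ^ 4 : ℝ) : ℂ) - ∫ x, V a x * (starRingEnd ℂ) (S (a - τ) (cubeS (V τ)) x))
          (∫ x, V a x * (starRingEnd ℂ) (S (a - τ) (cubeS (V τ)) x))
        rwa [sub_add_cancel] at this
      rw [Complex.norm_real, Real.norm_of_nonneg (by have := N4_nonneg (V τ); positivity)] at h3
      have hmono : (τ - a) ^ (1/4 : ℝ) ≤ (b - a) ^ (1/4 : ℝ) :=
        Real.rpow_le_rpow (by linarith [hτ.1]) (by linarith [hτ.2]) (by norm_num)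
      have hp : 0 ≤ (K * M + L) * N4 (V τ) ^ 3 := by have := N4_nonneg (V τ); positivity
      have h4 := mul_le_mul_of_nonneg_left hmono hp
      have h5 : N4 (V τ) ^ 3 * N4 (V τ) ≤ N4 (V τ) ^ 3 * (I0 + 4 * (b - a) ^ (1/4 : ℝ) * (K * M + L)) := by
        nlinarith
      rcases (N4_nonneg (V τ)).eq_or_lt with h0 | h0
      · rw [← h0]
        have : 0 ≤ (b - a) ^ (1/4 : ℝ) := Real.rpow_nonneg (by linarith) _
        positivity
      · exact le_of_mul_le_mul_left h5 (by positivity)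
    · intro t ht
      have htI : t ∈ Set.Icc a b := ⟨ht.1.le, ht.2.le.trans hτ.2⟩
      have h1 : N43 (G t) ≤ K * M + L := (hG t htI).trans (by
        have := mul_le_mul_of_nonneg_left (hMM t htI) hK0; linarith)
      have h2 := disp' (t - τ) (by linarith [ht.2]) (cubeS (V τ))
      rw [cubeS_N43, neg_sub] at h2
      refine (mul_le_mul h1 h2 (N4_nonneg _) (by positivity)).trans (le_of_eq (by ring))
  intro τ hτ
  set m := sSup ((fun t => N4 (V t)) '' Set.Icc a b) with hm
  have hbdd : BddAbove ((fun t => N4 (V t)) '' Set.Icc a b) := ⟨M0, by rintro _ ⟨t, ht, rfl⟩; exact hM t ht⟩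
  have hle : ∀ t ∈ Set.Icc a b, N4 (V t) ≤ m := fun t ht => le_csSup hbdd ⟨t, ht, rfl⟩
  have hm2 : m ≤ I0 + 4 * (b - a) ^ (1/4 : ℝ) * (K * m + L) := by
    refine csSup_le ⟨_, τ, hτ, rfl⟩ ?_
    rintro _ ⟨t, ht, rfl⟩
    exact key m hle t ht
  have hm0 : 0 ≤ m := (N4_nonneg _).trans (hle τ hτ)
  have := mul_le_mul_of_nonneg_right hK hm0
  have := hle τ hτ
  linarith

end Part13

section Part14



attribute [local irreducible] S dS lS cubeS

lemma dS_add (i : Fin 3) (f g : SW) : dS i (f + g) = dS i f + dS i g := by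
  ext x
  rw [dS_apply, add_apply, dS_apply, dS_apply, ← add_apply,
    ← fderiv_add f.differentiableAt g.differentiableAt]
  rfl

lemma dS_smul (i : Fin 3) (c : ℂ) (f : SW) : dS i (c • f) = c • dS i f := by
  ext x
  rw [dS_apply, smul_apply, dS_apply, ← smul_apply,
    ← fderiv_const_smul f.differentiableAt c]
  rfl

lemma sw_sub_eq (f g : SW) : f - g = f + (-1 : ℂ) • g := by
  ext x; simp [sub_eq_add_neg]

lemma dS_sub (i : Fin 3) (f g : SW) : dS i (f - g) = dS i f - dS i g := by
  rw [sw_sub_eq, dS_add, dS_smul, ← sw_sub_eq]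

lemma lS_add (f g : SW) : lS (f + g) = lS f + lS g := by
  ext x
  rw [add_apply, lS_apply, lS_apply, lS_apply, ← Finset.sum_add_distrib]
  simp_rw [dS_add]; rfl

lemma lS_smul (c : ℂ) (f : SW) : lS (c • f) = c • lS f := by
  ext x
  rw [smul_apply, lS_apply, lS_apply, Finset.smul_sum]
  simp_rw [dS_smul]; rfl

lemma lS_sub (f g : SW) : lS (f - g) = lS f - lS g := by
  rw [sw_sub_eq, lS_add, lS_smul, ← sw_sub_eq]

lemma H1sq_smul (c : ℂ) (f : SW) : H1sq (c • f) = ‖c‖ ^ 2 * H1sq f := by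
  unfold H1sq
  simp_rw [dS_smul, smul_apply, norm_smul, mul_pow, integral_const_mul]
  rw [mul_add, Finset.mul_sum]

lemma sq_sub_int (f g : SW) : ∫ x, ‖(f - g) x‖ ^ 2 ≤ 2 * (∫ x, ‖f x‖ ^ 2) + 2 * ∫ x, ‖g x‖ ^ 2 := by
  rw [← integral_const_mul, ← integral_const_mul, ← integral_add ((sw_sq_int f).const_mul _) ((sw_sq_int g).const_mul _)]
  refine integral_mono (sw_sq_int _) (((sw_sq_int f).const_mul _).add ((sw_sq_int g).const_mul _)) fun x => ?_
  have h1 : ‖(f - g) x‖ ≤ ‖f x‖ + ‖g x‖ := norm_sub_le _ _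
  have h2 := norm_nonneg ((f - g) x)
  show ‖(f - g) x‖ ^ 2 ≤ 2 * ‖f x‖ ^ 2 + 2 * ‖g x‖ ^ 2
  nlinarith [sq_nonneg (‖f x‖ - ‖g x‖)]

lemma H1sq_sub (f g : SW) : H1sq (f - g) ≤ 2 * H1sq f + 2 * H1sq g := by
  unfold H1sq
  simp_rw [dS_sub]
  have h1 := sq_sub_int f g
  have h2 := Finset.sum_le_sum (s := Finset.univ) fun i (_ : i ∈ Finset.univ) => sq_sub_int (dS i f) (dS i g)
  rw [Finset.sum_add_distrib, ← Finset.mul_sum, ← Finset.mul_sum] at h2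
  linarith

lemma LS.sub {a b : ℝ} {V G V' G' : ℝ → SW} (h : LS a b V G) (h' : LS a b V' G') :
    LS a b (fun t => V t - V' t) (fun t => G t - G' t) := by
  obtain ⟨C, hC⟩ := h.bd
  obtain ⟨C', hC'⟩ := h'.bd
  obtain ⟨D1, hD⟩ := h.gbd
  obtain ⟨D', hD'⟩ := h'.gbd
  refine ⟨h.sm.sub h'.sm, fun t ht x => ?_, ⟨2 * C + 2 * C', fun t ht => ?_⟩, ⟨D1 + D', fun t ht => ?_⟩⟩
  · have e : D vT (VV fun t => V t - V' t) (t, x) = D vT (VV V) (t, x) - D vT (VV V') (t, x) :=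
      D_sub (sm_diff h.sm) (sm_diff h'.sm) _ _
    rw [e, lS_sub, sub_apply, sub_apply, ← h.eqn t ht x, ← h'.eqn t ht x]
    ring
  · have := H1sq_sub (V t) (V' t); linarith [hC t ht, hC' t ht]
  · exact (N43_sub _ _).trans (add_le_add (hD t ht) (hD' t ht))

lemma LS.smul {a b : ℝ} {V G : ℝ → SW} (h : LS a b V G) (c : ℂ) :
    LS a b (fun t => c • V t) (fun t => c • G t) := by
  obtain ⟨C, hC⟩ := h.bd
  obtain ⟨D1, hD⟩ := h.gbd
  refine ⟨contDiff_const.smul h.sm, fun t ht x => ?_, ⟨‖c‖ ^ 2 * C, fun t ht => ?_⟩, ⟨‖c‖ * D1, fun t ht => ?_⟩⟩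
  · have e : D vT (VV fun t => c • V t) (t, x) = c • D vT (VV V) (t, x) := by
      unfold D
      rw [← smul_apply, ← fderiv_const_smul (sm_diff h.sm _) c]
      rfl
    rw [e, lS_smul, smul_apply, smul_apply, ← h.eqn t ht x]
    simp only [smul_eq_mul]; ring
  · rw [H1sq_smul]; exact mul_le_mul_of_nonneg_left (hC t ht) (by positivity)
  · rw [N43_smul]; exact mul_le_mul_of_nonneg_left (hD t ht) (by positivity)

lemma D_shift {f : R4 → ℂ} (hf : ContDiff ℝ ∞ f) (h t : ℝ) (x : E3) :
    D vT (fun p : R4 => f (p.1 + h, p.2)) (t, x) = D vT f (t + h, x) := by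
  have e : ContDiff ℝ ∞ (fun p : R4 => f (p.1 + h, p.2)) := hf.comp (by fun_prop)
  have h1 := D_time e t x
  have h2 := D_time hf (t + h) x
  have h3 : HasDerivAt (fun s : ℝ => s + h) 1 t := (hasDerivAt_id t).add_const h
  have h4 := HasDerivAt.scomp (h := fun s : ℝ => s + h) t h2 h3
  rw [one_smul] at h4
  exact h1.unique h4

lemma LS.shift {a b h : ℝ} {V G : ℝ → SW} (H : LS (a + h) (b + h) V G) :
    LS a b (fun t => V (t + h)) (fun t => G (t + h)) := by
  obtain ⟨C, hC⟩ := H.bd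
  obtain ⟨D1, hD⟩ := H.gbd
  have m : ∀ t ∈ Set.Icc a b, t + h ∈ Set.Icc (a + h) (b + h) := fun t ht => ⟨by linarith [ht.1], by linarith [ht.2]⟩
  refine ⟨H.sm.comp (by fun_prop : ContDiff ℝ ∞ fun p : R4 => (p.1 + h, p.2)), fun t ht x => ?_, ⟨C, fun t ht => hC _ (m t ht)⟩, ⟨D1, fun t ht => hD _ (m t ht)⟩⟩
  have e : D vT (VV fun t => V (t + h)) (t, x) = D vT (VV V) (t + h, x) := D_shift H.sm h t x
  rw [e, H.eqn _ (m t ht) x]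

lemma H1sq_add (f g : SW) : H1sq (f + g) ≤ 2 * H1sq f + 2 * H1sq g := by
  have := H1sq_sub f ((-1:ℂ) • g)
  rw [H1sq_smul] at this
  have e : f - (-1:ℂ) • g = f + g := by ext x; simp
  rw [e] at this
  simpa using this

lemma LS_affine (a b : ℝ) (f0 f1 : SW) : LS a b (fun t => f0 + ((t - a : ℝ) : ℂ) • f1)
    (fun t => I • f1 + lS f0 + ((t - a : ℝ) : ℂ) • lS f1) := by
  have sm : ContDiff ℝ ∞ (VV (fun t => f0 + ((t - a : ℝ) : ℂ) • f1)) := by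
    have c0 : ContDiff ℝ ∞ fun p : R4 => f0 p.2 := (f0.smooth _).comp contDiff_snd
    have c1 : ContDiff ℝ ∞ fun p : R4 => f1 p.2 := (f1.smooth _).comp contDiff_snd
    have c2 : ContDiff ℝ ∞ fun p : R4 => ((p.1 - a : ℝ) : ℂ) :=
      Complex.ofRealCLM.contDiff.comp (contDiff_fst.sub contDiff_const)
    exact c0.add (c2.mul c1)
  have hn : ∀ t ∈ Set.Icc a b, ‖((t - a : ℝ) : ℂ)‖ ≤ |b - a| := by
    intro t ht
    rw [Complex.norm_real, Real.norm_of_nonneg (by linarith [ht.1])]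
    exact le_trans (by linarith [ht.2]) (le_abs_self _)
  refine ⟨sm, fun t ht x => ?_, ⟨2 * H1sq f0 + 2 * (|b - a| ^ 2 * H1sq f1), fun t ht => ?_⟩,
    ⟨N43 (I • f1 + lS f0 : SW) + |b - a| * N43 (lS f1), fun t ht => ?_⟩⟩
  · have h1 := D_time sm t x
    have h2 : HasDerivAt (fun s : ℝ => ((s - a : ℝ) : ℂ)) 1 t := by
      have := ((hasDerivAt_id t).sub_const a).ofReal_comp
      simpa using this
    have h3 : HasDerivAt (fun s : ℝ => f0 x + ((s - a : ℝ) : ℂ) * f1 x) (1 * f1 x) t := (h2.mul_const (f1 x)).const_add (f0 x)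
    have e := h1.unique h3
    rw [e, lS_add, lS_smul]
    simp only [add_apply, smul_apply, smul_eq_mul]
    ring
  · refine (H1sq_add _ _).trans ?_
    rw [H1sq_smul]
    have := mul_le_mul_of_nonneg_right (pow_le_pow_left₀ (norm_nonneg _) (hn t ht) 2) (H1sq_nonneg f1)
    linarith
  · refine (N43_add _ _).trans ?_
    rw [N43_smul]
    have := mul_le_mul_of_nonneg_right (hn t ht) (N43_nonneg (lS f1))
    linarith

lemma sw_planch (f g : SW) : ∫ x, f x * (starRingEnd ℂ) (g x) = ∫ ξ, 𝓕 f ξ * (starRingEnd ℂ) (𝓕 g ξ) := by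
  have := SchwartzMap.integral_sesq_fourier_fourier g f (innerSL ℂ)
  simp only [innerSL_apply_apply, RCLike.inner_apply] at this
  exact this.symm

lemma S_adj (σ : ℝ) (f g : SW) : ∫ x, f x * (starRingEnd ℂ) (S σ g x) = ∫ x, S (-σ) f x * (starRingEnd ℂ) (g x) := by
  rw [sw_planch f, sw_planch (S (-σ) f)]
  congr 1; ext ξ
  rw [S_fourier, S_fourier, map_mul, mS_conj]; ring

lemma S_adj_bd (σ : ℝ) (f g : SW) : ‖∫ x, f x * (starRingEnd ℂ) (S σ g x)‖ ≤ CS * √(H1sq f) * N43 g := by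
  rw [S_adj]
  exact (pair_le' _ _).trans (mul_le_mul_of_nonneg_right (sobolev_S _ _) (N43_nonneg _))

end Part14

section Part15



attribute [local irreducible] S dS lS cubeS

lemma cube_diff_A (A : ℝ) (f g : SW) (hf : N4 f ≤ A) (hg : N4 g ≤ A) :
    N43 (cubeS f - cubeS g : SW) ≤ 4 * A ^ 2 * N4 (f - g : SW) := by
  refine (cube_diff f g).trans (mul_le_mul_of_nonneg_right ?_ (N4_nonneg _))
  have h1 := pow_le_pow_left₀ (N4_nonneg _) hf 2
  have h2 := pow_le_pow_left₀ (N4_nonneg _) hg 2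
  linarith

/-- first-order Taylor remainder -/
lemma lemT_w {a b A : ℝ} {V : ℝ → SW} (h : LS a b V (fun t => cubeS (V t)))
    (hA : ∀ t ∈ Set.Icc a b, N4 (V t) ≤ A) (hδ : 32 * A ^ 2 * (b - a) ^ (1/4:ℝ) ≤ 1) (f1 : SW)
    (hf1 : ∀ x, D vT (VV V) (a, x) = f1 x) :
    ∃ L0, 0 ≤ L0 ∧ ∀ η, 0 ≤ η → a + η ≤ b → ∀ τ, a ≤ τ → ∀ ψ : SW,
      ‖∫ x, (V (a + η) - (V a + ((η : ℝ) : ℂ) • f1)) x * (starRingEnd ℂ) (S (a - τ) ψ x)‖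
        ≤ (L0 * η ^ (1/4:ℝ) * η) * N43 ψ := by
  refine ⟨8 * (4 * A ^ 2 * N4 f1 + N43 (lS f1)), by have := N4_nonneg f1; have := N43_nonneg (lS f1); positivity, ?_⟩
  intro η hη hηb τ hτ ψ
  have hab : a ≤ b := by linarith
  set L0 := 4 * A ^ 2 * N4 f1 + N43 (lS f1) with hL0
  have hL00 : 0 ≤ L0 := by have := N4_nonneg f1; have := N43_nonneg (lS f1); positivity
  have hw := (h.sub (LS_affine a b (V a) f1)).mono (le_refl a) hηb
  set w : ℝ → SW := fun t => V t - (V a + ((t - a : ℝ) : ℂ) • f1) with hwdef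
  have hpa : 0 ≤ η ^ (1/4:ℝ) := Real.rpow_nonneg hη _
  have hδ' : 32 * A ^ 2 * η ^ (1/4:ℝ) ≤ 1 := by
    refine le_trans ?_ hδ
    have : η ^ (1/4:ℝ) ≤ (b - a) ^ (1/4:ℝ) := Real.rpow_le_rpow hη (by linarith) (by norm_num)
    exact mul_le_mul_of_nonneg_left this (by positivity)
  have heq : I • f1 + lS (V a) = cubeS (V a) := by
    ext x
    have := h.eqn a ⟨le_rfl, hab⟩ x
    rw [hf1] at this
    simpa using this
  have hwa : w a = 0 := by ext x; simp [w]
  have hsub : ∀ t ∈ Set.Icc a (a + η), N43 (cubeS (V t) - (I • f1 + lS (V a) + ((t - a : ℝ) : ℂ) • lS f1) : SW)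
      ≤ (4 * A ^ 2) * N4 (w t) + η * L0 := by
    intro t ht
    have htb : t ∈ Set.Icc a b := ⟨ht.1, ht.2.trans hηb⟩
    have hta : ‖((t - a : ℝ) : ℂ)‖ ≤ η := by
      rw [Complex.norm_real, Real.norm_of_nonneg (by linarith [ht.1])]; linarith [ht.2]
    have e1 : (cubeS (V t) - (I • f1 + lS (V a) + ((t - a : ℝ) : ℂ) • lS f1) : SW) =
        (cubeS (V t) - cubeS (V a)) - ((t - a : ℝ) : ℂ) • lS f1 := by
      rw [heq]; abel
    have e2 : (V t - V a : SW) = w t + ((t - a : ℝ) : ℂ) • f1 := by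
      simp only [w]; abel
    rw [e1]
    have h1 := N43_sub (cubeS (V t) - cubeS (V a)) (((t - a : ℝ) : ℂ) • lS f1)
    have h2 := cube_diff_A A (V t) (V a) (hA t htb) (hA a ⟨le_rfl, hab⟩)
    have h3 := N4_add (w t) (((t - a : ℝ) : ℂ) • f1)
    rw [N4_smul] at h3
    rw [N43_smul] at h1
    rw [e2] at h2
    have h4 := mul_le_mul_of_nonneg_right hta (N43_nonneg (lS f1))
    have h5 := mul_le_mul_of_nonneg_right hta (N4_nonneg f1)
    have h6 : 4 * A ^ 2 * N4 (w t + ((t - a : ℝ) : ℂ) • f1 : SW) ≤ 4 * A ^ 2 * (N4 (w t) + η * N4 f1) :=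
      mul_le_mul_of_nonneg_left (by linarith) (by positivity)
    rw [hL0]
    linarith
  have hwN : ∀ t ∈ Set.Icc a (a + η), N4 (w t) ≤ 8 * η ^ (1/4:ℝ) * (η * L0) := by
    have := absorb hw (by linarith) (4 * A ^ 2) (η * L0) 0 (A + (A + η * N4 f1)) (by positivity) (by positivity) le_rfl
      hsub ?_ ?_ ?_
    · intro t ht
      have := this t ht
      rw [add_sub_cancel_left] at this
      linarith
    · intro t ht
      have htb : t ∈ Set.Icc a b := ⟨ht.1, ht.2.trans hηb⟩
      have hta : ‖((t - a : ℝ) : ℂ)‖ ≤ η := by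
        rw [Complex.norm_real, Real.norm_of_nonneg (by linarith [ht.1])]; linarith [ht.2]
      have h5 := mul_le_mul_of_nonneg_right hta (N4_nonneg f1)
      have h1 := N4_sub (V t) (V a + ((t - a : ℝ) : ℂ) • f1)
      have h3 := N4_add (V a) (((t - a : ℝ) : ℂ) • f1)
      rw [N4_smul] at h3
      linarith [hA t htb, hA a ⟨le_rfl, hab⟩]
    · intro t ht ψ'
      have : ∀ x, w a x = 0 := fun x => by rw [hwa]; rfl
      show ‖∫ x, w a x * (starRingEnd ℂ) (S (a - t) ψ' x)‖ ≤ 0 * N43 ψ'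
      simp [this]
    · rw [add_sub_cancel_left]; linarith
  obtain ⟨hii, hie⟩ := int34 a (a + η) (by linarith)
  have hl := PI_bd hw (by linarith) (S (a - τ) ψ) (fun t => (2 * η * L0 * N43 ψ) * (a + η - t) ^ (-(3/4):ℝ))
    (hii.const_mul _) ?_
  · rw [intervalIntegral.integral_const_mul, hie, add_sub_cancel_left] at hl
    have e0 : (∫ x, (w a) x * (starRingEnd ℂ) (S (a - (a + η)) (S (a - τ) ψ) x)) = 0 := by
      have : ∀ x, w a x = 0 := fun x => by rw [hwa]; rfl
      simp [this]
    have e1 : w (a + η) = V (a + η) - (V a + ((η : ℝ) : ℂ) • f1) := by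
      simp only [w]; rw [add_sub_cancel_left]
    have hl' : ‖(∫ x, (w (a + η)) x * (starRingEnd ℂ) (S (a - τ) ψ x)) - (∫ x, (w a) x * (starRingEnd ℂ) (S (a - (a + η)) (S (a - τ) ψ) x))‖
        ≤ 2 * η * L0 * N43 ψ * (4 * η ^ (1/4:ℝ)) := hl
    rw [e0, sub_zero, e1] at hl'
    refine hl'.trans (le_of_eq (by ring))
  · intro t ht
    have htI : t ∈ Set.Icc a (a + η) := ⟨ht.1.le, ht.2.le⟩
    have h1 : N43 (cubeS (V t) - (I • f1 + lS (V a) + ((t - a : ℝ) : ℂ) • lS f1) : SW) ≤ 2 * η * L0 := by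
      refine (hsub t htI).trans ?_
      have h2 := mul_le_mul_of_nonneg_left (hwN t htI) (by positivity : 0 ≤ 4 * A ^ 2)
      have h3 := mul_le_mul_of_nonneg_right hδ' (by positivity : 0 ≤ η * L0)
      linarith
    have h2 : N4 (S (t - (a + η)) (S (a - τ) ψ)) ≤ (a + η - t) ^ (-(3/4):ℝ) * N43 ψ := by
      rw [← S_add]
      refine (disp' _ (by linarith [ht.2]) ψ).trans (mul_le_mul_of_nonneg_right ?_ (N43_nonneg _))
      exact Real.rpow_le_rpow_of_nonpos (by linarith [ht.2]) (by linarith) (by norm_num)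
    refine (mul_le_mul h1 h2 (N4_nonneg _) (by positivity)).trans (le_of_eq (by ring))

lemma lemT_h {a b A : ℝ} {V : ℝ → SW} (h : LS a b V (fun t => cubeS (V t)))
    (hA : ∀ t ∈ Set.Icc a b, N4 (V t) ≤ A) (hδ : 32 * A ^ 2 * (b - a) ^ (1/4:ℝ) ≤ 1) (f1 : SW)
    (hf1 : ∀ x, D vT (VV V) (a, x) = f1 x) :
    ∃ L0, 0 ≤ L0 ∧ ∀ η, 0 < η → ∀ τ, a ≤ τ → τ + η ≤ b →
      N4 (((η⁻¹ : ℝ) : ℂ) • (V (τ + η) - V τ) : SW) ≤ 2 * (CS * √(H1sq f1) + L0 * η ^ (1/4:ℝ)) := by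
  obtain ⟨L0, hL0, hw⟩ := lemT_w h hA hδ f1 hf1
  refine ⟨L0, hL0, ?_⟩
  intro η hη τ hτ hτb
  have hη1 : ‖((η⁻¹ : ℝ) : ℂ)‖ = η⁻¹ := by rw [Complex.norm_real, Real.norm_of_nonneg (by positivity)]
  have hab : a ≤ b := by linarith
  have hh : LS a (b - η) V (fun t => cubeS (V t)) := h.mono le_rfl (by linarith)
  have hs : LS a (b - η) (fun t => V (t + η)) (fun t => cubeS (V (t + η))) := by
    have : LS (a + η) (b - η + η) V (fun t => cubeS (V t)) := h.mono (by linarith) (by linarith)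
    exact this.shift
  have hq := (hs.sub hh).smul ((η⁻¹ : ℝ) : ℂ)
  have hm : ∀ t ∈ Set.Icc a (b - η), t ∈ Set.Icc a b ∧ t + η ∈ Set.Icc a b := fun t ht =>
    ⟨⟨ht.1, by linarith [ht.2]⟩, ⟨by linarith [ht.1], by linarith [ht.2]⟩⟩
  have key := absorb hq (by linarith) (4 * A ^ 2) 0 (CS * √(H1sq f1) + L0 * η ^ (1/4:ℝ)) (η⁻¹ * (A + A)) (by positivity) le_rfl
    (by have := CS_nonneg; positivity) ?_ ?_ ?_ ?_ τ ⟨hτ, by linarith⟩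
  · rw [mul_zero, add_zero] at key
    exact key
  · intro t ht
    rw [N43_smul, N4_smul, add_zero]
    have := cube_diff_A A _ _ (hA _ (hm t ht).2) (hA _ (hm t ht).1)
    have := mul_le_mul_of_nonneg_left this (norm_nonneg ((η⁻¹ : ℝ) : ℂ))
    linarith
  · intro t ht
    rw [N4_smul, hη1]
    refine mul_le_mul_of_nonneg_left ?_ (by positivity)
    exact (N4_sub _ _).trans (add_le_add (hA _ (hm t ht).2) (hA _ (hm t ht).1))
  · intro t ht ψ
    have e : ∀ x, (((η⁻¹ : ℝ) : ℂ) • (V (a + η) - V a) : SW) x = f1 x + ((η⁻¹ : ℝ) : ℂ) * (V (a + η) - (V a + ((η : ℝ) : ℂ) • f1)) x := by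
      intro x
      simp only [sub_apply, add_apply, smul_apply, smul_eq_mul]
      have : ((η⁻¹ : ℝ) : ℂ) * (η : ℂ) = 1 := by
        rw [← Complex.ofReal_mul, inv_mul_cancel₀ hη.ne']; simp
      linear_combination (f1 x) * this
    have e2 : (∫ x, (((η⁻¹ : ℝ) : ℂ) • (V (a + η) - V a) : SW) x * (starRingEnd ℂ) (S (a - t) ψ x)) =
        (∫ x, f1 x * (starRingEnd ℂ) (S (a - t) ψ x)) +
        ((η⁻¹ : ℝ) : ℂ) * ∫ x, (V (a + η) - (V a + ((η : ℝ) : ℂ) • f1)) x * (starRingEnd ℂ) (S (a - t) ψ x) := by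
      rw [← integral_const_mul, ← integral_add (sw_prod_int _ _) ((sw_prod_int _ _).const_mul _)]
      congr 1; ext x
      rw [e x]; ring
    rw [e2]
    refine (norm_add_le _ _).trans ?_
    rw [norm_mul, hη1, add_mul]
    refine add_le_add (S_adj_bd _ _ _) ?_
    have h3 := mul_le_mul_of_nonneg_left (hw η hη.le (by linarith) t ht.1 ψ) (by positivity : 0 ≤ η⁻¹)
    refine h3.trans (le_of_eq ?_)
    field_simp
  · have : (b - η - a) ^ (1/4:ℝ) ≤ (b - a) ^ (1/4:ℝ) := Real.rpow_le_rpow (by linarith) (by linarith) (by norm_num)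
    have := mul_le_mul_of_nonneg_left this (by positivity : 0 ≤ 16 * A ^ 2)
    linarith

lemma lemT {a b A : ℝ} {V : ℝ → SW} (h : LS a b V (fun t => cubeS (V t)))
    (hA : ∀ t ∈ Set.Icc a b, N4 (V t) ≤ A) (hδ : 32 * A ^ 2 * (b - a) ^ (1/4:ℝ) ≤ 1) (f1 : SW)
    (hf1 : ∀ x, D vT (VV V) (a, x) = f1 x) (τ : ℝ) (h1 : a ≤ τ) (h2 : τ < b) (ft : SW)
    (hft : ∀ x, D vT (VV V) (τ, x) = ft x) : N4 ft ≤ 2 * (CS * √(H1sq f1)) := by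
  obtain ⟨L0, hL0, hh⟩ := lemT_h h hA hδ f1 hf1
  set η : ℕ → ℝ := fun n => (b - τ) / ((n:ℝ) + 1) with hηd
  have hη0 : ∀ n, 0 < η n := fun n => by have : 0 < b - τ := by linarith
                                         positivity
  have hηb : ∀ n, τ + η n ≤ b := fun n => by
    have : η n ≤ b - τ := div_le_self (by linarith) (by linarith [Nat.cast_nonneg (α := ℝ) n])
    linarith
  have hηt : Tendsto η atTop (𝓝 0) := by
    have := (tendsto_one_div_add_atTop_nhds_zero_nat (𝕜 := ℝ)).const_mul (b - τ)
    rw [mul_zero] at this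
    refine this.congr fun n => ?_
    simp only [hηd]; ring
  have hlim : ∀ x, Tendsto (fun n => (((η n)⁻¹ : ℝ) : ℂ) • (V (τ + η n) x - V τ x)) atTop (𝓝 (ft x)) := by
    intro x
    have hd := D_time h.sm τ x
    rw [hft] at hd
    have h3 := hd.tendsto_slope_zero
    have h4 : Tendsto η atTop (𝓝[≠] 0) := tendsto_nhdsWithin_iff.2 ⟨hηt, Eventually.of_forall fun n => (hη0 n).ne'⟩
    have h5 := h3.comp h4
    refine h5.congr fun n => ?_
    simp only [Function.comp, VV, Complex.real_smul, smul_eq_mul]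
  have hfat := Lp.eLpNorm_lim_le_liminf_eLpNorm (p := 4) (μ := volume)
    (f := fun n x => (((η n)⁻¹ : ℝ) : ℂ) • (V (τ + η n) x - V τ x))
    (fun n => (sw_m ((((η n)⁻¹ : ℝ) : ℂ) • (V (τ + η n) - V τ) : SW))) ft (Eventually.of_forall hlim)
  have hb : ∀ n, eLpNorm (fun x => (((η n)⁻¹ : ℝ) : ℂ) • (V (τ + η n) x - V τ x)) 4 volume ≤
      ENNReal.ofReal (2 * (CS * √(H1sq f1) + L0 * η n ^ (1/4:ℝ))) := by
    intro n
    have := hh (η n) (hη0 n) τ h1 (hηb n)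
    refine le_trans (le_of_eq ?_) (ENNReal.ofReal_le_ofReal this)
    exact (ofReal_lpNorm (sw_memLp ((((η n)⁻¹ : ℝ) : ℂ) • (V (τ + η n) - V τ) : SW) 4)).symm
  have htend : Tendsto (fun n => ENNReal.ofReal (2 * (CS * √(H1sq f1) + L0 * η n ^ (1/4:ℝ)))) atTop
      (𝓝 (ENNReal.ofReal (2 * (CS * √(H1sq f1))))) := by
    refine ENNReal.tendsto_ofReal ?_
    have h6 : Tendsto (fun n => η n ^ (1/4:ℝ)) atTop (𝓝 0) := by
      have := hηt.rpow_const (p := (1/4:ℝ)) (Or.inr (by norm_num))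
      rwa [Real.zero_rpow (by norm_num)] at this
    have := ((h6.const_mul L0).const_add (CS * √(H1sq f1))).const_mul 2
    simpa using this
  have h7 : eLpNorm ft 4 volume ≤ ENNReal.ofReal (2 * (CS * √(H1sq f1))) := by
    refine hfat.trans ?_
    rw [← htend.liminf_eq]
    exact Filter.liminf_le_liminf (Eventually.of_forall hb)
  unfold N4
  rw [← toReal_eLpNorm (sw_m ft)]
  exact ENNReal.toReal_le_of_le_ofReal (by have := CS_nonneg; positivity) h7

end Part15

section Part16



attribute [local irreducible] S dS lS cubeS

lemma VV_eq_UU {u : ℝ → E3 → ℂ} {V : ℝ → SW} (hV : ∀ t x, u t x = V t x) : VV V = UU u :=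
  funext fun p => (hV p.1 p.2).symm

lemma br_H1 {α β : ℝ} {u : ℝ → E3 → ℂ} (h : Sol α β u) {V : ℝ → SW} (hV : ∀ t x, u t x = V t x) (t : ℝ) :
    H1sq (V t) = Imass u t + Igr u t := by
  unfold H1sq Imass Igr
  congr 1
  · refine integral_congr_ae (Eventually.of_forall fun x => ?_)
    simp only; rw [nU_eq, ← hV]; rfl
  · rw [← integral_finsetSum _ (fun i _ => sw_sq_int _)]
    refine integral_congr_ae (Eventually.of_forall fun x => ?_)
    simp only; rw [gU_eq h.sm]
    refine Finset.sum_congr rfl fun i _ => ?_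
    rw [h.slice t (V t) (hV t)]

lemma br_N4 {u : ℝ → E3 → ℂ} {V : ℝ → SW} (hV : ∀ t x, u t x = V t x) (t : ℝ) :
    N4 (V t) ^ 4 = Iq u t := by
  rw [N4_pow (sw_m _)]
  unfold Iq
  refine integral_congr_ae (Eventually.of_forall fun x => ?_)
  simp only; rw [nU_eq, ← hV]; unfold UU; ring

lemma br_It {u : ℝ → E3 → ℂ} (h : ContDiff ℝ ∞ (UU u)) (t : ℝ) (ft : SW) (hft : ∀ x, D vT (UU u) (t, x) = ft x) :
    It u t = N4 ft ^ 4 := by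
  rw [N4_pow (sw_m _)]
  unfold It
  refine integral_congr_ae (Eventually.of_forall fun x => ?_)
  simp only; rw [tU_eq h, hft]; ring

lemma br_LS {α β : ℝ} {u : ℝ → E3 → ℂ} (h : Sol α β u) {V : ℝ → SW} (hV : ∀ t x, u t x = V t x) (C : ℝ)
    (hC : ∀ t ∈ Set.Icc α β, Imass u t + Igr u t ≤ C) : LS α β V (fun t => cubeS (V t)) := by
  have e := VV_eq_UU hV
  refine ⟨by rw [e]; exact h.sm, fun t ht x => ?_, ⟨C, fun t ht => by rw [br_H1 h hV]; exact hC t ht⟩,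
    ⟨(CS * √C) ^ 3, fun t ht => ?_⟩⟩
  · rw [e, cubeS_apply, lS_apply]
    have h1 := h.eqn (t, x) ht
    have h2 : ∀ i, D (vX i) (D (vX i) (UU u)) (t, x) = dS i (dS i (V t)) x := by
      intro i
      rw [D_slice (D_sm h.sm _), dS_apply]
      have : (fun y => D (vX i) (UU u) (t, y)) = dS i (V t) := funext fun y => h.slice t (V t) (hV t) i y
      rw [this]
    simp_rw [h2] at h1
    rw [h1]
    have : UU u (t, x) = V t x := hV t x
    rw [this]
  · rw [cubeS_N43]
    refine pow_le_pow_left₀ (N4_nonneg _) ((sobolev _).trans ?_) 3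
    refine mul_le_mul_of_nonneg_left (Real.sqrt_le_sqrt ?_) CS_nonneg
    rw [br_H1 h hV]; exact hC t ht

/-- time derivative bound on short intervals -/
lemma lemTU {a b M : ℝ} {u : ℝ → E3 → ℂ} (h : Sol a b u) (hM : ∀ t ∈ Set.Icc a b, Imass u t + Igr u t ≤ M)
    (hδ : 32 * (CS * √M) ^ 2 * (b - a) ^ (1/4:ℝ) ≤ 1) (f1 : SW) (hf1 : ∀ x, D vT (UU u) (a, x) = f1 x)
    (τ : ℝ) (h1 : a ≤ τ) (h2 : τ < b) : It u τ ≤ (2 * (CS * √(H1sq f1))) ^ 4 := by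
  choose V hV using h.sw
  obtain ⟨ft, hft⟩ := h.swt τ
  rw [br_It h.sm τ ft hft]
  refine pow_le_pow_left₀ (N4_nonneg _) ?_ 4
  have e := VV_eq_UU hV
  refine lemT (br_LS h hV M hM) (A := CS * √M) (fun t ht => ?_) hδ f1 (by rw [e]; exact hf1) τ h1 h2 ft
    (by rw [e]; exact hft)
  refine (sobolev _).trans (mul_le_mul_of_nonneg_left (Real.sqrt_le_sqrt ?_) CS_nonneg)
  rw [br_H1 h hV]; exact hM t ht

lemma ex_delta (M : ℝ) : ∃ δ > 0, ∀ L, L ≤ δ → 0 ≤ L → 32 * (CS * √M) ^ 2 * L ^ (1/4:ℝ) ≤ 1 := by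
  set K := 32 * (CS * √M) ^ 2 with hK
  have hK0 : 0 ≤ K := by positivity
  refine ⟨((K + 1)⁻¹) ^ 4, by positivity, fun L hL h0 => ?_⟩
  have h1 : L ^ (1/4:ℝ) ≤ (((K + 1)⁻¹) ^ 4) ^ (1/4:ℝ) := Real.rpow_le_rpow h0 hL (by norm_num)
  have h2 : (((K + 1)⁻¹) ^ 4) ^ (1/4:ℝ) = (K + 1)⁻¹ := by
    rw [← Real.rpow_natCast, ← Real.rpow_mul (by positivity)]; norm_num
  rw [h2] at h1
  calc K * L ^ (1/4:ℝ) ≤ K * (K + 1)⁻¹ := mul_le_mul_of_nonneg_left h1 hK0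
    _ ≤ 1 := by rw [← div_eq_mul_inv, div_le_one (by positivity)]; linarith

def four (u : ℝ → E3 → ℂ) (t C : ℝ) : Prop := Imass u t ≤ C ∧ Igr u t ≤ C ∧ Iq u t ≤ C ∧ It u t ≤ C

lemma four.mono {u : ℝ → E3 → ℂ} {t C C' : ℝ} (h : four u t C) (hC : C ≤ C') : four u t C' :=
  ⟨h.1.trans hC, h.2.1.trans hC, h.2.2.1.trans hC, h.2.2.2.trans hC⟩

def Good (u : ℝ → E3 → ℂ) (t : ℝ) : Prop := ∃ ε > 0, ∃ C, ∀ s, 0 ≤ s → |s - t| < ε → four u s C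

lemma good_Bd {u : ℝ → E3 → ℂ} {a b : ℝ} (ha : 0 ≤ a) (hG : ∀ t ∈ Set.Icc a b, Good u t) : ∃ C, Bd a b u C := by
  have := isCompact_Icc.induction_on (s := Set.Icc a b) (p := fun s => ∃ C, ∀ t ∈ s, 0 ≤ t → four u t C)
    ⟨0, by simp⟩ (fun s t hst ⟨C, hC⟩ => ⟨C, fun x hx => hC x (hst hx)⟩)
    (fun s t ⟨C, hC⟩ ⟨C', hC'⟩ => ⟨max C C', fun x hx h0 => hx.elim
      (fun hx => (hC x hx h0).mono (le_max_left _ _)) (fun hx => (hC' x hx h0).mono (le_max_right _ _))⟩)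
    (fun x hx => by
      obtain ⟨ε, hε, C, hC⟩ := hG x hx
      refine ⟨Metric.ball x ε, mem_nhdsWithin_of_mem_nhds (Metric.ball_mem_nhds x hε), C, fun t ht h0 => ?_⟩
      exact hC t h0 (by rwa [Metric.mem_ball, Real.dist_eq] at ht))
  obtain ⟨C, hC⟩ := this
  exact ⟨C, fun t ht => (hC t ht (ha.trans ht.1)).1, fun t ht => (hC t ht (ha.trans ht.1)).2.1,
    fun t ht => (hC t ht (ha.trans ht.1)).2.2.1, fun t ht => (hC t ht (ha.trans ht.1)).2.2.2⟩

lemma good_const {u : ℝ → E3 → ℂ} {a b : ℝ} (ha : 0 ≤ a) (hab : a ≤ b) (h : Sol a b u)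
    (hG : ∀ t ∈ Set.Icc a b, Good u t) : Imass u b = Imass u a ∧ Ien u b = Ien u a := by
  obtain ⟨C, hC⟩ := good_Bd ha hG
  exact ⟨mass_law h hab C fun t ht => ⟨hC.m t ht, hC.g t ht⟩, energy_law h hab C hC⟩

/-- gap lemma -/
lemma gap {u : ℝ → E3 → ℂ} {a b n : ℝ} (ha : 0 ≤ a) (hab : a < b) (h : Sol a b u)
    (hG : ∀ t ∈ Set.Ioc a b, Good u t) (f1 : SW) (hf1 : ∀ x, D vT (UU u) (a, x) = f1 x)
    (n1 : Imass u a ≤ n) (n2 : Igr u a ≤ n) (n3 : Iq u a ≤ n) (n4 : H1sq f1 ≤ n)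
    (hδ : 32 * (CS * √(3 * n)) ^ 2 * (b - a) ^ (1/4:ℝ) ≤ 1) (t : ℝ) (h1 : a ≤ t) (h2 : t < b) :
    four u t (3 * n + (2 * (CS * √n)) ^ 4) := by
  have hn0 : 0 ≤ n := (Imass_nn u a).trans n1
  have hc : ∀ t ∈ Set.Ioc a b, Imass u b = Imass u t ∧ Ien u b = Ien u t := fun t ht =>
    good_const (ha.trans ht.1.le) ht.2 (h.mono ht.1.le le_rfl) (fun s hs => hG s ⟨ht.1.trans_le hs.1, hs.2⟩)
  set M' := max (Imass u a + Igr u a) (Imass u b + 2 * Ien u b) with hM'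
  have hMb : ∀ t ∈ Set.Icc a b, Imass u t + Igr u t ≤ M' := by
    intro t ht
    rcases ht.1.eq_or_lt with rfl | h'
    · exact le_max_left _ _
    · refine le_trans ?_ (le_max_right _ _)
      have := hc t ⟨h', ht.2⟩
      rw [this.1, this.2, Ien_eq h]
      have := Iq_nn u t; linarith
  obtain ⟨δ, hδ0, hδM⟩ := ex_delta M'
  set b' := min b (a + δ) with hb'
  have hab' : a < b' := lt_min hab (by linarith)
  have hT1 : ∀ τ, a ≤ τ → τ < b' → It u τ ≤ (2 * (CS * √(H1sq f1))) ^ 4 := fun τ => 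
    lemTU (h.mono le_rfl (min_le_left _ _)) (fun t ht => hMb t ⟨ht.1, ht.2.trans (min_le_left _ _)⟩)
      (hδM _ (by have := min_le_right b (a + δ); linarith) (by linarith)) f1 hf1 τ
  set c := (a + b') / 2 with hcd
  have hac : a < c := by rw [hcd]; linarith
  have hcb' : c < b' := by rw [hcd]; linarith
  have hcb : c ≤ b := hcb'.le.trans (min_le_left _ _)
  have hEq : ∀ t ∈ Set.Icc a b, Iq u t ≤ 4 * max (Ien u a) (Ien u b) := by
    intro t ht
    have e := Ien_eq h t
    have g0 := Igr_nn u t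
    rcases ht.1.eq_or_lt with h' | h'
    · have := le_max_left (Ien u a) (Ien u b)
      rw [h'] at this ⊢; linarith
    · have := (hc t ⟨h', ht.2⟩).2
      have := le_max_right (Ien u a) (Ien u b)
      linarith
  have hBd : Bd a c u (max (max M' (4 * max (Ien u a) (Ien u b))) ((2 * (CS * √(H1sq f1))) ^ 4)) := by
    refine ⟨fun t ht => ?_, fun t ht => ?_, fun t ht => ?_, fun t ht => ?_⟩
    · refine le_trans ?_ ((le_max_left _ _).trans (le_max_left _ _))
      have := hMb t ⟨ht.1, ht.2.trans hcb⟩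
      have := Igr_nn u t; linarith
    · refine le_trans ?_ ((le_max_left _ _).trans (le_max_left _ _))
      have := hMb t ⟨ht.1, ht.2.trans hcb⟩
      have := Imass_nn u t; linarith
    · exact (hEq t ⟨ht.1, ht.2.trans hcb⟩).trans ((le_max_right _ _).trans (le_max_left _ _))
    · exact (hT1 t ht.1 (ht.2.trans_lt hcb')).trans (le_max_right _ _)
  have hm1 := mass_law (h.mono le_rfl hcb) hac.le _ (fun t ht => ⟨hBd.m t ht, hBd.g t ht⟩)
  have he1 := energy_law (h.mono le_rfl hcb) hac.le _ hBd
  have hcc := hc c ⟨hac, hcb⟩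
  have hma : ∀ t ∈ Set.Icc a b, Imass u t = Imass u a ∧ Ien u t = Ien u a := by
    intro t ht
    rcases ht.1.eq_or_lt with rfl | h'
    · exact ⟨rfl, rfl⟩
    · have := hc t ⟨h', ht.2⟩
      exact ⟨by linarith, by linarith⟩
  have ea := Ien_eq h a
  have hfin : ∀ t ∈ Set.Icc a b, Imass u t ≤ n ∧ Igr u t ≤ 3/2 * n ∧ Iq u t ≤ 3 * n := by
    intro t ht
    have := hma t ht
    have et := Ien_eq h t
    have := Igr_nn u t; have := Iq_nn u t
    refine ⟨by linarith, by linarith, by linarith⟩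
  have hIt := lemTU h (M := 3 * n) (fun t ht => by have := hfin t ht; linarith) hδ f1 hf1 t h1 h2
  have hIt2 : It u t ≤ (2 * (CS * √n)) ^ 4 := by
    refine hIt.trans (pow_le_pow_left₀ (by have := CS_nonneg; positivity) ?_ 4)
    have := mul_le_mul_of_nonneg_left (Real.sqrt_le_sqrt n4) CS_nonneg
    linarith
  have := hfin t ⟨h1, h2.le⟩
  have hp : 0 ≤ (2 * (CS * √n)) ^ 4 := by positivity
  exact ⟨by linarith, by linarith, by linarith, by linarith⟩

end Part16

section Part17



attribute [local irreducible] S dS lS cubeS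

def FF (u : ℝ → E3 → ℂ) (p : R4) : ℝ :=
  nU u p + gU u p + nU u p ^ 2 + tU u p ^ 2 + (‖D vT (UU u) p‖ ^ 2 + ∑ i, ‖D (vX i) (D vT (UU u)) p‖ ^ 2)

def Ph (u : ℝ → E3 → ℂ) (t : ℝ) : ℝ≥0∞ := ∫⁻ x, ENNReal.ofReal (FF u (t, x))

lemma FF_cont {u : ℝ → E3 → ℂ} (h : ContDiff ℝ ∞ (UU u)) : Continuous (FF u) := by
  unfold FF
  have h1 := (nD_sm (Pr_sm h) (Qi_sm h)).continuous
  have h2 := (gD_sm (Pr_sm h) (Qi_sm h)).continuous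
  have h3 := (tD_sm (Pr_sm h) (Qi_sm h)).continuous
  have h4 := (D_sm h vT).continuous
  have h5 := fun i => (D_sm (D_sm h vT) (vX i)).continuous
  fun_prop

lemma Ph_closed {u : ℝ → E3 → ℂ} (h : ContDiff ℝ ∞ (UU u)) (c : ℝ≥0∞) : IsClosed {t | Ph u t ≤ c} := by
  refine IsSeqClosed.isClosed fun s t hs ht => ?_
  have hc := FF_cont h
  have h1 : Ph u t = ∫⁻ x, liminf (fun k => ENNReal.ofReal (FF u (s k, x))) atTop := by
    unfold Ph
    refine lintegral_congr fun x => ?_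
    have : Tendsto (fun k => ENNReal.ofReal (FF u (s k, x))) atTop (𝓝 (ENNReal.ofReal (FF u (t, x)))) :=
      ((ENNReal.continuous_ofReal.comp (hc.comp (Continuous.prodMk_left x))).tendsto t).comp ht
    exact this.liminf_eq.symm
  show Ph u t ≤ c
  rw [h1]
  refine (lintegral_liminf_le (fun k => ?_)).trans ?_
  · exact (ENNReal.continuous_ofReal.comp (hc.comp (Continuous.prodMk_right _))).measurable
  · refine (liminf_le_liminf (Eventually.of_forall fun k => hs k)).trans ?_
    simp

lemma FF_int {α β : ℝ} {u : ℝ → E3 → ℂ} (h : Sol α β u) (t : ℝ) (f1 : SW) (hf1 : ∀ x, D vT (UU u) (t, x) = f1 x) :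
    Integrable (fun x => FF u (t, x)) ∧
     ∫ x, FF u (t, x) = Imass u t + Igr u t + Iq u t + It u t + H1sq f1 := by
  have e : ∀ x, FF u (t, x) = nU u (t, x) + gU u (t, x) + nU u (t, x) ^ 2 + tU u (t, x) ^ 2 +
      (‖f1 x‖ ^ 2 + ∑ i, ‖dS i f1 x‖ ^ 2) := by
    intro x
    unfold FF
    rw [hf1]
    congr 2
    refine Finset.sum_congr rfl fun i _ => ?_
    rw [D_slice (D_sm h.sm _), dS_apply]
    rw [show (fun y => D vT (UU u) (t, y)) = f1 from funext hf1]
  simp_rw [e]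
  have i1 := int_n h t
  have i2 := int_g h t
  have i3 := int_n2 h t
  have i4 := int_t2 h t
  have i5 := sw_sq_int f1
  have i6 : Integrable (fun x => ∑ i, ‖dS i f1 x‖ ^ 2) := integrable_finsetSum _ fun i _ => sw_sq_int _
  refine ⟨(((i1.add i2).add i3).add i4).add (i5.add i6), ?_⟩
  have a1 := integral_add (((i1.add i2).add i3).add i4) (i5.add i6)
  have a2 := integral_add ((i1.add i2).add i3) i4
  have a3 := integral_add (i1.add i2) i3
  have a4 := integral_add i1 i2
  have a5 := integral_add i5 i6
  have a6 := integral_finsetSum (μ := volume) Finset.univ (f := fun i x => ‖dS i f1 x‖ ^ 2) (fun i _ => sw_sq_int _)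
  simp only [Pi.add_apply] at a1 a2 a3 a4 a5
  rw [a1, a2, a3, a4, a5, a6]
  rfl

lemma FF_nn (u : ℝ → E3 → ℂ) (p : R4) : 0 ≤ FF u p := by
  unfold FF
  have := nD_nn (Pr u) (Qi u) p
  have := gD_nn (Pr u) (Qi u) p
  positivity

lemma Ph_eq {α β : ℝ} {u : ℝ → E3 → ℂ} (h : Sol α β u) (t : ℝ) (f1 : SW) (hf1 : ∀ x, D vT (UU u) (t, x) = f1 x) :
    Ph u t = ENNReal.ofReal (Imass u t + Igr u t + Iq u t + It u t + H1sq f1) := by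
  have := FF_int h t f1 hf1
  rw [← this.2]
  exact (ofReal_integral_eq_lintegral_ofReal this.1 (Eventually.of_forall fun x => FF_nn _ _)).symm

lemma Ph_le {α β : ℝ} {u : ℝ → E3 → ℂ} (h : Sol α β u) (t : ℝ) (f1 : SW) (hf1 : ∀ x, D vT (UU u) (t, x) = f1 x)
    (n : ℕ) (hn : Ph u t ≤ n) : Imass u t ≤ n ∧ Igr u t ≤ n ∧ Iq u t ≤ n ∧ It u t ≤ n ∧ H1sq f1 ≤ n := by
  rw [Ph_eq h t f1 hf1, ← ENNReal.ofReal_natCast, ENNReal.ofReal_le_ofReal_iff (by positivity)] at hn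
  have := Imass_nn u t; have := Igr_nn u t; have := Iq_nn u t; have := It_nn u t; have := H1sq_nonneg f1
  refine ⟨by linarith, by linarith, by linarith, by linarith, by linarith⟩

lemma good_open (u : ℝ → E3 → ℂ) : IsOpen {t | Good u t} := by
  rw [Metric.isOpen_iff]
  rintro t ⟨ε, hε, C, hC⟩
  refine ⟨ε / 2, by positivity, fun s hs => ⟨ε / 2, by positivity, C, fun r hr h => hC r hr ?_⟩⟩
  rw [Metric.mem_ball, Real.dist_eq] at hs
  have := abs_sub_le r s t
  linarith

def KK (u : ℝ → E3 → ℂ) : Set ℝ := {t | 0 ≤ t ∧ ¬ Good u t}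

lemma KK_closed (u : ℝ → E3 → ℂ) : IsClosed (KK u) :=
  isClosed_Ici.inter (good_open u).isClosed_compl

/-- right-hand bound starting from a bad point -/
lemma right_bd {u : ℝ → E3 → ℂ} (hS : ∀ T, Sol 0 T u) (n : ℕ) (k r : ℝ) (hk : k ∈ KK u)
    (hK : ∀ s ∈ KK u, k ≤ s → s < r → Ph u s ≤ n)
    (hδ : ∀ L, L ≤ r - k → 0 ≤ L → 32 * (CS * √(3 * n)) ^ 2 * L ^ (1/4:ℝ) ≤ 1)
    (t : ℝ) (h1 : k ≤ t) (h2 : t < r) : four u t (3 * n + (2 * (CS * √n)) ^ 4) := by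
  have ht0 : 0 ≤ t := hk.1.trans h1
  by_cases ht : t ∈ KK u
  · obtain ⟨f1, hf1⟩ := (hS 0).swt t
    have := Ph_le (hS 0) t f1 hf1 n (hK t ht h1 h2)
    have hp : 0 ≤ (2 * (CS * √n)) ^ 4 := by positivity
    have hn0 : (0:ℝ) ≤ n := by positivity
    exact ⟨by linarith, by linarith, by linarith, by linarith⟩
  · set A := KK u ∩ Set.Icc k t with hA
    have hAc : IsCompact A := isCompact_Icc.inter_left (KK_closed u)
    have hAn : A.Nonempty := ⟨k, hk, le_rfl, h1⟩
    obtain ⟨haK, ha⟩ := hAc.sSup_mem hAn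
    set a := sSup A with had
    have hat : a < t := lt_of_le_of_ne ha.2 (fun h => ht (h ▸ haK))
    have hgt : ∀ s, a < s → s ≤ t → Good u s := by
      intro s hs hst
      by_contra hb
      have : s ∈ A := ⟨⟨haK.1.trans hs.le, hb⟩, ha.1.trans hs.le, hst⟩
      have := le_csSup hAc.bddAbove this
      linarith
    have hgt' : Good u t := hgt t hat le_rfl
    obtain ⟨ε, hε, hb⟩ := Metric.isOpen_iff.1 (good_open u) t hgt'
    set b := t + min (ε / 2) ((r - t) / 2) with hbd
    have hm1 := min_le_left (ε / 2) ((r - t) / 2)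
    have hm2 := min_le_right (ε / 2) ((r - t) / 2)
    have hm3 : 0 < min (ε / 2) ((r - t) / 2) := lt_min (by linarith) (by linarith)
    obtain ⟨f1, hf1⟩ := (hS 0).swt a
    obtain ⟨n1, n2, n3, n4, n5⟩ := Ph_le (hS 0) a f1 hf1 n (hK a haK ha.1 (hat.trans h2))
    refine gap (b := b) haK.1 (by linarith) ((hS b).mono haK.1 le_rfl) (fun s hs => ?_) f1 hf1 n1 n2 n3 n5
      (hδ _ (by linarith [ha.1]) (by linarith)) t hat.le (by linarith)
    rcases le_or_gt s t with h' | h'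
    · exact hgt s hs.1 h'
    · refine hb ?_
      rw [Metric.mem_ball, Real.dist_eq, abs_of_pos (by linarith)]
      have := hs.2; linarith

/-- left-hand bound in a gap -/
lemma left_bd {u : ℝ → E3 → ℂ} (hS : ∀ T, Sol 0 T u) (c r : ℝ) (hc : 0 ≤ c) (hcr : c < r)
    (hG : ∀ t, c ≤ t → t < r → Good u t) : ∃ d < r, ∃ C, ∀ t, d ≤ t → t < r → four u t C := by
  have hcst : ∀ t, c ≤ t → t < r → Imass u t = Imass u c ∧ Ien u t = Ien u c := fun t h1 h2 =>
    good_const hc h1 ((hS t).mono hc le_rfl) (fun s hs => hG s hs.1 (hs.2.trans_lt h2))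
  have hb : ∀ t, c ≤ t → t < r → Imass u t + Igr u t ≤ Imass u c + 2 * Ien u c ∧ Iq u t ≤ 4 * Ien u c := by
    intro t h1 h2
    have := hcst t h1 h2
    have e := Ien_eq (hS 0) t
    have := Igr_nn u t; have := Iq_nn u t
    constructor <;> linarith
  obtain ⟨δ, hδ0, hδ⟩ := ex_delta (Imass u c + 2 * Ien u c)
  set d := max c (r - δ) with hd
  have hdr : d < r := max_lt hcr (by linarith)
  have hcd : c ≤ d := le_max_left _ _
  have hrd : r - δ ≤ d := le_max_right _ _
  obtain ⟨f1, hf1⟩ := (hS 0).swt d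
  have hEn : 0 ≤ Ien u c := by
    rw [Ien_eq (hS 0)]; have := Igr_nn u c; have := Iq_nn u c; positivity
  refine ⟨d, hdr, Imass u c + 4 * Ien u c + (2 * (CS * √(H1sq f1))) ^ 4, fun t h1 h2 => ?_⟩
  set b := (t + r) / 2 with hbd
  have hIt := lemTU (a := d) (b := b) ((hS b).mono (hc.trans hcd) le_rfl)
    (fun s hs => (hb s (hcd.trans hs.1) (by have := hs.2; linarith)).1)
    (hδ _ (by linarith) (by linarith)) f1 hf1 t h1 (by linarith)
  have := hb t (hcd.trans h1) h2
  have := Igr_nn u t; have := Iq_nn u t; have := Imass_nn u t; have := Imass_nn u c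
  have hp : 0 ≤ (2 * (CS * √(H1sq f1))) ^ 4 := by positivity
  exact ⟨by linarith, by linarith, by linarith, by linarith⟩

set_option maxHeartbeats 1000000 in
lemma all_good {u : ℝ → E3 → ℂ} (hS : ∀ T, Sol 0 T u) (t : ℝ) (ht : 0 ≤ t) : Good u t := by
  by_contra hcon
  have hcl := KK_closed u
  have : CompleteSpace (KK u) := hcl.completeSpace_coe
  have : Nonempty (KK u) := ⟨⟨t, ht, hcon⟩⟩
  obtain ⟨n, hn⟩ := nonempty_interior_of_iUnion_of_closed (X := KK u)
    (f := fun n : ℕ => {s : KK u | Ph u s ≤ n})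
    (fun n => (Ph_closed (hS 0).sm n).preimage continuous_subtype_val)
    (by
      refine Set.eq_univ_of_forall fun s => Set.mem_iUnion.2 ?_
      obtain ⟨f1, hf1⟩ := (hS 0).swt s
      obtain ⟨n, hn⟩ := ENNReal.exists_nat_gt (show Ph u s ≠ ⊤ by rw [Ph_eq (hS 0) s f1 hf1]; simp)
      exact ⟨n, hn.le⟩)
  obtain ⟨⟨k, hk⟩, hkn⟩ := hn
  rw [mem_interior_iff_mem_nhds, Metric.mem_nhds_iff] at hkn
  obtain ⟨ε, hε, hb⟩ := hkn
  have hb' : ∀ s ∈ KK u, |s - k| < ε → Ph u s ≤ n := fun s hs h =>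
    hb (show (⟨s, hs⟩ : KK u) ∈ Metric.ball _ ε from by rw [Metric.mem_ball, Subtype.dist_eq, Real.dist_eq]; exact h)
  obtain ⟨δ, hδ0, hδ⟩ := ex_delta (3 * n)
  set η := min ε δ / 2 with hη
  have hη0 : 0 < η := by have := lt_min hε hδ0; positivity
  have hηε : 2 * η ≤ ε := by have := min_le_left ε δ; linarith
  have hηδ : 2 * η ≤ δ := by have := min_le_right ε δ; linarith
  -- bound starting from any bad point near `k`
  have hR : ∀ l ∈ KK u, k - η < l → l ≤ k → ∀ t, l ≤ t → t < k + η → four u t (3 * n + (2 * (CS * √n)) ^ 4) := by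
    intro l hl h1 h2 t h3 h4
    refine right_bd hS n l (k + η) hl (fun s hs h5 h6 => hb' s hs ?_) (fun L hL hL0 => hδ L (by linarith) hL0) t h3 h4
    rw [abs_lt]; constructor <;> linarith
  apply hk.2
  by_cases hacc : ∃ l ∈ KK u, k - η < l ∧ l < k
  · obtain ⟨l, hl, h1, h2⟩ := hacc
    refine ⟨min η (k - l), lt_min hη0 (by linarith), 3 * n + (2 * (CS * √n)) ^ 4, fun s hs h => hR l hl h1 h2.le s ?_ ?_⟩
    · have := (abs_lt.1 h).1; have := min_le_right η (k - l); linarith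
    · have := (abs_lt.1 h).2; have := min_le_left η (k - l); linarith
  · push Not at hacc
    rcases hk.1.eq_or_lt with h0 | h0
    · refine ⟨η, hη0, 3 * n + (2 * (CS * √n)) ^ 4, fun s hs h => hR k hk (by linarith) le_rfl s (by linarith) ?_⟩
      have := (abs_lt.1 h).2; linarith
    · set c := max 0 (k - η / 2) with hcd
      have hc0 : 0 ≤ c := le_max_left _ _
      have hck : c < k := max_lt h0 (by linarith)
      have hcη : k - η / 2 ≤ c := le_max_right _ _
      obtain ⟨d, hdk, C, hC⟩ := left_bd hS c k hc0 hck (fun s h1 h2 => by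
        by_contra hbad
        have := hacc s ⟨hc0.trans h1, hbad⟩ (by linarith)
        linarith)
      refine ⟨min η (k - d), lt_min hη0 (by linarith), max C (3 * n + (2 * (CS * √n)) ^ 4), fun s hs h => ?_⟩
      rcases lt_or_ge s k with h' | h'
      · refine (hC s ?_ h').mono (le_max_left _ _)
        have := (abs_lt.1 h).1; have := min_le_right η (k - d); linarith
      · refine (hR k hk (by linarith) le_rfl s h' ?_).mono (le_max_right _ _)
        have := (abs_lt.1 h).2; have := min_le_left η (k - d); linarith

lemma all_Bd {u : ℝ → E3 → ℂ} (hS : ∀ T, Sol 0 T u) (T : ℝ) : ∃ C, Bd 0 T u C :=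
  good_Bd le_rfl fun t ht => all_good hS t ht.1

end Part17

section Part18



attribute [local irreducible] S dS lS cubeS

lemma glob_Sol {u : ℝ → E3 → ℂ} (h : IsGlobalSolution 1 1 (fun z => z) u) (T : ℝ) : Sol 0 T u := by
  have hsm : ContDiff ℝ ∞ (UU u) := h.smooth
  have hd : ∀ t x, D vT (UU u) (t, x) = deriv (fun s => u s x) t := fun t x => ((D_time hsm t x).deriv).symm
  refine ⟨hsm, fun t => ?_, fun t => ?_, fun p hp => ?_⟩
  · obtain ⟨g, hg⟩ := h.schwartz 0 t
    exact ⟨g, fun x => by rw [← hg]; simp⟩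
  · obtain ⟨g, hg⟩ := h.schwartz 1 t
    exact ⟨g, fun x => by rw [← hg, hd]; simp⟩
  · obtain ⟨t, x⟩ := p
    have h1 := h.eqn t hp.1 x
    have h2 : lap (u t) x = ∑ i, D (vX i) (D (vX i) (UU u)) (t, x) := by
      unfold lap
      refine Finset.sum_congr rfl fun i _ => ?_
      rw [D_slice (D_sm hsm _)]
      congr 2
      funext y
      rw [D_slice hsm]; rfl
    rw [hd, ← h2]
    rw [ofReal_one, one_mul, one_mul] at h1
    exact h1

lemma glob_bd {u : ℝ → E3 → ℂ} (hS : ∀ T, Sol 0 T u) (t : ℝ) (ht : 0 ≤ t) :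
    Imass u t + Igr u t ≤ Imass u 0 + 2 * Ien u 0 := by
  obtain ⟨h1, h2⟩ := good_const le_rfl ht (hS t) (fun s hs => all_good hS s hs.1)
  have e := Ien_eq (hS 0) t
  have := Iq_nn u t
  linarith

lemma glob_q {u : ℝ → E3 → ℂ} (hS : ∀ T, Sol 0 T u) (t : ℝ) (ht : 0 < t) :
    Iq u t ≤ Ivar u 0 / 2 * (t ^ 2)⁻¹ := by
  obtain ⟨C, hC⟩ := all_Bd hS t
  have := pseudo_conf (hS t) ht.le C hC
  rw [← div_eq_mul_inv, le_div_iff₀ (by positivity)]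
  linarith

lemma Ivar_nn (u : ℝ → E3 → ℂ) (t : ℝ) : 0 ≤ Ivar u t :=
  integral_nonneg fun x => mul_nonneg (r2_nn _) (nD_nn _ _ _)

lemma glob_N4 {u : ℝ → E3 → ℂ} (hS : ∀ T, Sol 0 T u) {V : ℝ → SW} (hV : ∀ t x, u t x = V t x) (t : ℝ) (ht : 0 < t) :
    N4 (V t) ^ 3 ≤ (Ivar u 0 / 2) ^ (3/4:ℝ) * t ^ (-(3/2):ℝ) := by
  have h1 := glob_q hS t ht
  rw [← br_N4 hV] at h1
  have h0 := N4_nonneg (V t)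
  have hv := Ivar_nn u 0
  have e1 : N4 (V t) ^ 3 = (N4 (V t) ^ 4) ^ (3/4:ℝ) := by
    rw [← Real.rpow_natCast, ← Real.rpow_natCast, ← Real.rpow_mul h0]; norm_num
  have e2 : ((t ^ 2)⁻¹) ^ (3/4:ℝ) = t ^ (-(3/2):ℝ) := by
    rw [← Real.rpow_natCast, ← Real.rpow_neg ht.le, ← Real.rpow_mul ht.le]; norm_num
  rw [e1, ← e2, ← Real.mul_rpow (by positivity) (by positivity)]
  exact Real.rpow_le_rpow (by positivity) h1 (by norm_num)

lemma int_32 {a b : ℝ} (ha : 0 < a) (hab : a ≤ b) : IntervalIntegrable (fun t : ℝ => t ^ (-(3/2):ℝ)) volume a b ∧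
    ∫ t in a..b, t ^ (-(3/2):ℝ) ≤ 2 * a ^ (-(1/2):ℝ) := by
  have h0 : (0:ℝ) ∉ Set.uIcc a b := by
    rw [Set.uIcc_of_le hab]; intro h; linarith [h.1]
  refine ⟨intervalIntegral.intervalIntegrable_rpow (Or.inr h0), ?_⟩
  rw [integral_rpow (Or.inr ⟨by norm_num, h0⟩)]
  have e : (-(3/2):ℝ) + 1 = -(1/2) := by norm_num
  rw [e]
  have : 0 ≤ b ^ (-(1/2):ℝ) := Real.rpow_nonneg (by linarith) _
  linarith

/-- profile -/
def prof (V : ℝ → SW) (t : ℝ) : SW := S (-t) (V t)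

lemma prof_fourier (V : ℝ → SW) (t : ℝ) (ξ : E3) : 𝓕 (V t) ξ = mS t ξ * 𝓕 (prof V t) ξ := by
  unfold prof
  rw [S_fourier, ← mul_assoc, ← mS_add]; simp [mS_zero]

lemma S_sub (σ : ℝ) (f g : SW) : S σ (f - g) = S σ f - S σ g := by
  unfold S; rw [map_sub]

lemma prof_cauchy {u : ℝ → E3 → ℂ} (hS : ∀ T, Sol 0 T u) {V : ℝ → SW} (hV : ∀ t x, u t x = V t x) :
    ∃ K M : ℝ, 0 ≤ K ∧ 0 ≤ M ∧ ∀ a b, 0 < a → a ≤ b →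
      (∫ x, ‖(prof V b - prof V a) x‖ ^ 2) ≤ K * a ^ (-(1/2):ℝ) ∧ H1sq (prof V b - prof V a) ≤ M := by
  set M := Imass u 0 + 2 * Ien u 0 with hM
  have hM0 : 0 ≤ M := by
    have := glob_bd hS 0 le_rfl
    have := Imass_nn u 0; have := Igr_nn u 0; linarith
  have hH : ∀ t, 0 ≤ t → H1sq (V t) ≤ M := fun t ht => by rw [br_H1 (hS 0) hV]; exact glob_bd hS t ht
  set P := (Ivar u 0 / 2) ^ (3/4:ℝ) with hP
  have hP0 : 0 ≤ P := Real.rpow_nonneg (by have := Ivar_nn u 0; positivity) _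
  have hCS := CS_nonneg
  refine ⟨P * (CS * √(4 * M)) * 2, 4 * M, by positivity, by positivity, fun a b ha hab => ?_⟩
  have hHd : H1sq (prof V b - prof V a) ≤ 4 * M := by
    refine (H1sq_sub _ _).trans ?_
    unfold prof
    rw [H1sq_S, H1sq_S]
    have := hH a ha.le; have := hH b (ha.le.trans hab); linarith
  refine ⟨?_, hHd⟩
  set d := V b - S (b - a) (V a) with hd
  have ed : prof V b - prof V a = S (-b) d := by
    rw [hd, S_sub, ← S_add]; unfold prof; congr 2; ring
  rw [ed, S_int_sq]
  have hHd' : H1sq d ≤ 4 * M := by rw [ed, H1sq_S] at hHd; exact hHd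
  have hLS : LS a b V (fun t => cubeS (V t)) :=
    br_LS ((hS b).mono ha.le le_rfl) hV M (fun t ht => glob_bd hS t (ha.le.trans ht.1))
  obtain ⟨hi, hle⟩ := int_32 ha hab
  have hPI := PI_bd hLS hab d (fun t => P * (CS * √(4 * M)) * t ^ (-(3/2):ℝ)) (hi.const_mul _) (fun t ht => by
    have ht0 : 0 < t := ha.trans ht.1
    show N43 (cubeS (V t)) * N4 (S (t - b) d) ≤ _
    rw [cubeS_N43]
    have h1 := glob_N4 hS hV t ht0
    have h2 : N4 (S (t - b) d) ≤ CS * √(4 * M) :=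
      (sobolev_S _ _).trans (mul_le_mul_of_nonneg_left (Real.sqrt_le_sqrt hHd') hCS)
    calc N4 (V t) ^ 3 * N4 (S (t - b) d) ≤ (P * t ^ (-(3/2):ℝ)) * (CS * √(4 * M)) :=
          mul_le_mul h1 h2 (N4_nonneg _) (mul_nonneg hP0 (Real.rpow_nonneg ht0.le _))
      _ = _ := by ring)
  rw [intervalIntegral.integral_const_mul, S_adj, ← integral_sub (sw_prod_int _ _) (sw_prod_int _ _)] at hPI
  have e1 : ∀ x, V b x * (starRingEnd ℂ) (d x) - S (-(a - b)) (V a) x * (starRingEnd ℂ) (d x) =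
      ((‖d x‖ ^ 2 : ℝ) : ℂ) := by
    intro x
    rw [← sub_mul, neg_sub, ← sub_apply, ← hd, Complex.mul_conj, Complex.normSq_eq_norm_sq]
  simp_rw [e1] at hPI
  rw [integral_complex_ofReal, Complex.norm_real, Real.norm_of_nonneg (integral_nonneg fun x => by positivity)] at hPI
  refine hPI.trans ?_
  rw [mul_assoc _ 2]
  exact mul_le_mul_of_nonneg_left hle (by positivity)

lemma interp_wt {s X L : ℝ} (hs0 : 0 < s) (hs1 : s < 1) (hX : 1 ≤ X) (hL : 1 ≤ L) :
    X ^ s ≤ L ^ (s - 1) * X + L := by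
  rcases le_total X L with h | h
  · have h1 : X ^ s ≤ X := by
      calc X ^ s ≤ X ^ (1:ℝ) := Real.rpow_le_rpow_of_exponent_le hX hs1.le
        _ = X := Real.rpow_one X
    have : 0 ≤ L ^ (s - 1) * X := mul_nonneg (Real.rpow_nonneg (by linarith) _) (by linarith)
    linarith
  · have h1 : X ^ s = X ^ (s - 1) * X := by
      rw [← Real.rpow_add_one (by linarith)]; congr 1; ring
    have h2 : X ^ (s - 1) ≤ L ^ (s - 1) := Real.rpow_le_rpow_of_nonpos (by linarith) h (by linarith)
    have := mul_le_mul_of_nonneg_right h2 (show 0 ≤ X by linarith)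
    linarith

def hsm (s : ℝ) : Measure E3 := volume.withDensity (fun ξ => ENNReal.ofReal ((1 + ‖ξ‖ ^ 2) ^ s))

lemma wt_meas (s : ℝ) : Measurable (fun ξ : E3 => ENNReal.ofReal ((1 + ‖ξ‖ ^ 2) ^ s)) := by
  fun_prop

lemma hsm_sq (s : ℝ) (f : E3 → ℂ) :
    eLpNorm f 2 (hsm s) ^ 2 = ∫⁻ ξ, ENNReal.ofReal ((1 + ‖ξ‖ ^ 2) ^ s) * (‖f ξ‖₊ : ℝ≥0∞) ^ 2 := by
  have h1 := eLpNorm_nnreal_pow_eq_lintegral (μ := hsm s) (f := f) (p := 2) (by norm_num)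
  have h2 : eLpNorm f 2 (hsm s) ^ 2 = ∫⁻ ξ, ‖f ξ‖ₑ ^ 2 ∂(hsm s) := by
    have : ((2 : NNReal) : ℝ) = ((2:ℕ):ℝ) := by norm_num
    rw [this] at h1
    simp_rw [ENNReal.rpow_natCast] at h1
    exact h1
  rw [h2, hsm, lintegral_withDensity_eq_lintegral_mul_non_measurable _ (wt_meas s)
    (Eventually.of_forall fun x => ENNReal.ofReal_lt_top)]
  rfl

lemma hsm_bd {s : ℝ} (hs0 : 0 < s) (hs1 : s < 1) {L : ℝ} (hL : 1 ≤ L) (f : SW) :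
    eLpNorm (𝓕 f : SW) 2 (hsm s) ^ 2 ≤ ENNReal.ofReal (L ^ (s - 1) * H1sq f + L * ∫ x, ‖f x‖ ^ 2) := by
  rw [hsm_sq]
  obtain ⟨hi, hle⟩ := weight_le f
  have hi2 : Integrable (fun ξ => ‖𝓕 f ξ‖ ^ 2) volume := sw_sq_int _
  have hLs : 0 ≤ L ^ (s - 1) := Real.rpow_nonneg (by linarith) _
  have hb : ∀ ξ : E3, ENNReal.ofReal ((1 + ‖ξ‖ ^ 2) ^ s) * (‖(𝓕 f : SW) ξ‖₊ : ℝ≥0∞) ^ 2 ≤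
      ENNReal.ofReal (L ^ (s - 1) * ((1 + ‖ξ‖ ^ 2) * ‖𝓕 f ξ‖ ^ 2) + L * ‖𝓕 f ξ‖ ^ 2) := by
    intro ξ
    have e : (‖(𝓕 f : SW) ξ‖₊ : ℝ≥0∞) ^ 2 = ENNReal.ofReal (‖𝓕 f ξ‖ ^ 2) := by
      rw [ENNReal.ofReal_pow (norm_nonneg _), ofReal_norm]; rfl
    rw [e, ← ENNReal.ofReal_mul (by positivity)]
    refine ENNReal.ofReal_le_ofReal ?_
    have := mul_le_mul_of_nonneg_right (interp_wt hs0 hs1 (X := 1 + ‖ξ‖ ^ 2) (by nlinarith [sq_nonneg ‖ξ‖]) hL)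
      (sq_nonneg ‖𝓕 f ξ‖)
    linarith
  refine (lintegral_mono hb).trans ?_
  have hi3 := (hi.const_mul (L ^ (s - 1))).add (hi2.const_mul L)
  have := ofReal_integral_eq_lintegral_ofReal hi3 (Eventually.of_forall fun ξ => by
    simp only [Pi.add_apply, Pi.zero_apply]; positivity)
  simp only [Pi.add_apply] at this
  rw [← this]
  refine ENNReal.ofReal_le_ofReal ?_
  rw [integral_add (hi.const_mul _) (hi2.const_mul _), integral_const_mul, integral_const_mul,
    SchwartzMap.integral_norm_sq_fourier]
  have := mul_le_mul_of_nonneg_left hle hLs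
  linarith

theorem scat_main
    (s : ℝ) (hs : 4/5 < s) (hs1 : s < 1)
    (φ : ℝ → E3 → ℂ) (hφ : IsGlobalSolution 1 1 (fun z => z) φ) :
    ∃ g : E3 → ℂ, Measurable g ∧
      (∫⁻ ξ : E3, ENNReal.ofReal ((1 + ‖ξ‖ ^ 2) ^ s) * (‖g ξ‖₊ : ℝ≥0∞) ^ 2) < ⊤ ∧
      Filter.Tendsto
        (fun t : ℝ => ∫⁻ ξ : E3, ENNReal.ofReal ((1 + ‖ξ‖ ^ 2) ^ s) *
          (‖𝓕 (φ t) ξ - Complex.exp (((-4) * π ^ 2 * t * ‖ξ‖ ^ 2 : ℝ) * Complex.I) * g ξ‖₊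
            : ℝ≥0∞) ^ 2)
        Filter.atTop (nhds 0) := by
  have hs0 : 0 < s := by linarith
  have hS := glob_Sol hφ
  choose V hV using (hS 0).sw
  obtain ⟨K, M, hK, hM, hKM⟩ := prof_cauchy hS hV
  have hmem : ∀ f : SW, MemLp (𝓕 f : SW) 2 (hsm s) := by
    intro f
    refine ⟨(𝓕 f : SW).continuous.measurable.aestronglyMeasurable, ?_⟩
    have := hsm_bd hs0 hs1 le_rfl f
    have h2 : eLpNorm (𝓕 f : SW) 2 (hsm s) ^ 2 < ⊤ := this.trans_lt ENNReal.ofReal_lt_top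
    by_contra hc
    rw [not_lt, top_le_iff] at hc
    rw [hc] at h2
    simp at h2
  set W : ℝ → Lp ℂ 2 (hsm s) := fun t => (hmem (prof V t)).toLp _ with hW
  set η : ℝ → ℝ := fun a => (a ^ (1/4:ℝ)) ^ (s - 1) * M + a ^ (1/4:ℝ) * (K * a ^ (-(1/2):ℝ)) with hη
  have hηt : Tendsto η atTop (𝓝 0) := by
    have h1 : Tendsto (fun a : ℝ => a ^ (1/4:ℝ)) atTop atTop := tendsto_rpow_atTop (by norm_num)
    have h2 : Tendsto (fun a : ℝ => a ^ (-(1 - s))) atTop (𝓝 0) := tendsto_rpow_neg_atTop (by linarith)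
    have h3 : Tendsto (fun a : ℝ => a ^ (-(1/4):ℝ)) atTop (𝓝 0) := tendsto_rpow_neg_atTop (by norm_num)
    have h4 := ((h2.comp h1).mul_const M).add (h3.const_mul K)
    rw [zero_mul, mul_zero, add_zero] at h4
    refine h4.congr' ?_
    filter_upwards [eventually_gt_atTop 0] with a ha
    simp only [Function.comp, hη]
    rw [neg_sub]
    have : a ^ (-(1/4):ℝ) = a ^ (1/4:ℝ) * a ^ (-(1/2):ℝ) := by
      rw [← Real.rpow_add ha]; norm_num
    rw [this]; ring
  have hη0 : ∀ a, 0 ≤ a → 0 ≤ η a := fun a ha => by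
    simp only [hη]; positivity
  have hdist : ∀ a b, 1 ≤ a → a ≤ b → dist (W a) (W b) ≤ √(η a) := by
    intro a b ha hab
    have ha0 : 0 < a := by linarith
    rw [dist_comm]
    refine Real.le_sqrt_of_sq_le ?_
    have e : edist (W b) (W a) = eLpNorm (𝓕 (prof V b - prof V a) : SW) 2 (hsm s) := by
      rw [hW, Lp.edist_toLp_toLp]
      congr 1
      have e0 : (𝓕 (prof V b - prof V a) : SW) = 𝓕 (prof V b) - 𝓕 (prof V a) :=
        map_sub (FourierTransform.fourierCLE ℂ SW) _ _
      rw [e0]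
      rfl
    have h1 := hsm_bd hs0 hs1 (Real.one_le_rpow ha (by norm_num : (0:ℝ) ≤ 1/4)) (prof V b - prof V a)
    rw [← e, edist_dist, ← ENNReal.ofReal_pow dist_nonneg] at h1
    obtain ⟨k1, k2⟩ := hKM a b ha0 hab
    have hp1 : 0 ≤ (a ^ (1/4:ℝ)) ^ (s - 1) := by positivity
    have hp2 : 0 ≤ a ^ (1/4:ℝ) := by positivity
    have h2 : (a ^ (1/4:ℝ)) ^ (s - 1) * H1sq (prof V b - prof V a) +
        a ^ (1/4:ℝ) * ∫ x, ‖(prof V b - prof V a) x‖ ^ 2 ≤ η a :=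
      add_le_add (mul_le_mul_of_nonneg_left k2 hp1) (mul_le_mul_of_nonneg_left k1 hp2)
    exact (ENNReal.ofReal_le_ofReal_iff (hη0 a ha0.le)).1 (h1.trans (ENNReal.ofReal_le_ofReal h2))
  have hmax : Tendsto (fun t : ℝ => max t 1) atTop atTop := tendsto_atTop_mono (fun t => le_max_left t 1) tendsto_id
  have hC : CauchySeq (fun t : ℝ => W (max t 1)) := by
    refine cauchySeq_of_le_tendsto_0' (fun t => √(η (max t 1)))
      (fun a b hab => hdist _ _ (le_max_right _ _) (max_le_max_right 1 hab)) ?_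
    have := (hηt.comp hmax).sqrt
    rw [Real.sqrt_zero] at this
    exact this
  have : Fact ((1:ℝ≥0∞) ≤ 2) := ⟨by norm_num⟩
  obtain ⟨G, hG⟩ := cauchySeq_tendsto_of_complete hC
  refine ⟨G, (Lp.stronglyMeasurable G).measurable, ?_, ?_⟩
  · rw [← hsm_sq]
    exact ENNReal.pow_lt_top (Lp.eLpNorm_lt_top G)
  · have hG2 : Tendsto (fun t : ℝ => edist (W (max t 1)) G) atTop (𝓝 0) := tendsto_iff_edist_tendsto_0.1 hG
    have hG3 := (ENNReal.Tendsto.pow (n := 2) hG2).congr' (f₂ := fun t => edist (W t) G ^ 2) (by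
      filter_upwards [eventually_ge_atTop 1] with t ht
      rw [max_eq_left ht])
    simp only [ne_eq, OfNat.ofNat_ne_zero, not_false_eq_true, zero_pow] at hG3
    refine hG3.congr fun t => ?_
    have e1 : edist (W t) G = eLpNorm (fun ξ => (𝓕 (prof V t) : SW) ξ - G ξ) 2 (hsm s) := by
      rw [Lp.edist_def]
      exact eLpNorm_congr_ae ((hmem (prof V t)).coeFn_toLp.sub (Filter.EventuallyEq.refl _ _))
    rw [e1, hsm_sq]
    refine lintegral_congr fun ξ => ?_
    congr 2
    have e2 : φ t = V t := funext (hV t)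
    have e3 : 𝓕 (φ t) ξ = mS t ξ * 𝓕 (prof V t) ξ := by
      rw [e2, ← prof_fourier, SchwartzMap.fourier_coe]
    rw [e3]
    have e4 : mS t ξ * 𝓕 (prof V t) ξ - Complex.exp (((-4) * π ^ 2 * t * ‖ξ‖ ^ 2 : ℝ) * Complex.I) * G ξ =
       mS t ξ * (𝓕 (prof V t) ξ - G ξ) := by rw [mul_sub]; rfl
    rw [e4]
    have e5 : ‖mS t ξ‖₊ = 1 := NNReal.eq (norm_mS t ξ)
    rw [nnnorm_mul, e5, one_mul]

end Part18

end Helpers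

/-- (Scattering: existence of the asymptotic state.) Let
`s ∈ (4/5, 1)`, `φ₀ ∈ C_c^∞(ℝ³)` and let `φ` be a smooth decaying global solution of
the cubic defocusing NLS on `[0,∞) × ℝ³` with `φ(0) = φ₀`.  Then there is a measurable
`g : ℝ³ → ℂ` with `∫ (1+|ξ|²)^s |g(ξ)|² dξ < ∞` such that
`∫ (1+|ξ|²)^s |𝓕(φ(t))(ξ) − e^{−4π²it|ξ|²} g(ξ)|² dξ → 0` as `t → ∞`; that is, `φ(t)`
converges in `H^s` to the free evolution `e^{itΔ} φ⁺` of the state `φ⁺` with `𝓕φ⁺ = g`. -/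
theorem scattering_asymptotic_state
    (s : ℝ) (hs : 4/5 < s) (hs1 : s < 1)
    (φ₀ : E3 → ℂ) (hφ₀sm : ContDiff ℝ ∞ φ₀) (hφ₀c : HasCompactSupport φ₀)
    (φ : ℝ → E3 → ℂ) (hφ : IsGlobalSolution 1 1 (fun z => z) φ) (hφ0 : φ 0 = φ₀) :
    ∃ g : E3 → ℂ, Measurable g ∧
      (∫⁻ ξ : E3, ENNReal.ofReal ((1 + ‖ξ‖ ^ 2) ^ s) * (‖g ξ‖₊ : ℝ≥0∞) ^ 2) < ⊤ ∧
      Filter.Tendsto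
        (fun t : ℝ => ∫⁻ ξ : E3, ENNReal.ofReal ((1 + ‖ξ‖ ^ 2) ^ s) *
          (‖𝓕 (φ t) ξ - Complex.exp (((-4) * π ^ 2 * t * ‖ξ‖ ^ 2 : ℝ) * Complex.I) * g ξ‖₊
            : ℝ≥0∞) ^ 2)
        Filter.atTop (nhds 0) := by
  exact scat_main s hs hs1 φ hφ
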